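/- Assume 0 < p < 1 is real and the family Ψ_n satisfies properties (P1)–(P6). Then for each k ≥ 0, the component of ψ_n at the alternating spin configuration ↑↓↑↓⋯↑↓↑ (length 2n+1, starting and ending with ↑) is: (ψ_{2k})_{↑↓⋯↑↓↑} = 2^k · H_{2k} · H_{2k}(J₂) and (ψ_{2k+1})_{↑↓⋯↑↓↑} = 2^k · H_{2k} · H_{2(k+1)}(J₂), where J₂ = −1/2 and the polynomials H are evaluated at the parameter ζ = (ϑ₁(η,p²)/ϑ₄(η,p²))². -/

import Mathlib

noncomputable section

open Complex
open scoped BigOperators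

/-- Jacobi theta function `ϑ₁(z|τ)` with nome `p = e^{iπτ}` (Whittaker–Watson convention). -/
def th1 (z τ : ℂ) : ℂ :=
  -Complex.I * ∑' n : ℤ, (-1 : ℂ) ^ n *
    Complex.exp ((Real.pi : ℂ) * Complex.I * τ * ((n : ℂ) + 1/2) ^ 2 + (2 * (n : ℂ) + 1) * Complex.I * z)

/-- Jacobi theta function `ϑ₂(z|τ)`. -/
def th2 (z τ : ℂ) : ℂ :=
  ∑' n : ℤ,
    Complex.exp ((Real.pi : ℂ) * Complex.I * τ * ((n : ℂ) + 1/2) ^ 2 + (2 * (n : ℂ) + 1) * Complex.I * z)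

/-- Jacobi theta function `ϑ₃(z|τ)`. -/
def th3 (z τ : ℂ) : ℂ :=
  ∑' n : ℤ, Complex.exp ((Real.pi : ℂ) * Complex.I * τ * (n : ℂ) ^ 2 + 2 * (n : ℂ) * Complex.I * z)

/-- Jacobi theta function `ϑ₄(z|τ)`. -/
def th4 (z τ : ℂ) : ℂ :=
  ∑' n : ℤ, (-1 : ℂ) ^ n *
    Complex.exp ((Real.pi : ℂ) * Complex.I * τ * (n : ℂ) ^ 2 + 2 * (n : ℂ) * Complex.I * z)

/-- The crossing parameter `η = π/3`. -/
def ηc : ℂ := (Real.pi : ℂ) / 3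

/-- The elliptic nome `p = e^{iπτ}`. -/
def pnome (τ : ℂ) : ℂ := Complex.exp ((Real.pi : ℂ) * Complex.I * τ)

/-- `ζ = (ϑ₁(η,p²)/ϑ₄(η,p²))²`. -/
def zet (τ : ℂ) : ℂ := (th1 ηc (2 * τ) / th4 ηc (2 * τ)) ^ 2

/-- The nome `p` is real with `0 < p < 1`. -/
def preal (τ : ℂ) : Prop := (pnome τ).im = 0 ∧ 0 < (pnome τ).re ∧ (pnome τ).re < 1

/-- A tuple given by a list of prescribed entries, padded by zeros. -/
def padded {n : ℕ} (l : List ℂ) : Fin n → ℂ := fun j => l.getD (j : ℕ) 0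

/-- Extension of a tuple by a list of prescribed further entries (padded by zeros). -/
def extL {m n : ℕ} (w : Fin m → ℂ) (l : List ℂ) : Fin n → ℂ :=
  fun j => if h : (j : ℕ) < m then w ⟨j, h⟩ else l.getD ((j : ℕ) - m) 0

/-- First `k` entries of a `2k`-tuple. -/
def firstHalf {k : ℕ} (x : Fin (2 * k) → ℂ) : Fin k → ℂ :=
  fun i => x ⟨(i : ℕ), by have := i.2; omega⟩

/-- Last `k` entries of a `2k`-tuple. -/
def secondHalf {k : ℕ} (x : Fin (2 * k) → ℂ) : Fin k → ℂ :=
  fun i => x ⟨k + (i : ℕ), by have := i.2; omega⟩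

/-- `𝕙(x,y) = ϑ₁(x−y+η)ϑ₁(x−y−η)ϑ₁(x+y+η)ϑ₁(x+y−η)`. -/
def hh (τ x y : ℂ) : ℂ :=
  th1 (x - y + ηc) τ * th1 (x - y - ηc) τ * th1 (x + y + ηc) τ * th1 (x + y - ηc) τ

/-- `𝔻(x₁,…,x_k) = ∏_{i<j} ϑ₁(x_j−x_i)ϑ₁(x_j+x_i)`. -/
def vdTheta (τ : ℂ) {k : ℕ} (y : Fin k → ℂ) : ℂ :=
  ∏ i : Fin k, ∏ j : Fin k, if i < j then th1 (y j - y i) τ * th1 (y j + y i) τ else 1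

/-- The elliptic Tsuchiya determinant `ℍ_{2k}(x₁,…,x_k; x_{k+1},…,x_{2k})`. -/
def tsuchiya (τ : ℂ) (k : ℕ) (x : Fin (2 * k) → ℂ) : ℂ :=
  (∏ i : Fin k, ∏ j : Fin k, hh τ (firstHalf x i) (secondHalf x j))
    / (vdTheta τ (firstHalf x) * vdTheta τ (secondHalf x))
    * Matrix.det (Matrix.of fun i j : Fin k => (hh τ (firstHalf x i) (secondHalf x j))⁻¹)

/-- The expression defining the elliptic Tsuchiya determinant is well defined:
the Vandermonde-type denominators and the entries `𝕙(x_i,x_{j+k})` are nonzero. -/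
def tsuDefined (τ : ℂ) (k : ℕ) (x : Fin (2 * k) → ℂ) : Prop :=
  (∀ i j : Fin k, i ≠ j →
    th1 (firstHalf x j - firstHalf x i) τ ≠ 0 ∧ th1 (firstHalf x j + firstHalf x i) τ ≠ 0) ∧
  (∀ i j : Fin k, i ≠ j →
    th1 (secondHalf x j - secondHalf x i) τ ≠ 0 ∧ th1 (secondHalf x j + secondHalf x i) τ ≠ 0) ∧
  (∀ i j : Fin k, hh τ (firstHalf x i) (secondHalf x j) ≠ 0)

/-- `h(w,w') = 1 − (3+ζ²)ww' + (1−ζ²)ww'(w+w')`. -/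
def hpol (ζ w w' : ℂ) : ℂ := 1 - (3 + ζ ^ 2) * w * w' + (1 - ζ ^ 2) * w * w' * (w + w')

/-- Vandermonde product `Δ(w₁,…,w_k) = ∏_{i<j}(w_j − w_i)`. -/
def vdm {k : ℕ} (y : Fin k → ℂ) : ℂ :=
  ∏ i : Fin k, ∏ j : Fin k, if i < j then y j - y i else 1

/-- The determinant-ratio expression defining the polynomial `H_{2k}`. -/
def Hratio (ζ : ℂ) (k : ℕ) (w : Fin (2 * k) → ℂ) : ℂ :=
  (∏ i : Fin k, ∏ j : Fin k, hpol ζ (firstHalf w i) (secondHalf w j))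
    / (vdm (firstHalf w) * vdm (secondHalf w))
    * Matrix.det (Matrix.of fun i j : Fin k => (hpol ζ (firstHalf w i) (secondHalf w j))⁻¹)

/-- The expression `Hratio` is well defined at `w`. -/
def HratioDefined (ζ : ℂ) (k : ℕ) (w : Fin (2 * k) → ℂ) : Prop :=
  (∀ i j : Fin k, i ≠ j → firstHalf w i ≠ firstHalf w j) ∧
  (∀ i j : Fin k, i ≠ j → secondHalf w i ≠ secondHalf w j) ∧
  (∀ i j : Fin k, hpol ζ (firstHalf w i) (secondHalf w j) ≠ 0)

/-- `H` is the family of Rosengren–Zinn-Justin polynomials `H_{2k}` for parameter `ζ`: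
for each `k`, `H k` is a polynomial function of the `2k` variables agreeing with the
determinant-ratio formula wherever the latter is defined, and `H 0 = 1`. -/
def IsHFamily (ζ : ℂ) (H : (k : ℕ) → (Fin (2 * k) → ℂ) → ℂ) : Prop :=
  (∀ w, H 0 w = 1) ∧
  (∀ k : ℕ, ∃ P : MvPolynomial (Fin (2 * k)) ℂ, ∀ w, H k w = MvPolynomial.eval w P) ∧
  (∀ (k : ℕ) (w : Fin (2 * k) → ℂ), HratioDefined ζ k w → H k w = Hratio ζ k w)

/-- Vertex weight `a(u)`. -/
def av (τ u : ℂ) : ℂ := th4 (2*ηc) (2*τ) * th1 (u + 2*ηc) (2*τ) * th4 u (2*τ)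
/-- Vertex weight `b(u)`. -/
def bv (τ u : ℂ) : ℂ := th4 (2*ηc) (2*τ) * th4 (u + 2*ηc) (2*τ) * th1 u (2*τ)
/-- Vertex weight `c(u)`. -/
def cv (τ u : ℂ) : ℂ := th1 (2*ηc) (2*τ) * th4 (u + 2*ηc) (2*τ) * th4 u (2*τ)
/-- Vertex weight `d(u)`. -/
def dv (τ u : ℂ) : ℂ := th1 (2*ηc) (2*τ) * th1 (u + 2*ηc) (2*τ) * th1 u (2*τ)
/-- `r(u) = a(u) + b(u)`. -/
def rv (τ u : ℂ) : ℂ := av τ u + bv τ u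

/-- Entries of the `R`-matrix of the eight-vertex model, in the basis `{↑↑,↑↓,↓↑,↓↓}`
identified with `Fin 2 × Fin 2` (`↑ = 0`, `↓ = 1`). -/
def Rent (τ u : ℂ) (p q : Fin 2 × Fin 2) : ℂ :=
  if p = q then (if p.1 = p.2 then av τ u else bv τ u)
  else if q = (p.2, p.1) then cv τ u
  else if p.1 = p.2 ∧ q.1 = q.2 then dv τ u
  else 0

/-- Entries of `Ř(u) = 𝒫 R(u)`. -/
def Rcheckent (τ u : ℂ) (p q : Fin 2 × Fin 2) : ℂ := Rent τ u (p.2, p.1) q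

/-- The boundary vector `χ(x) ∈ ℂ²⊗ℂ²`. -/
def chiV (τ lam x : ℂ) : Fin 2 × Fin 2 → ℂ := fun p =>
  if p = ((0 : Fin 2), (1 : Fin 2)) then th1 (x + lam) (2*τ) * th4 (x - lam - 2*ηc) (2*τ)
  else if p = ((1 : Fin 2), (0 : Fin 2)) then th1 (x - lam - 2*ηc) (2*τ) * th4 (x + lam) (2*τ)
  else 0

/-- The boundary vector `χ̄(x) ∈ ℂ²⊗ℂ²`. -/
def chibarV (τ lam x : ℂ) : Fin 2 × Fin 2 → ℂ := fun p =>
  if p = ((0 : Fin 2), (0 : Fin 2)) then th1 (x + lam) (2*τ) * th1 (x - lam - 2*ηc) (2*τ)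
  else if p = ((1 : Fin 2), (1 : Fin 2)) then th4 (x - lam - 2*ηc) (2*τ) * th4 (x + lam) (2*τ)
  else 0

/-- A family `Ψ_n(u₁,…,u_{2n+1}) ∈ (ℂ²)^{⊗(2n+1)}`, represented by its components
with respect to spin configurations `α : Fin (2n+1) → Fin 2` (`↑ = 0`, `↓ = 1`). -/
abbrev PsiFam := (n : ℕ) → (Fin (2 * n + 1) → ℂ) → (Fin (2 * n + 1) → Fin 2) → ℂ

/-- The action of `Ř(u)` on tensor factors `i`, `j` of `(ℂ²)^{⊗L}`. -/
def applyRc (τ u : ℂ) {L : ℕ} (i j : Fin L) (ψ : (Fin L → Fin 2) → ℂ) :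
    (Fin L → Fin 2) → ℂ := fun α =>
  ∑ s : Fin 2, ∑ t : Fin 2,
    Rcheckent τ u (α i, α j) (s, t) * ψ (Function.update (Function.update α i s) j t)

/-- Spin flip. -/
def flipS : Fin 2 → Fin 2 := fun s => if s = 0 then 1 else 0

/-- Components of the singlet `s = ↑↓ − ↓↑`. -/
def singletC : Fin 2 → Fin 2 → ℂ := fun s t =>
  if s = 0 ∧ t = 1 then 1 else if s = 1 ∧ t = 0 then -1 else 0

/-- Delete the entries at positions `i`, `i+1` from a tuple. -/
def delTwo {α : Type*} {n : ℕ} (i : ℕ) (u : Fin (2 * (n + 1) + 1) → α) : Fin (2 * n + 1) → α :=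
  fun j => if _h : (j : ℕ) < i then u ⟨j, by have := j.2; omega⟩
           else u ⟨(j : ℕ) + 2, by have := j.2; omega⟩

/-- The components of `Ψ_n` are entire functions of each `u_i`. -/
def PsiEntire (Ψ : PsiFam) : Prop :=
  ∀ (n : ℕ) (u : Fin (2*n+1) → ℂ) (i : Fin (2*n+1)) (α : Fin (2*n+1) → Fin 2),
    Differentiable ℂ fun z => Ψ n (Function.update u i z) α

/-- (P1): the exchange relations. -/
def PsiP1 (τ : ℂ) (Ψ : PsiFam) : Prop :=
  ∀ (n : ℕ) (u : Fin (2*n+1) → ℂ) (i j : Fin (2*n+1)), (j : ℕ) = (i : ℕ) + 1 →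
    applyRc τ (u j - u i) i j (Ψ n u)
      = fun α => rv τ (u j - u i) * Ψ n (fun l => u (Equiv.swap i j l)) α

/-- (P2): local spin flips. -/
def PsiP2 (τ : ℂ) (Ψ : PsiFam) : Prop :=
  ∀ (n : ℕ) (u : Fin (2*n+1) → ℂ) (i : Fin (2*n+1)) (α : Fin (2*n+1) → Fin 2),
    Ψ n u (Function.update α i (flipS (α i)))
      = (-(pnome τ)) ^ n * Complex.exp (-Complex.I * ∑ j, (u j - u i))
        * Ψ n (Function.update u i (u i + Real.pi * τ)) α

/-- (P3): quasi-periodicity of `Ψ_n` in each `u_i`. -/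
def PsiP3 (τ : ℂ) (Ψ : PsiFam) : Prop :=
  ∀ (n : ℕ) (u : Fin (2*n+1) → ℂ) (i : Fin (2*n+1)),
    (Ψ n (Function.update u i (u i + Real.pi))
      = fun α => (∏ j ∈ Finset.univ.erase i, (if α j = 0 then (1:ℂ) else -1)) * Ψ n u α) ∧
    (Ψ n (Function.update u i (u i + 2 * Real.pi * τ))
      = fun α => (pnome τ ^ (4*n))⁻¹ *
          Complex.exp (-2 * Complex.I * ∑ j, (u i - u j)) * Ψ n u α)

/-- (P4): the wheel condition. -/
def PsiP4 (Ψ : PsiFam) : Prop :=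
  ∀ (n : ℕ) (u : Fin (2*n+1) → ℂ),
    (∃ i j k : Fin (2*n+1), i < j ∧ j < k ∧ u j = u i + 2*ηc ∧ u k = u i + 4*ηc) →
    Ψ n u = 0

/-- (P5): the reduction relations. -/
def PsiP5 (τ : ℂ) (Ψ : PsiFam) : Prop :=
  ∀ (n : ℕ) (u : Fin (2*(n+1)+1) → ℂ) (i : ℕ) (hi : i + 1 < 2*(n+1)+1),
    u ⟨i+1, hi⟩ = u ⟨i, by omega⟩ + 2*ηc →
    Ψ (n+1) u = fun α =>
      (∏ j ∈ (Finset.univ.erase (⟨i, by omega⟩ : Fin (2*(n+1)+1))).erase ⟨i+1, hi⟩,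
          th1 (u ⟨i, by omega⟩ - u j - 2*ηc) τ)
        * singletC (α ⟨i, by omega⟩) (α ⟨i+1, hi⟩)
        * Ψ n (delTwo i u) (delTwo i α)

/-- (P6): `Ψ₀ = ↑ + ↓`. -/
def PsiP6 (Ψ : PsiFam) : Prop := ∀ u α, Ψ 0 u α = 1

/-- The inhomogeneity parameters `(x₁,−x₁,…,x_n,−x_n,0)`. -/
def interleave {n : ℕ} (x : Fin n → ℂ) : Fin (2*n+1) → ℂ := fun j =>
  if h : (j : ℕ) < 2*n then
    (if (j : ℕ) % 2 = 0 then x ⟨(j:ℕ)/2, by omega⟩ else -x ⟨(j:ℕ)/2, by omega⟩)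
  else 0

/-- Components of `χ(x)`. -/
def chiC (τ lam x : ℂ) (s t : Fin 2) : ℂ :=
  if s = 0 ∧ t = 1 then th1 (x + lam) (2*τ) * th4 (x - lam - 2*ηc) (2*τ)
  else if s = 1 ∧ t = 0 then th1 (x - lam - 2*ηc) (2*τ) * th4 (x + lam) (2*τ)
  else 0

/-- Components of `χ̄(x)`. -/
def chibarC (τ lam x : ℂ) (s t : Fin 2) : ℂ :=
  if s = 0 ∧ t = 0 then th1 (x + lam) (2*τ) * th1 (x - lam - 2*ηc) (2*τ)
  else if s = 1 ∧ t = 1 then th4 (x - lam - 2*ηc) (2*τ) * th4 (x + lam) (2*τ)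
  else 0

/-- The scalar product `Z_n(x₁,…,x_n) = ⟨ξ_n(x₁,…,x_n), Ψ_n(x₁,−x₁,…,x_n,−x_n,0)⟩`. -/
def Zfun (τ lam : ℂ) (Ψ : PsiFam) (n : ℕ) (x : Fin n → ℂ) : ℂ :=
  ∑ α : Fin (2*n+1) → Fin 2,
    (∏ m : Fin n, chiC τ lam (x m)
        (α ⟨2*(m:ℕ), by have := m.2; omega⟩) (α ⟨2*(m:ℕ)+1, by have := m.2; omega⟩))
      * (if α ⟨2*n, by omega⟩ = 0 then (1:ℂ) else 0)
      * Ψ n (interleave x) α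

/-- The scalar product `Z̄_n^±(x₁,…,x_n)`, with `ε = ±1`. -/
def Zbarfun (τ lam ε : ℂ) (Ψ : PsiFam) (n : ℕ) (x : Fin n → ℂ) : ℂ :=
  ∑ α : Fin (2*n+1) → Fin 2,
    (∏ m : Fin n, chibarC τ lam (x m)
        (α ⟨2*(m:ℕ), by have := m.2; omega⟩) (α ⟨2*(m:ℕ)+1, by have := m.2; omega⟩))
      * (if α ⟨2*n, by omega⟩ = 0 then (1:ℂ) else ε)
      * Ψ n (interleave x) α

/-- The normalisation constant `𝒩_n`. -/
def Ncoef (τ : ℂ) (n : ℕ) : ℂ :=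
  (-1 : ℂ) ^ ((n+1)/2) * (th1 ηc τ ^ (n^2))⁻¹ * (th4 0 (2*τ) / th4 ηc (2*τ)) ^ (n*(n+1)/2)

/-- The vector `ψ_n = 𝒩_n Ψ_n(0,…,0)`. -/
def psiH (τ : ℂ) (Ψ : PsiFam) (n : ℕ) (α : Fin (2*n+1) → Fin 2) : ℂ :=
  Ncoef τ n * Ψ n (fun _ => 0) α

/-- The scalar product `S_n(μ) = ((⟨↑↓| + μ⟨↓↑|)^{⊗n} ⊗ ⟨↑|) ψ_n`. -/
def Sfun (τ : ℂ) (Ψ : PsiFam) (n : ℕ) (μ : ℂ) : ℂ :=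
  ∑ α : Fin (2*n+1) → Fin 2,
    (∏ m : Fin n,
      (if α ⟨2*(m:ℕ), by have := m.2; omega⟩ = 0 ∧ α ⟨2*(m:ℕ)+1, by have := m.2; omega⟩ = 1
        then (1:ℂ)
       else if α ⟨2*(m:ℕ), by have := m.2; omega⟩ = 1 ∧ α ⟨2*(m:ℕ)+1, by have := m.2; omega⟩ = 0
        then μ
       else 0))
      * (if α ⟨2*n, by omega⟩ = 0 then (1:ℂ) else 0) * psiH τ Ψ n α

/-- The scalar product `S̄_n^±(ν) = ((⟨↑↑| + ν⟨↓↓|)^{⊗n} ⊗ (⟨↑| ± ⟨↓|)) ψ_n`, with `ε = ±1`. -/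
def Sbarfun (τ ε : ℂ) (Ψ : PsiFam) (n : ℕ) (ν : ℂ) : ℂ :=
  ∑ α : Fin (2*n+1) → Fin 2,
    (∏ m : Fin n,
      (if α ⟨2*(m:ℕ), by have := m.2; omega⟩ = 0 ∧ α ⟨2*(m:ℕ)+1, by have := m.2; omega⟩ = 0
        then (1:ℂ)
       else if α ⟨2*(m:ℕ), by have := m.2; omega⟩ = 1 ∧ α ⟨2*(m:ℕ)+1, by have := m.2; omega⟩ = 1
        then ν
       else 0))
      * (if α ⟨2*n, by omega⟩ = 0 then (1:ℂ) else ε) * psiH τ Ψ n α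

/-- The alternating spin configuration `↑↓↑↓⋯↑`. -/
def altConf {L : ℕ} : Fin L → Fin 2 := fun j => if (j : ℕ) % 2 = 0 then 0 else 1

/-- The fully polarised spin configuration `↓⋯↓`. -/
def downConf {L : ℕ} : Fin L → Fin 2 := fun _ => 1

/-- The spin configuration `↑⋯↑↓` with a single `↓` at the last site. -/
def lastDownConf {n : ℕ} : Fin (2*n+1) → Fin 2 := fun j => if (j : ℕ) = 2*n then 1 else 0

/-- `J₂ = −1/2`. -/
def J2c : ℂ := -(1/2)
/-- `J₃ = 1/(1+ζ)`. -/
def J3c (ζ : ℂ) : ℂ := 1/(1+ζ)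
/-- `J₄ = 1/(1−ζ)`. -/
def J4c (ζ : ℂ) : ℂ := 1/(1-ζ)
/-- `μ̄ = (μ−1)²/((ζ²−1)μ)`. -/
def mubar (ζ μ : ℂ) : ℂ := (μ - 1)^2 / ((ζ^2 - 1)*μ)
/-- `ν̄ = (ν−ζ)(νζ−1)/((ζ²−1)ν)`. -/
def nubar (ζ ν : ℂ) : ℂ := (ν - ζ)*(ν*ζ - 1) / ((ζ^2 - 1)*ν)

/-- The elliptic function `w(x)`. -/
def wfun (τ x : ℂ) : ℂ :=
  th4 ηc (2*τ) / th4 0 (2*τ) * th1 x τ ^ 2 / (th1 (x - ηc) τ * th1 (x + ηc) τ)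

/-- `β₂ = η + π/2`. -/
def β2c : ℂ := ηc + (Real.pi : ℂ)/2
/-- `β₃ = η + π/2 + πτ/2`. -/
def β3c (τ : ℂ) : ℂ := ηc + (Real.pi : ℂ)/2 + (Real.pi : ℂ)*τ/2
/-- `β₄ = η + πτ/2`. -/
def β4c (τ : ℂ) : ℂ := ηc + (Real.pi : ℂ)*τ/2

/-- `f` is an (even) theta function of degree `m`, nome `p = e^{iπτ}` and norm `0`
with respect to each of its variables. -/
def ThetaLike (τ : ℂ) (m : ℕ) {n : ℕ} (X : (Fin n → ℂ) → ℂ) : Prop :=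
  ∀ (x : Fin n → ℂ) (i : Fin n),
    Differentiable ℂ (fun z => X (Function.update x i z)) ∧
    (∀ z, X (Function.update x i (z + Real.pi)) = X (Function.update x i z)) ∧
    (∀ z, X (Function.update x i (z + Real.pi * τ))
        = ((-(pnome τ)) ^ m)⁻¹ * Complex.exp (-2 * Complex.I * ((m : ℂ) * z))
            * X (Function.update x i z)) ∧
    (∀ z, X (Function.update x i (-z)) = X (Function.update x i z))

open scoped Topology

lemma th3_eq_jacobiTheta₂ (z τ : ℂ) : th3 z τ = jacobiTheta₂ (z / Real.pi) τ := by
  unfold th3 jacobiTheta₂ jacobiTheta₂_term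
  refine tsum_congr fun n => ?_
  have : (Real.pi : ℂ) ≠ 0 := by exact_mod_cast Real.pi_ne_zero
  congr 1
  field_simp
  ring

lemma exp_int_pi (n : ℤ) : Complex.exp ((n : ℂ) * (Real.pi * Complex.I)) = (-1) ^ n := by
  rw [Complex.exp_int_mul, Complex.exp_pi_mul_I]

lemma th4_eq_th3 (z τ : ℂ) : th4 z τ = th3 (z + Real.pi / 2) τ := by
  unfold th3 th4
  refine tsum_congr fun n => ?_
  rw [← exp_int_pi, ← Complex.exp_add]
  congr 1
  ring

lemma th2_eq_th3 (z τ : ℂ) : th2 z τ =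
    Complex.exp (Complex.I * Real.pi * τ / 4 + Complex.I * z) * th3 (z + Real.pi * τ / 2) τ := by
  unfold th3 th2
  rw [← tsum_mul_left]
  refine tsum_congr fun n => ?_
  rw [← Complex.exp_add]
  congr 1
  ring

lemma th2_add_half_pi (z τ : ℂ) : th2 (z + Real.pi / 2) τ = - th1 z τ := by
  unfold th2 th1
  rw [neg_mul, neg_neg, ← tsum_mul_left]
  refine tsum_congr fun n => ?_
  have h : (Complex.I) = Complex.exp (Real.pi / 2 * Complex.I) := by rw [Complex.exp_pi_div_two_mul_I]
  rw [← exp_int_pi, ← Complex.exp_add]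
  conv_rhs => enter [1]; rw [h]
  rw [← Complex.exp_add]
  congr 1
  ring

lemma th3_neg (z τ : ℂ) : th3 (-z) τ = th3 z τ := by
  rw [th3_eq_jacobiTheta₂, th3_eq_jacobiTheta₂, neg_div, jacobiTheta₂_neg_left]

lemma th3_add_pi (z τ : ℂ) : th3 (z + Real.pi) τ = th3 z τ := by
  have : (Real.pi : ℂ) ≠ 0 := by exact_mod_cast Real.pi_ne_zero
  rw [th3_eq_jacobiTheta₂, th3_eq_jacobiTheta₂, add_div, div_self this, jacobiTheta₂_add_left]

lemma th3_add_pi_tau (z τ : ℂ) : th3 (z + Real.pi * τ) τ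
    = Complex.exp (-(Complex.I * (Real.pi * τ + 2 * z))) * th3 z τ := by
  have : (Real.pi : ℂ) ≠ 0 := by exact_mod_cast Real.pi_ne_zero
  rw [th3_eq_jacobiTheta₂, th3_eq_jacobiTheta₂, add_div, mul_div_cancel_left₀ _ this,
    jacobiTheta₂_add_left']
  congr 2
  field_simp

lemma th1_eq_th2 (z τ : ℂ) : th1 z τ = - th2 (z + Real.pi / 2) τ := by
  rw [th2_add_half_pi, neg_neg]

lemma th1_eq_th4 (z τ : ℂ) : th1 z τ =
    -Complex.I * Complex.exp (Complex.I * Real.pi * τ / 4 + Complex.I * z) * th4 (z + Real.pi * τ / 2) τ := by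
  rw [th1_eq_th2, th2_eq_th3, th4_eq_th3]
  have h : (Complex.I) = Complex.exp (Real.pi / 2 * Complex.I) := by rw [Complex.exp_pi_div_two_mul_I]
  have : Complex.exp (Complex.I * Real.pi * τ / 4 + Complex.I * (z + Real.pi / 2))
    = Complex.I * Complex.exp (Complex.I * Real.pi * τ / 4 + Complex.I * z) := by
    conv_rhs => enter [1]; rw [h]
    rw [← Complex.exp_add]
    congr 1; ring
  rw [this]
  rw [show z + (Real.pi : ℂ) / 2 + Real.pi * τ / 2 = z + Real.pi * τ / 2 + Real.pi / 2 by ring]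
  ring

lemma th4_add_half_pi (z τ : ℂ) : th4 (z + Real.pi / 2) τ = th3 z τ := by
  rw [th4_eq_th3, ← th3_add_pi z]; congr 1; ring

lemma th4_neg (z τ : ℂ) : th4 (-z) τ = th4 z τ := by
  rw [th4_eq_th3, th4_eq_th3, ← th3_neg, ← th3_add_pi]; congr 1; ring

lemma th4_add_pi (z τ : ℂ) : th4 (z + Real.pi) τ = th4 z τ := by
  rw [th4_eq_th3, th4_eq_th3, ← th3_add_pi (z + _)]; congr 1; ring

lemma th4_sub_pi (z τ : ℂ) : th4 (z - Real.pi) τ = th4 z τ := by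
  rw [← th4_add_pi, sub_add_cancel]

lemma exp_neg_pi_I' : Complex.exp (Complex.I * Real.pi) = -1 := by
  rw [mul_comm, Complex.exp_pi_mul_I]

lemma th4_add_pi_tau (z τ : ℂ) : th4 (z + Real.pi * τ) τ
    = -Complex.exp (-(Complex.I * (Real.pi * τ + 2 * z))) * th4 z τ := by
  rw [th4_eq_th3, th4_eq_th3, show z + (Real.pi : ℂ) * τ + Real.pi / 2 = z + Real.pi / 2 + Real.pi * τ by ring,
    th3_add_pi_tau]
  rw [show -(Complex.I * (Real.pi * τ + 2 * (z + Real.pi / 2))) = -(Complex.I * (Real.pi * τ + 2 * z)) - Complex.I * Real.pi by ring,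
    Complex.exp_sub, exp_neg_pi_I']
  ring

lemma th2_neg (z τ : ℂ) : th2 (-z) τ = th2 z τ := by
  rw [th2_eq_th3, th2_eq_th3, ← th3_neg,
    show z + (Real.pi : ℂ) * τ / 2 = -(-z + Real.pi * τ / 2) + Real.pi * τ by ring, th3_add_pi_tau,
    ← mul_assoc, ← Complex.exp_add]
  congr 2; ring

lemma th2_add_pi (z τ : ℂ) : th2 (z + Real.pi) τ = -th2 z τ := by
  rw [th2_eq_th3, th2_eq_th3, ← th3_add_pi (z + _),
    show Complex.I * Real.pi * τ / 4 + Complex.I * (z + Real.pi)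
      = Complex.I * Real.pi * τ / 4 + Complex.I * z + Complex.I * Real.pi by ring, Complex.exp_add _ (I * Real.pi),
    exp_neg_pi_I', show z + (Real.pi : ℂ) + Real.pi * τ / 2 = z + Real.pi * τ / 2 + Real.pi by ring]
  ring

lemma th1_add_pi (z τ : ℂ) : th1 (z + Real.pi) τ = -th1 z τ := by
  rw [th1_eq_th2, th1_eq_th2, show z + (Real.pi : ℂ) + Real.pi / 2 = z + Real.pi / 2 + Real.pi by ring, th2_add_pi]

lemma th1_sub_pi (z τ : ℂ) : th1 (z - Real.pi) τ = -th1 z τ := by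
  have := th1_add_pi (z - Real.pi) τ
  rw [sub_add_cancel] at this
  rw [this, neg_neg]

lemma th1_add_half_pi (z τ : ℂ) : th1 (z + Real.pi / 2) τ = th2 z τ := by
  rw [th1_eq_th2, show z + (Real.pi : ℂ) / 2 + Real.pi / 2 = z + Real.pi by ring, th2_add_pi, neg_neg]

lemma th1_neg (z τ : ℂ) : th1 (-z) τ = -th1 z τ := by
  rw [th1_eq_th2, ← th2_neg, show -(-z + (Real.pi : ℂ) / 2) = z - Real.pi / 2 by ring,
   th1_eq_th2, show z + (Real.pi : ℂ) / 2 = z - Real.pi / 2 + Real.pi by ring, th2_add_pi, neg_neg]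

lemma th1_zero (τ : ℂ) : th1 0 τ = 0 := by
  have := th1_neg 0 τ
  rw [neg_zero] at this
  exact self_eq_neg.mp this

lemma th1_add_pi_tau (z τ : ℂ) : th1 (z + Real.pi * τ) τ
    = -Complex.exp (-(Complex.I * (Real.pi * τ + 2 * z))) * th1 z τ := by
  rw [th1_eq_th4, th1_eq_th4 z, show z + (Real.pi : ℂ) * τ + Real.pi * τ / 2 = z + Real.pi * τ / 2 + Real.pi * τ by ring,
    th4_add_pi_tau]
  have : Complex.exp (Complex.I * Real.pi * τ / 4 + Complex.I * (z + Real.pi * τ)) *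
     Complex.exp (-(Complex.I * (Real.pi * τ + 2 * (z + Real.pi * τ / 2))))
     = Complex.exp (-(Complex.I * (Real.pi * τ + 2 * z))) * Complex.exp (Complex.I * Real.pi * τ / 4 + Complex.I * z) := by
    rw [← Complex.exp_add, ← Complex.exp_add]; congr 1; ring
  linear_combination (Complex.I * th4 (z + Real.pi * τ / 2) τ) * this

lemma th1_add_pi_tau_double (z τ : ℂ) : th1 (z + Real.pi * τ) (2 * τ)
    = Complex.I * Complex.exp (-(Complex.I * (Real.pi * τ / 2 + z))) * th4 z (2 * τ) := by
  rw [th1_eq_th4, show z + (Real.pi : ℂ) * τ + Real.pi * (2 * τ) / 2 = z + Real.pi * (2 * τ) by ring,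
    th4_add_pi_tau]
  have : Complex.exp (Complex.I * Real.pi * (2 * τ) / 4 + Complex.I * (z + Real.pi * τ)) *
     Complex.exp (-(Complex.I * (Real.pi * (2 * τ) + 2 * z)))
     = Complex.exp (-(Complex.I * (Real.pi * τ / 2 + z))) := by
    rw [← Complex.exp_add]; congr 1; ring
  linear_combination (Complex.I * th4 z (2 * τ)) * this

lemma th4_add_pi_tau_double (z τ : ℂ) : th4 (z + Real.pi * τ) (2 * τ)
    = Complex.I * Complex.exp (-(Complex.I * (Real.pi * τ / 2 + z))) * th1 z (2 * τ) := by
  rw [th1_eq_th4, show z + (Real.pi : ℂ) * (2 * τ) / 2 = z + Real.pi * τ by ring]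
  have : Complex.exp (Complex.I * Real.pi * (2 * τ) / 4 + Complex.I * z) *
     Complex.exp (-(Complex.I * (Real.pi * τ / 2 + z)))
     = 1 := by
    rw [← Complex.exp_add, ← Complex.exp_zero]; congr 1; ring
  linear_combination (Complex.I * Complex.I * th4 (z + Real.pi * τ) (2 * τ)) * this + th4 (z + Real.pi * τ) (2 * τ) * Complex.I_sq

lemma th3_summable (z : ℂ) {τ : ℂ} (hτ : 0 < τ.im) : Summable fun n : ℤ =>
    Complex.exp ((Real.pi : ℂ) * Complex.I * τ * (n : ℂ) ^ 2 + 2 * (n : ℂ) * Complex.I * z) := by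
  refine ((summable_jacobiTheta₂_term_iff (z / Real.pi) τ).mpr hτ).congr fun n => ?_
  have : (Real.pi : ℂ) ≠ 0 := by exact_mod_cast Real.pi_ne_zero
  unfold jacobiTheta₂_term
  congr 1
  field_simp
  ring

lemma th2_summable (z : ℂ) {τ : ℂ} (hτ : 0 < τ.im) : Summable fun n : ℤ =>
    Complex.exp ((Real.pi : ℂ) * Complex.I * τ * ((n : ℂ) + 1/2) ^ 2 + (2 * (n : ℂ) + 1) * Complex.I * z) := by
  refine ((th3_summable (z + Real.pi * τ / 2) hτ).mul_left
    (Complex.exp (Complex.I * Real.pi * τ / 4 + Complex.I * z))).congr fun n => ?_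
  rw [← Complex.exp_add]
  congr 1
  ring

lemma th3_differentiable {τ : ℂ} (hτ : 0 < τ.im) : Differentiable ℂ fun z => th3 z τ := by
  intro z
  simp_rw [th3_eq_jacobiTheta₂]
  exact DifferentiableAt.comp (f := fun z : ℂ => z / Real.pi) z (differentiableAt_jacobiTheta₂_fst (z / Real.pi) hτ)
    (by fun_prop)

lemma th4_differentiable {τ : ℂ} (hτ : 0 < τ.im) : Differentiable ℂ fun z => th4 z τ := by
  simp_rw [th4_eq_th3]
  exact (th3_differentiable hτ).comp (by fun_prop)

lemma th2_differentiable {τ : ℂ} (hτ : 0 < τ.im) : Differentiable ℂ fun z => th2 z τ := by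
  simp_rw [th2_eq_th3]
  exact Differentiable.mul (by fun_prop) ((th3_differentiable hτ).comp (f := fun z => z + Real.pi * τ / 2) (by fun_prop))

lemma th1_differentiable {τ : ℂ} (hτ : 0 < τ.im) : Differentiable ℂ fun z => th1 z τ := by
  simp_rw [th1_eq_th2]
  exact ((th2_differentiable hτ).comp (f := fun z : ℂ => z + Real.pi / 2) (by fun_prop)).neg

/-- Splitting `ℤ × ℤ` according to the parity of the sum of the coordinates. -/
def paritySplit : (ℤ × ℤ) ⊕ (ℤ × ℤ) ≃ ℤ × ℤ where
  toFun := Sum.elim (fun k => (k.1 + k.2, k.1 - k.2)) (fun k => (k.1 + k.2 + 1, k.1 - k.2))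
  invFun n := if (n.1 + n.2) % 2 = 0 then .inl ((n.1 + n.2) / 2, (n.1 - n.2) / 2)
    else .inr ((n.1 + n.2) / 2, (n.1 - n.2) / 2)
  left_inv := by
    rintro (⟨a, b⟩ | ⟨a, b⟩)
    · have : (a + b + (a - b)) % 2 = 0 := by omega
      simp only [Sum.elim_inl, this, if_true, Sum.inl.injEq, Prod.mk.injEq]
      omega
    · have : ¬ (a + b + 1 + (a - b)) % 2 = 0 := by omega
      simp only [Sum.elim_inr, this, if_false, Sum.inr.injEq, Prod.mk.injEq]
      omega
  right_inv := by
    rintro ⟨a, b⟩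
    dsimp only
    split_ifs with h
    · simp only [Sum.elim_inl, Prod.mk.injEq]; omega
    · simp only [Sum.elim_inr, Prod.mk.injEq]; omega

lemma th3_mul_th3 (x y : ℂ) {τ : ℂ} (hτ : 0 < τ.im) : th3 x τ * th3 y τ =
    th3 (x + y) (2 * τ) * th3 (x - y) (2 * τ) + th2 (x + y) (2 * τ) * th2 (x - y) (2 * τ) := by
  have h2 : 0 < (2 * τ).im := by simpa using hτ
  unfold th3 th2
  rw [tsum_mul_tsum_of_summable_norm (th3_summable x hτ).norm (th3_summable y hτ).norm,
   tsum_mul_tsum_of_summable_norm (th3_summable _ h2).norm (th3_summable _ h2).norm,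
   tsum_mul_tsum_of_summable_norm (th2_summable _ h2).norm (th2_summable _ h2).norm]
  have e1 := (summable_mul_of_summable_norm (th3_summable (x + y) h2).norm (th3_summable (x - y) h2).norm)
  have e2 := (summable_mul_of_summable_norm (th2_summable (x + y) h2).norm (th2_summable (x - y) h2).norm)
  have g1 : ∀ c : ℤ × ℤ, Complex.exp ((Real.pi : ℂ) * I * τ * ((paritySplit (.inl c)).1 : ℂ) ^ 2
        + 2 * ((paritySplit (.inl c)).1 : ℂ) * I * x) *
      Complex.exp ((Real.pi : ℂ) * I * τ * ((paritySplit (.inl c)).2 : ℂ) ^ 2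
        + 2 * ((paritySplit (.inl c)).2 : ℂ) * I * y) =
      cexp (↑Real.pi * I * (2 * τ) * ↑c.1 ^ 2 + 2 * ↑c.1 * I * (x + y)) *
      cexp (↑Real.pi * I * (2 * τ) * ↑c.2 ^ 2 + 2 * ↑c.2 * I * (x - y)) := by
    intro c
    simp only [paritySplit, Equiv.coe_fn_mk, Sum.elim_inl]
    push_cast
    rw [← Complex.exp_add, ← Complex.exp_add]; congr 1; ring
  have g2 : ∀ c : ℤ × ℤ, Complex.exp ((Real.pi : ℂ) * I * τ * ((paritySplit (.inr c)).1 : ℂ) ^ 2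
        + 2 * ((paritySplit (.inr c)).1 : ℂ) * I * x) *
      Complex.exp ((Real.pi : ℂ) * I * τ * ((paritySplit (.inr c)).2 : ℂ) ^ 2
        + 2 * ((paritySplit (.inr c)).2 : ℂ) * I * y) =
      cexp (↑Real.pi * I * (2 * τ) * (↑c.1 + 1 / 2) ^ 2 + (2 * ↑c.1 + 1) * I * (x + y)) *
      cexp (↑Real.pi * I * (2 * τ) * (↑c.2 + 1 / 2) ^ 2 + (2 * ↑c.2 + 1) * I * (x - y)) := by
    intro c
    simp only [paritySplit, Equiv.coe_fn_mk, Sum.elim_inr]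
    push_cast
    rw [← Complex.exp_add, ← Complex.exp_add]; congr 1; ring
  rw [← paritySplit.tsum_eq, Summable.tsum_sum]
  · exact congrArg₂ _ (tsum_congr g1) (tsum_congr g2)
  · exact e1.congr fun c => (g1 c).symm
  · exact e2.congr fun c => (g2 c).symm

lemma th3_add_half_pi (z τ : ℂ) : th3 (z + Real.pi / 2) τ = th4 z τ := (th4_eq_th3 z τ).symm

lemma th4_mul_th3 (x y : ℂ) {τ : ℂ} (hτ : 0 < τ.im) : th4 x τ * th3 y τ =
    th4 (x + y) (2 * τ) * th4 (x - y) (2 * τ) + th1 (x + y) (2 * τ) * th1 (x - y) (2 * τ) := by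
  rw [th4_eq_th3, th3_mul_th3 _ _ hτ, show x + (Real.pi : ℂ) / 2 + y = x + y + Real.pi / 2 by ring,
    show x + (Real.pi : ℂ) / 2 - y = x - y + Real.pi / 2 by ring, th3_add_half_pi, th3_add_half_pi,
    th2_add_half_pi, th2_add_half_pi]
  ring

lemma th3_mul_th4 (x y : ℂ) {τ : ℂ} (hτ : 0 < τ.im) : th3 x τ * th4 y τ =
    th4 (x + y) (2 * τ) * th4 (x - y) (2 * τ) - th1 (x + y) (2 * τ) * th1 (x - y) (2 * τ) := by
  have h := th4_mul_th3 y x hτ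
  rw [show y - x = -(x - y) by ring, th4_neg, th1_neg, add_comm y x] at h
  linear_combination h

lemma th1_mul_th2 (x y : ℂ) {τ : ℂ} (hτ : 0 < τ.im) : th1 x τ * th2 y τ =
    th1 (x + y) (2 * τ) * th4 (x - y) (2 * τ) + th4 (x + y) (2 * τ) * th1 (x - y) (2 * τ) := by
  have h := th4_mul_th3 (x + Real.pi * τ / 2) (y + Real.pi * τ / 2) hτ
  rw [show x + (Real.pi : ℂ) * τ / 2 + (y + Real.pi * τ / 2) = x + y + Real.pi * τ by ring,
    show x + (Real.pi : ℂ) * τ / 2 - (y + Real.pi * τ / 2) = x - y by ring,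
    th4_add_pi_tau_double, th1_add_pi_tau_double] at h
  rw [th1_eq_th4 x, th2_eq_th3 y]
  have e : Complex.exp (Complex.I * Real.pi * τ / 4 + Complex.I * x) *
      Complex.exp (Complex.I * Real.pi * τ / 4 + Complex.I * y) *
      Complex.exp (-(Complex.I * (Real.pi * τ / 2 + (x + y)))) = 1 := by
    rw [← Complex.exp_add, ← Complex.exp_add, ← Complex.exp_zero]; congr 1; ring
  linear_combination (-Complex.I * Complex.exp (Complex.I * Real.pi * τ / 4 + Complex.I * x) *
      Complex.exp (Complex.I * Real.pi * τ / 4 + Complex.I * y)) * h -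
      Complex.I ^ 2 * (th1 (x + y) (2 * τ) * th4 (x - y) (2 * τ) + th4 (x + y) (2 * τ) * th1 (x - y) (2 * τ)) * e
      - (th1 (x + y) (2 * τ) * th4 (x - y) (2 * τ) + th4 (x + y) (2 * τ) * th1 (x - y) (2 * τ)) * Complex.I_sq

lemma two_th1_mul_th1 (x y : ℂ) {τ : ℂ} (hτ : 0 < τ.im) :
    2 * (th1 (x + y) (2 * τ) * th1 (x - y) (2 * τ)) = th4 x τ * th3 y τ - th3 x τ * th4 y τ := by
  rw [th4_mul_th3 _ _ hτ, th3_mul_th4 _ _ hτ]; ring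

lemma two_th4_mul_th4 (x y : ℂ) {τ : ℂ} (hτ : 0 < τ.im) :
    2 * (th4 (x + y) (2 * τ) * th4 (x - y) (2 * τ)) = th4 x τ * th3 y τ + th3 x τ * th4 y τ := by
  rw [th4_mul_th3 _ _ hτ, th3_mul_th4 _ _ hτ]; ring

lemma two_th1_mul_th4 (x y : ℂ) {τ : ℂ} (hτ : 0 < τ.im) :
    2 * (th1 (x + y) (2 * τ) * th4 (x - y) (2 * τ)) = th1 x τ * th2 y τ + th2 x τ * th1 y τ := by
  have h := th1_mul_th2 y x hτ
  rw [show y - x = -(x - y) by ring, th4_neg, th1_neg, add_comm y x] at h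
  rw [mul_comm (th2 x τ), h, th1_mul_th2 _ _ hτ]; ring

/-- The product `ϑ₁(x+y)ϑ₁(x-y)` separates in terms of theta functions of half the modulus. -/
lemma two_th1_mul_th1_half (x y : ℂ) {τ : ℂ} (hτ : 0 < τ.im) :
    2 * (th1 (x + y) τ * th1 (x - y) τ) =
      th4 x (τ / 2) * th3 y (τ / 2) - th3 x (τ / 2) * th4 y (τ / 2) := by
  have h := two_th1_mul_th1 x y (τ := τ / 2) (by
    rw [show τ / 2 = ((1 / 2 : ℝ) : ℂ) * τ by push_cast; ring, Complex.im_ofReal_mul]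
    positivity)
  rwa [show 2 * (τ / 2) = τ by ring] at h

lemma th1_mul_th2_zero (z : ℂ) {τ : ℂ} (hτ : 0 < τ.im) :
    th1 z τ * th2 0 τ = 2 * (th1 z (2 * τ) * th4 z (2 * τ)) := by
  rw [th1_mul_th2 _ _ hτ, add_zero, sub_zero]; ring

lemma th1_mul_th2_self (z : ℂ) {τ : ℂ} (hτ : 0 < τ.im) :
    th1 z τ * th2 z τ = th4 0 (2 * τ) * th1 (2 * z) (2 * τ) := by
  rw [th1_mul_th2 _ _ hτ, sub_self, th1_zero, two_mul]; ring

/-- Addition formula for `ϑ₄`. -/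
lemma th4_mul_th4_mul_sq (x y : ℂ) {τ : ℂ} (hτ : 0 < τ.im) :
    th4 (x + y) (2 * τ) * th4 (x - y) (2 * τ) * th4 0 (2 * τ) ^ 2 =
      th4 x (2 * τ) ^ 2 * th4 y (2 * τ) ^ 2 - th1 x (2 * τ) ^ 2 * th1 y (2 * τ) ^ 2 := by
  have h := two_th4_mul_th4 x y hτ
  have h0 := two_th4_mul_th4 0 0 hτ
  have hx := two_th4_mul_th4 x 0 hτ
  have hy := two_th4_mul_th4 y 0 hτ
  have kx := two_th1_mul_th1 x 0 hτ
  have ky := two_th1_mul_th1 y 0 hτ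
  simp only [add_zero, sub_zero] at h0 hx hy kx ky
  set a := th4 x τ
  set b := th3 x τ
  set c := th4 y τ
  set d := th3 y τ
  set e := th4 0 τ
  set f := th3 0 τ
  have q1 : th4 (x + y) (2 * τ) * th4 (x - y) (2 * τ) = (a * d + b * c) / 2 := by linear_combination h / 2
  have q2 : th4 0 (2 * τ) ^ 2 = e * f := by linear_combination h0 / 2
  have q3 : th4 x (2 * τ) ^ 2 = (a * f + b * e) / 2 := by linear_combination hx / 2
  have q4 : th4 y (2 * τ) ^ 2 = (c * f + d * e) / 2 := by linear_combination hy / 2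
  have q5 : th1 x (2 * τ) ^ 2 = (a * f - b * e) / 2 := by linear_combination kx / 2
  have q6 : th1 y (2 * τ) ^ 2 = (c * f - d * e) / 2 := by linear_combination ky / 2
  rw [q1, q2, q3, q4, q5, q6]; ring

lemma th4_two_mul (z : ℂ) {τ : ℂ} (hτ : 0 < τ.im) :
    th4 (2 * z) (2 * τ) * th4 0 (2 * τ) ^ 3 = th4 z (2 * τ) ^ 4 - th1 z (2 * τ) ^ 4 := by
  have h := th4_mul_th4_mul_sq z z hτ
  rw [← two_mul, sub_self] at h
  linear_combination h

/-- The integral of an entire `π`-periodic function over a period does not depend on the base point. -/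
lemma integral_period_shift {F : ℂ → ℂ} (hF : Differentiable ℂ F)
    (hper : ∀ z, F (z + Real.pi) = F z) (s : ℂ) :
    ∫ x in (0 : ℝ)..Real.pi, F (x + s) = ∫ x in (0 : ℝ)..Real.pi, F x := by
  obtain ⟨G, hG⟩ := hF.isExactOn_univ
  have hG : ∀ z, HasDerivAt G (F z) z := fun z => hG z (Set.mem_univ z)
  have key : ∀ s : ℂ, ∫ x in (0 : ℝ)..Real.pi, F (x + s) = G (s + Real.pi) - G s := by
    intro s
    have h := intervalIntegral.integral_eq_sub_of_hasDerivAt (a := 0) (b := Real.pi)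
      (f := fun x : ℝ => G (x + s)) (f' := fun x : ℝ => F (x + s)) (fun x _ => by
        have h1 : HasDerivAt (fun x : ℂ => G (x + s)) (F ((x : ℂ) + s)) (x : ℂ) := by
          simpa using (hG ((x : ℂ) + s)).comp_add_const (x : ℂ) s
        exact h1.comp_ofReal) (by
        apply Continuous.intervalIntegrable
        exact hF.continuous.comp (by fun_prop))
    rw [h]
    simp [add_comm]
  have hc : ∀ s, HasDerivAt (fun s => G (s + Real.pi) - G s) 0 s := by
    intro s
    have h1 : HasDerivAt (fun s : ℂ => G (s + Real.pi)) (F (s + Real.pi)) s := by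
      simpa using (hG (s + Real.pi)).comp_add_const s (Real.pi : ℂ)
    have h2 := h1.fun_sub (hG s)
    rwa [hper s, sub_self] at h2
  have hconst := is_const_of_deriv_eq_zero (f := fun s => G (s + Real.pi) - G s)
    (fun s => (hc s).differentiableAt) (fun s => (hc s).deriv)
  rw [key, hconst s 0, ← key 0]
  simp

/-- The Fourier coefficients (up to normalisation) of a `π`-periodic function. -/
def fourierInt (f : ℂ → ℂ) (n : ℤ) : ℂ :=
  ∫ x in (0 : ℝ)..Real.pi, f x * Complex.exp (-(2 * n * Complex.I * x))

lemma eq_zero_of_forall_real {f : ℂ → ℂ} (hf : Differentiable ℂ f) (h : ∀ x : ℝ, f x = 0) :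
    f = 0 := by
  have ha : AnalyticOnNhd ℂ f Set.univ := fun z _ => hf.analyticAt z
  refine ha.eq_of_frequently_eq (g := 0) (fun z _ => analyticAt_const) (z₀ := 0) ?_
  have ht : Filter.Tendsto (fun n : ℕ => (((1 : ℝ) / ((n : ℝ) + 1) : ℝ) : ℂ)) Filter.atTop (nhdsWithin 0 {0}ᶜ) := by
    rw [tendsto_nhdsWithin_iff]
    refine ⟨?_, Filter.Eventually.of_forall fun n => ?_⟩
    · have := (Complex.continuous_ofReal.tendsto 0).comp tendsto_one_div_add_atTop_nhds_zero_nat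
      simpa [Function.comp_def] using this
    · simp only [Set.mem_compl_iff, Set.mem_singleton_iff, Complex.ofReal_eq_zero]
      positivity
  exact ht.frequently (Filter.Frequently.of_forall fun n => h _)

lemma eq_zero_of_fourierInt {f : ℂ → ℂ} (hf : Differentiable ℂ f)
    (hper : ∀ z, f (z + Real.pi) = f z) (h : ∀ n, fourierInt f n = 0) : f = 0 := by
  apply eq_zero_of_forall_real hf
  have : Fact (0 < Real.pi) := ⟨Real.pi_pos⟩
  have hp : Function.Periodic (fun x : ℝ => f x) Real.pi := fun x => by
    simpa using hper x
  have hcont : Continuous (hp.lift : AddCircle Real.pi → ℂ) := by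
    refine continuous_coinduced_dom.mpr ?_
    exact hf.continuous.comp Complex.continuous_ofReal
  let g : C(AddCircle Real.pi, ℂ) := ⟨hp.lift, hcont⟩
  have hg : ∀ n, fourierCoeff g n = 0 := by
    intro n
    rw [fourierCoeff_eq_intervalIntegral _ n 0]
    have := h n
    unfold fourierInt at this
    rw [zero_add]
    rw [show (∫ x in (0 : ℝ)..Real.pi, fourier (-n) (x : AddCircle Real.pi) • g x) = 0 from ?_, smul_zero]
    rw [← this]
    refine intervalIntegral.integral_congr fun x _ => ?_
    have hpi : (Real.pi : ℂ) ≠ 0 := by exact_mod_cast Real.pi_ne_zero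
    simp only [fourier_coe_apply, g, ContinuousMap.coe_mk, smul_eq_mul]
    rw [mul_comm]
    congr 1
    congr 1
    push_cast
    field_simp
  have hs : Summable (fourierCoeff g) := by
    rw [show fourierCoeff (g : AddCircle Real.pi → ℂ) = fun _ => 0 from funext hg]; exact summable_zero
  have hsum := hasSum_fourier_series_of_summable hs
  simp only [hg, zero_smul] at hsum
  have g0 : g = 0 := hsum.unique hasSum_zero
  intro x
  have := congrArg (fun k : C(AddCircle Real.pi, ℂ) => k (x : AddCircle Real.pi)) g0
  simpa [g] using this

/-- Even theta functions of degree `2l` and nome `e^{iπτ}`. -/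
def evenTheta (τ : ℂ) (l : ℕ) : Submodule ℂ (ℂ → ℂ) where
  carrier := {f | Differentiable ℂ f ∧ (∀ z, f (z + Real.pi) = f z) ∧
    (∀ z, f (z + Real.pi * τ) = Complex.exp (-(l * (2 * Complex.I * (Real.pi * τ + 2 * z)))) * f z) ∧
    ∀ z, f (-z) = f z}
  add_mem' := by
    rintro f g ⟨a, b, c, d⟩ ⟨a', b', c', d'⟩
    refine ⟨a.add a', fun z => ?_, fun z => ?_, fun z => ?_⟩
    · simp [b, b']
    · simp only [Pi.add_apply, c, c']; ring
    · simp [d, d']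
  zero_mem' := by
    refine ⟨differentiable_const 0, ?_, ?_, ?_⟩ <;> simp
  smul_mem' := by
    rintro t f ⟨a, b, c, d⟩
    refine ⟨a.const_smul t, fun z => ?_, fun z => ?_, fun z => ?_⟩
    · simp [b]
    · simp only [Pi.smul_apply, c, smul_eq_mul]; ring
    · simp [d]

lemma evenTheta_mul {τ : ℂ} {l m : ℕ} {f g : ℂ → ℂ} (hf : f ∈ evenTheta τ l)
    (hg : g ∈ evenTheta τ m) : (fun z => f z * g z) ∈ evenTheta τ (l + m) := by
  obtain ⟨a, b, c, d⟩ := hf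
  obtain ⟨a', b', c', d'⟩ := hg
  refine ⟨a.mul a', fun z => ?_, fun z => ?_, fun z => ?_⟩
  · simp [b, b']
  · simp only [c, c']
    rw [Nat.cast_add, add_mul, neg_add, Complex.exp_add]; ring
  · simp [d, d']

lemma evenTheta_one (τ : ℂ) : (fun _ => 1) ∈ evenTheta τ 0 := by
  refine ⟨differentiable_const 1, ?_, ?_, ?_⟩ <;> simp

lemma evenTheta_prod {τ : ℂ} {ι : Type*} (s : Finset ι) (l : ι → ℕ) (f : ι → ℂ → ℂ)
    (h : ∀ i ∈ s, f i ∈ evenTheta τ (l i)) : (fun z => ∏ i ∈ s, f i z) ∈ evenTheta τ (∑ i ∈ s, l i) := by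
  classical
  induction s using Finset.induction_on with
  | empty => simpa using evenTheta_one τ
  | insert i s hi ih =>
    simp only [Finset.prod_insert hi, Finset.sum_insert hi]
    exact evenTheta_mul (h i (Finset.mem_insert_self i s))
      (ih fun j hj => h j (Finset.mem_insert_of_mem hj))

lemma evenTheta_pow {τ : ℂ} {l : ℕ} {f : ℂ → ℂ} (h : f ∈ evenTheta τ l) (n : ℕ) :
    (fun z => f z ^ n) ∈ evenTheta τ (n * l) := by
  simpa using evenTheta_prod (Finset.range n) (fun _ => l) (fun _ => f) fun _ _ => h

lemma th1_mul_mem_evenTheta {τ : ℂ} (hτ : 0 < τ.im) (a : ℂ) :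
    (fun z => th1 (z + a) τ * th1 (z - a) τ) ∈ evenTheta τ 1 := by
  have hd := th1_differentiable hτ
  refine ⟨?_, fun z => ?_, fun z => ?_, fun z => ?_⟩
  · exact (hd.comp (f := fun z : ℂ => z + a) (by fun_prop)).mul
      (hd.comp (f := fun z : ℂ => z - a) (by fun_prop))
  · dsimp only
    rw [show z + (Real.pi : ℂ) + a = z + a + Real.pi by ring,
      show z + (Real.pi : ℂ) - a = z - a + Real.pi by ring, th1_add_pi, th1_add_pi]; ring
  · dsimp only
    rw [show z + (Real.pi : ℂ) * τ + a = z + a + Real.pi * τ by ring,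
      show z + (Real.pi : ℂ) * τ - a = z - a + Real.pi * τ by ring, th1_add_pi_tau, th1_add_pi_tau]
    have : Complex.exp (-((1 : ℕ) * (2 * Complex.I * (Real.pi * τ + 2 * z)))) =
      Complex.exp (-(Complex.I * (Real.pi * τ + 2 * (z + a)))) *
        Complex.exp (-(Complex.I * (Real.pi * τ + 2 * (z - a)))) := by
      rw [← Complex.exp_add]; congr 1; push_cast; ring
    rw [this]; ring
  · dsimp only
    rw [show -z + a = -(z - a) by ring, show -z - a = -(z + a) by ring, th1_neg, th1_neg]; ring

lemma fourierInt_neg {τ : ℂ} {l : ℕ} {f : ℂ → ℂ} (hf : f ∈ evenTheta τ l) (n : ℤ) :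
    fourierInt f (-n) = fourierInt f n := by
  obtain ⟨a, b, c, d⟩ := hf
  unfold fourierInt
  have h := intervalIntegral.integral_comp_sub_left (a := 0) (b := Real.pi)
    (fun x : ℝ => f x * Complex.exp (-(2 * ((-n : ℤ) : ℂ) * Complex.I * x))) Real.pi
  rw [sub_self, sub_zero] at h
  rw [← h]
  refine intervalIntegral.integral_congr fun x _ => ?_
  push_cast
  rw [show f (Real.pi - x) = f x by rw [← d x, ← b (-x)]; congr 1; ring]
  have := Complex.exp_int_mul_two_pi_mul_I n
  rw [show -(2 * -(n : ℂ) * Complex.I * (Real.pi - x)) = n * (2 * Real.pi * Complex.I) + -(2 * n * Complex.I * x) by ring,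
    Complex.exp_add, this, one_mul]

lemma fourierInt_shift {τ : ℂ} {l : ℕ} {f : ℂ → ℂ} (hf : f ∈ evenTheta τ l) (n : ℤ) :
    fourierInt f (n + 2 * l) = Complex.exp (2 * (l + n) * Complex.I * Real.pi * τ) * fourierInt f n := by
  obtain ⟨a, b, c, d⟩ := hf
  have h := integral_period_shift (F := fun z => f z * Complex.exp (-(2 * n * Complex.I * z)))
    (a.mul (by fun_prop)) (fun z => by
      have := Complex.exp_int_mul_two_pi_mul_I (-n)
      rw [b, show -(2 * (n : ℂ) * Complex.I * (z + Real.pi)) =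
        ((-n : ℤ) : ℂ) * (2 * Real.pi * Complex.I) + -(2 * n * Complex.I * z) by push_cast; ring,
        Complex.exp_add, this, one_mul]) (Real.pi * τ)
  unfold fourierInt
  rw [← h, ← intervalIntegral.integral_const_mul]
  refine intervalIntegral.integral_congr fun x _ => ?_
  rw [c]
  have e : Complex.exp (-(2 * ((n + 2 * l : ℤ) : ℂ) * Complex.I * x)) =
    Complex.exp (2 * (l + n) * Complex.I * Real.pi * τ) *
     (Complex.exp (-(l * (2 * Complex.I * (Real.pi * τ + 2 * x)))) *
      Complex.exp (-(2 * n * Complex.I * (x + Real.pi * τ)))) := by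
    rw [← Complex.exp_add, ← Complex.exp_add]; congr 1; push_cast; ring
  rw [e]; ring

lemma evenTheta_eq_zero {τ : ℂ} {l : ℕ} (hl : 1 ≤ l) {f : ℂ → ℂ} (hf : f ∈ evenTheta τ l)
    (h : ∀ n : ℕ, n ≤ l → fourierInt f n = 0) : f = 0 := by
  have key : ∀ m : ℕ, fourierInt f m = 0 := by
    intro m
    induction m using Nat.strong_induction_on with
    | _ m ih =>
      by_cases hm : m ≤ l
      · exact h m hm
      · have e := fourierInt_shift hf ((m : ℤ) - 2 * l)
        rw [sub_add_cancel] at e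
        rw [e]
        by_cases h2 : 2 * l ≤ m
        · have := ih (m - 2 * l) (by omega)
          rw [Nat.cast_sub h2] at this
          push_cast at this
          rw [this, mul_zero]
        · have := ih (2 * l - m) (by omega)
          rw [Nat.cast_sub (by omega)] at this
          push_cast at this
          rw [← fourierInt_neg hf, neg_sub, this, mul_zero]
  refine eq_zero_of_fourierInt hf.1 hf.2.1 fun n => ?_
  rcases Int.eq_nat_or_neg n with ⟨m, rfl | rfl⟩
  · exact key m
  · rw [fourierInt_neg hf, key]

lemma fourierInt_add {f g : ℂ → ℂ} (hf : Continuous f) (hg : Continuous g) (n : ℤ) :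
    fourierInt (f + g) n = fourierInt f n + fourierInt g n := by
  unfold fourierInt
  rw [← intervalIntegral.integral_add]
  · simp [add_mul]
  · apply Continuous.intervalIntegrable; fun_prop
  · apply Continuous.intervalIntegrable; fun_prop

/-- The Fourier coefficients `0, …, l`, as a linear map. -/
def fourierMap (τ : ℂ) (l : ℕ) : evenTheta τ l →ₗ[ℂ] (Fin (l + 1) → ℂ) where
  toFun f n := fourierInt f (n : ℕ)
  map_add' f g := by
    ext n
    exact fourierInt_add f.2.1.continuous g.2.1.continuous _
  map_smul' t f := by
    ext n
    simp [fourierInt, mul_assoc]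

lemma fourierMap_injective {τ : ℂ} {l : ℕ} (hl : 1 ≤ l) : Function.Injective (fourierMap τ l) := by
  rw [← LinearMap.ker_eq_bot, LinearMap.ker_eq_bot']
  intro f hf
  have := evenTheta_eq_zero hl f.2 fun n hn => congrFun hf ⟨n, by omega⟩
  exact Subtype.ext this

/-- Evaluation at given points, as a linear map. -/
def evalMap (τ : ℂ) (l : ℕ) {ι : Type*} (a : ι → ℂ) : evenTheta τ l →ₗ[ℂ] (ι → ℂ) where
  toFun f i := (f : ℂ → ℂ) (a i)
  map_add' _ _ := rfl
  map_smul' _ _ := rfl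

lemma evalMap_surjective {τ : ℂ} (hτ : 0 < τ.im) {l : ℕ} (a : Fin (l + 1) → ℂ)
    (ha : ∀ i j, i ≠ j → th1 (a i + a j) τ ≠ 0 ∧ th1 (a i - a j) τ ≠ 0) :
    Function.Surjective (evalMap τ l a) := by
  have hmem : ∀ i, (fun z => ∏ j ∈ Finset.univ.erase i, (th1 (z + a j) τ * th1 (z - a j) τ)) ∈
      evenTheta τ l := by
    intro i
    have := evenTheta_prod (Finset.univ.erase i) (fun _ => 1)
      (fun j z => th1 (z + a j) τ * th1 (z - a j) τ) fun j _ => th1_mul_mem_evenTheta hτ (a j)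
    simpa using this
  have hne : ∀ i, ∏ j ∈ Finset.univ.erase i, (th1 (a i + a j) τ * th1 (a i - a j) τ) ≠ 0 := by
    intro i
    refine Finset.prod_ne_zero_iff.mpr fun j hj => ?_
    have := ha i j (Finset.ne_of_mem_erase hj).symm
    exact mul_ne_zero this.1 this.2
  intro v
  refine ⟨∑ i, (v i / ∏ j ∈ Finset.univ.erase i, (th1 (a i + a j) τ * th1 (a i - a j) τ)) •
    (⟨_, hmem i⟩ : evenTheta τ l), ?_⟩
  rw [map_sum]
  ext k
  rw [Finset.sum_apply, Finset.sum_eq_single k]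
  · simp only [map_smul, Pi.smul_apply, evalMap, LinearMap.coe_mk, AddHom.coe_mk, smul_eq_mul]
    rw [div_mul_cancel₀ _ (hne k)]
  · intro i _ hik
    simp only [map_smul, Pi.smul_apply, evalMap, LinearMap.coe_mk, AddHom.coe_mk, smul_eq_mul]
    have : ∏ j ∈ Finset.univ.erase i, (th1 (a k + a j) τ * th1 (a k - a j) τ) = 0 :=
      Finset.prod_eq_zero (i := k) (by simp [hik.symm]) (by rw [sub_self, th1_zero, mul_zero])
    rw [this, mul_zero]
  · simp

/-- An even theta function with sufficiently many zeros vanishes identically. -/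
lemma evenTheta_eq_zero_of_zeros {τ : ℂ} (hτ : 0 < τ.im) {l : ℕ} (hl : 1 ≤ l) {ι : Type*}
    [Fintype ι] (a : ι → ℂ) (hcard : l + 1 ≤ Fintype.card ι)
    (ha : ∀ i j, i ≠ j → th1 (a i + a j) τ ≠ 0 ∧ th1 (a i - a j) τ ≠ 0)
    {f : ℂ → ℂ} (hf : f ∈ evenTheta τ l) (h0 : ∀ i, f (a i) = 0) : f = 0 := by
  obtain ⟨e⟩ : Nonempty (Fin (l + 1) ↪ ι) :=
    Function.Embedding.nonempty_of_card_le (by simpa using hcard)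
  have : FiniteDimensional ℂ (evenTheta τ l) :=
    FiniteDimensional.of_injective _ (fourierMap_injective (τ := τ) hl)
  have hs := evalMap_surjective hτ (fun i => a (e i)) fun i j hij => ha _ _ (e.injective.ne hij)
  have h1 : Module.finrank ℂ (evenTheta τ l) ≤ l + 1 := by
    simpa using LinearMap.finrank_le_finrank_of_injective (fourierMap_injective (τ := τ) hl)
  have h2 : l + 1 ≤ Module.finrank ℂ (evenTheta τ l) := by
    simpa using LinearMap.finrank_le_finrank_of_surjective hs
  have hi := (LinearMap.injective_iff_surjective_of_finrank_eq_finrank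
    (by simpa using le_antisymm h1 h2)).mpr hs
  have : (⟨f, hf⟩ : evenTheta τ l) = 0 := hi (by
    rw [map_zero]; ext i; exact h0 (e i))
  exact congrArg Subtype.val this

lemma integral_exp_two_int (n : ℤ) (hn : n ≠ 0) :
    ∫ x in (0 : ℝ)..Real.pi, Complex.exp (2 * n * Complex.I * x) = 0 := by
  have hn' : (2 * n * Complex.I : ℂ) ≠ 0 := by simp [hn]
  rw [integral_exp_mul_complex hn']
  have := Complex.exp_int_mul_two_pi_mul_I n
  rw [show 2 * (n : ℂ) * Complex.I * Real.pi = n * (2 * Real.pi * Complex.I) by ring, this]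
  simp

lemma integral_th3 {τ : ℂ} (hτ : 0 < τ.im) : ∫ x in (0 : ℝ)..Real.pi, th3 x τ = Real.pi := by
  have h := intervalIntegral.hasSum_integral_of_dominated_convergence (ι := ℤ) (μ := MeasureTheory.volume)
    (a := 0) (b := Real.pi)
    (F := fun n x => Complex.exp ((Real.pi : ℂ) * Complex.I * τ * (n : ℂ) ^ 2 + 2 * (n : ℂ) * Complex.I * (x : ℝ)))
    (f := fun x : ℝ => th3 x τ)
    (fun n _ => ‖Complex.exp ((Real.pi : ℂ) * Complex.I * τ * (n : ℂ) ^ 2 + 2 * (n : ℂ) * Complex.I * 0)‖)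
    (fun n => by
      apply Continuous.aestronglyMeasurable
      fun_prop)
    (fun n => Filter.Eventually.of_forall fun x _ => by
      rw [Complex.norm_exp, Complex.norm_exp]
      apply le_of_eq
      congr 1
      simp)
    (Filter.Eventually.of_forall fun x _ => (th3_summable 0 hτ).norm)
    (by simp)
    (Filter.Eventually.of_forall fun x _ => (th3_summable x hτ).hasSum)
  have h2 : HasSum (fun n : ℤ => if n = 0 then (Real.pi : ℂ) else 0) Real.pi := by
    convert hasSum_ite_eq (0 : ℤ) (Real.pi : ℂ)
  refine h.unique ?_
  rw [show (fun n : ℤ => ∫ t in (0 : ℝ)..Real.pi,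
      Complex.exp ((Real.pi : ℂ) * Complex.I * τ * (n : ℂ) ^ 2 + 2 * (n : ℂ) * Complex.I * (t : ℝ))) =
      fun n : ℤ => if n = 0 then (Real.pi : ℂ) else 0 from funext fun n => ?_]
  · exact h2
  split_ifs with hn
  · subst hn; simp
  · simp_rw [Complex.exp_add]
    rw [intervalIntegral.integral_const_mul, integral_exp_two_int n hn, mul_zero]

lemma th3_ne_zero {τ : ℂ} (hτ : 0 < τ.im) : ¬ ∀ z, th3 z τ = 0 := by
  intro h
  have := integral_th3 hτ
  simp only [h, intervalIntegral.integral_zero] at this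
  exact Real.pi_ne_zero (by exact_mod_cast this.symm)

lemma th4_ne_zero {τ : ℂ} (hτ : 0 < τ.im) : ¬ ∀ z, th4 z τ = 0 := fun h =>
  th3_ne_zero hτ fun z => by rw [← th4_add_half_pi, h]

lemma th1_ne_zero {τ : ℂ} (hτ : 0 < τ.im) : ¬ ∀ z, th1 z τ = 0 := by
  intro h
  refine th4_ne_zero hτ fun z => ?_
  have := th1_eq_th4 (z - Real.pi * τ / 2) τ
  rw [h, sub_add_cancel] at this
  have h1 := Complex.exp_ne_zero (Complex.I * Real.pi * τ / 4 + Complex.I * (z - Real.pi * τ / 2))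
  simpa [h1] using this.symm

lemma entire_mul_eq_zero {f g : ℂ → ℂ} (hf : Differentiable ℂ f) (hg : Differentiable ℂ g)
    (h : ∀ z, f z * g z = 0) : (∀ z, f z = 0) ∨ ∀ z, g z = 0 := by
  have := AnalyticOnNhd.eq_zero_or_eq_zero_of_mul_eq_zero (U := Set.univ)
    (fun z _ => hf.analyticAt z) (fun z _ => hg.analyticAt z) (fun z _ => h z) isPreconnected_univ
  simpa using this

lemma half_im_pos {τ : ℂ} (hτ : 0 < τ.im) : 0 < (τ / 2).im := by
  rw [show τ / 2 = ((1 / 2 : ℝ) : ℂ) * τ by push_cast; ring, Complex.im_ofReal_mul]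
  positivity

lemma double_im_pos {τ : ℂ} (hτ : 0 < τ.im) : 0 < (2 * τ).im := by simpa using hτ

lemma th3_th4_no_common_zero {τ : ℂ} (hτ : 0 < τ.im) (x : ℂ) (h3 : th3 x (τ / 2) = 0)
    (h4 : th4 x (τ / 2) = 0) : False := by
  have h : ∀ y, th1 (x + y) τ * th1 (x - y) τ = 0 := by
    intro y
    have := two_th1_mul_th1_half x y hτ
    rw [h3, h4] at this
    simpa using this
  have hd := th1_differentiable hτ
  rcases entire_mul_eq_zero (hd.comp (f := fun y : ℂ => x + y) (by fun_prop))
    (hd.comp (f := fun y : ℂ => x - y) (by fun_prop)) h with h' | h'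
  · exact th1_ne_zero hτ fun z => by simpa using h' (z - x)
  · exact th1_ne_zero hτ fun z => by simpa using h' (x - z)

lemma th1_zero_periodic_tau (τ : ℂ) : Function.Periodic (fun z => th1 z τ = 0) (Real.pi * τ) := by
  intro z
  simp [th1_add_pi_tau]

lemma th1_zero_periodic (τ : ℂ) : Function.Periodic (fun z => th1 z τ = 0) Real.pi := by
  intro z
  simp [th1_add_pi]

lemma th1_eq_zero_lattice {τ z : ℂ} (m n : ℤ) :
    th1 (z + m * Real.pi + n * (Real.pi * τ)) τ = 0 ↔ th1 z τ = 0 := by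
  have h1 := ((th1_zero_periodic_tau τ).int_mul n) (z + m * Real.pi)
  have h2 := ((th1_zero_periodic τ).int_mul m) z
  exact (h1.trans h2).to_iff

/-- The zeros of `ϑ₁` lie in the lattice generated by `π` and `πτ`. -/
lemma th1_eq_zero {τ a : ℂ} (hτ : 0 < τ.im) (ha : th1 a τ = 0) :
    ∃ m n : ℤ, a = m * Real.pi + n * (Real.pi * τ) := by
  have hσ := half_im_pos hτ
  set A : ℂ → ℂ := fun x => th3 x (τ / 2) with hA
  set B : ℂ → ℂ := fun x => th4 x (τ / 2) with hB
  have dA : Differentiable ℂ A := th3_differentiable hσ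
  have dB : Differentiable ℂ B := th4_differentiable hσ
  have nc : ∀ x, A x = 0 → B x ≠ 0 := fun x h h' => th3_th4_no_common_zero hτ x h h'
  have prop : ∀ b, th1 b τ = 0 → ∀ x, A x * B (x - b) = A (x - b) * B x := by
    intro b hb x
    have := two_th1_mul_th1_half x (x - b) hτ
    rw [show x - (x - b) = b by ring, hb] at this
    simp only [hA, hB]
    linear_combination this
  have hπ : th1 (Real.pi * τ / 2) τ ≠ 0 := by
    intro h
    have h := prop _ h
    have hz : ∀ x, A x * B x = 0 := by
      intro x
      have h3 := th3_add_pi_tau (x - Real.pi * τ / 2) (τ / 2)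
      have h4 := th4_add_pi_tau (x - Real.pi * τ / 2) (τ / 2)
      rw [show x - Real.pi * τ / 2 + Real.pi * (τ / 2) = x by ring] at h3 h4
      have e := Complex.exp_ne_zero (-(Complex.I * (Real.pi * (τ / 2) + 2 * (x - Real.pi * τ / 2))))
      have hx := h x
      simp only [hA, hB] at hx ⊢
      have : Complex.exp (-(Complex.I * (Real.pi * (τ / 2) + 2 * (x - Real.pi * τ / 2)))) *
          (th3 (x - Real.pi * τ / 2) (τ / 2) * th4 (x - Real.pi * τ / 2) (τ / 2)) = 0 := by
        rw [h3, h4] at hx; linear_combination hx / 2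
      have := (mul_eq_zero.mp this).resolve_left e
      rw [h3, h4]
      linear_combination (-(Complex.exp (-(Complex.I * (Real.pi * (τ / 2) + 2 * (x - Real.pi * τ / 2))))) ^ 2) * this
    rcases entire_mul_eq_zero dA dB hz with h' | h'
    · exact th3_ne_zero hσ h'
    · exact th4_ne_zero hσ h'
  have pr := prop a ha
  classical
  set c : ℂ → ℂ := fun x => if A x = 0 then B (x - a) / B x else A (x - a) / A x with hc
  have cA : ∀ x, A (x - a) = c x * A x := by
    intro x
    by_cases h : A x = 0
    · have := pr x
      simp only [hc, h, if_true, mul_zero]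
      rw [h, zero_mul] at this
      exact (mul_eq_zero.mp this.symm).resolve_right (nc x h)
    · simp only [hc, h, if_false]; rw [div_mul_cancel₀ _ h]
  have cB : ∀ x, B (x - a) = c x * B x := by
    intro x
    by_cases h : A x = 0
    · simp only [hc, h, if_true]; rw [div_mul_cancel₀ _ (nc x h)]
    · simp only [hc, h, if_false]
      field_simp
      linear_combination pr x
  have dc : Differentiable ℂ c := by
    intro x
    by_cases h : A x = 0
    · have hB0 := nc x h
      have : c =ᶠ[nhds x] fun y => B (y - a) / B y := by
        filter_upwards [dB.continuous.continuousAt.eventually_ne hB0] with y hy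
        rw [cB y, mul_div_cancel_right₀ _ hy]
      refine this.differentiableAt_iff.mpr ?_
      exact ((dB.comp (f := fun y : ℂ => y - a) (by fun_prop)) x).div (dB x) hB0
    · have : c =ᶠ[nhds x] fun y => A (y - a) / A y := by
        filter_upwards [dA.continuous.continuousAt.eventually_ne h] with y hy
        rw [cA y, mul_div_cancel_right₀ _ hy]
      refine this.differentiableAt_iff.mpr ?_
      exact ((dA.comp (f := fun y : ℂ => y - a) (by fun_prop)) x).div (dA x) h
  have cuniq : ∀ x t, A (x - a) = t * A x → B (x - a) = t * B x → c x = t := by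
    intro x t h h'
    by_cases h0 : A x = 0
    · rw [cB x] at h'; exact mul_right_cancel₀ (nc x h0) h'
    · rw [cA x] at h; exact mul_right_cancel₀ h0 h
  have cper : ∀ x, c (x + Real.pi) = c x := by
    intro x
    refine cuniq _ _ ?_ ?_
    · have := cA x
      simp only [hA] at this ⊢
      rw [show x + Real.pi - a = x - a + Real.pi by ring, th3_add_pi, th3_add_pi, this]
    · have := cB x
      simp only [hB] at this ⊢
      rw [show x + Real.pi - a = x - a + Real.pi by ring, th4_add_pi, th4_add_pi, this]
  have cq : ∀ x, c (x + Real.pi * (τ / 2)) = Complex.exp (2 * Complex.I * a) * c x := by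
    intro x
    have e : Complex.exp (-(Complex.I * (Real.pi * (τ / 2) + 2 * (x - a)))) =
      Complex.exp (2 * Complex.I * a) * Complex.exp (-(Complex.I * (Real.pi * (τ / 2) + 2 * x))) := by
      rw [← Complex.exp_add]; congr 1; ring
    refine cuniq _ _ ?_ ?_
    · have := cA x
      simp only [hA] at this ⊢
      rw [show x + Real.pi * (τ / 2) - a = x - a + Real.pi * (τ / 2) by ring, th3_add_pi_tau, th3_add_pi_tau,
        this, e]
      ring
    · have := cB x
      simp only [hB] at this ⊢
      rw [show x + Real.pi * (τ / 2) - a = x - a + Real.pi * (τ / 2) by ring, th4_add_pi_tau, th4_add_pi_tau,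
        this, e]
      ring
  have cne : c ≠ 0 := by
    intro h
    refine th3_ne_zero hσ fun z => ?_
    have := cA (z + a)
    rw [h] at this
    simpa [hA] using this
  obtain ⟨n, hn⟩ : ∃ n, fourierInt c n ≠ 0 := by
    by_contra hcon
    push Not at hcon
    exact cne (eq_zero_of_fourierInt dc cper hcon)
  have hs := integral_period_shift (F := fun z => c z * Complex.exp (-(2 * n * Complex.I * z)))
    (dc.mul (by fun_prop)) (fun z => by
      have := Complex.exp_int_mul_two_pi_mul_I (-n)
      rw [cper, show -(2 * (n : ℂ) * Complex.I * (z + Real.pi)) =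
        ((-n : ℤ) : ℂ) * (2 * Real.pi * Complex.I) + -(2 * n * Complex.I * z) by push_cast; ring,
        Complex.exp_add, this, one_mul]) (Real.pi * (τ / 2))
  have hs2 : Complex.exp (2 * Complex.I * a - n * Complex.I * Real.pi * τ) * fourierInt c n = fourierInt c n := by
    conv_rhs => rw [fourierInt, ← hs]
    rw [fourierInt, ← intervalIntegral.integral_const_mul]
    refine intervalIntegral.integral_congr fun x _ => ?_
    rw [cq, show Complex.exp (-(2 * n * Complex.I * (x + Real.pi * (τ / 2)))) =
      Complex.exp (-(2 * n * Complex.I * x)) * Complex.exp (- (n * Complex.I * Real.pi * τ)) by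
      rw [← Complex.exp_add]; congr 1; ring, sub_eq_add_neg, Complex.exp_add]
    ring
  have hs3 : Complex.exp (2 * Complex.I * a - n * Complex.I * Real.pi * τ) = 1 :=
    mul_right_cancel₀ hn (by rw [hs2, one_mul])
  obtain ⟨m, hm⟩ := Complex.exp_eq_one_iff.mp hs3
  have ea : a = m * Real.pi + n * (Real.pi * τ / 2) := by
    have : Complex.I * (a - (m * Real.pi + n * (Real.pi * τ / 2))) = 0 := by linear_combination hm / 2
    exact sub_eq_zero.mp ((mul_eq_zero.mp this).resolve_left Complex.I_ne_zero)
  rcases Int.even_or_odd' n with ⟨j, rfl | rfl⟩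
  · exact ⟨m, j, by rw [ea]; push_cast; ring⟩
  · exfalso
    apply hπ
    rw [← th1_eq_zero_lattice m j, ← ha, ea]
    congr 1; push_cast; ring

lemma th1_real_ne_zero {τ : ℂ} (hτ : 0 < τ.im) (r s : ℝ) (h : ¬ ((∃ m : ℤ, r = m) ∧ ∃ n : ℤ, s = n)) :
    th1 (r * Real.pi + s * (Real.pi * τ)) τ ≠ 0 := by
  intro h0
  obtain ⟨m, n, hmn⟩ := th1_eq_zero hτ h0
  have e : (((r - m) * Real.pi : ℝ) : ℂ) + (((s - n) * Real.pi : ℝ) : ℂ) * τ = 0 := by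
    push_cast; linear_combination hmn
  have him := congrArg Complex.im e
  rw [Complex.add_im, Complex.ofReal_im, Complex.im_ofReal_mul, zero_add, Complex.zero_im] at him
  have hs : s = n := by
    have := (mul_eq_zero.mp ((mul_eq_zero.mp him).resolve_right hτ.ne')).resolve_right Real.pi_ne_zero
    linarith
  subst hs
  have hre := congrArg Complex.re e
  rw [Complex.add_re, Complex.ofReal_re, Complex.re_ofReal_mul] at hre
  have hr : r = m := by
    have : (r - m) * Real.pi = 0 := by simpa using hre
    have := (mul_eq_zero.mp this).resolve_right Real.pi_ne_zero
    linarith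
  exact h ⟨⟨m, hr⟩, ⟨n, rfl⟩⟩

lemma not_int_of_between {r : ℝ} (k : ℤ) (h1 : (k : ℝ) < r) (h2 : r < k + 1) : ¬ ∃ m : ℤ, r = m := by
  rintro ⟨m, rfl⟩
  have h1 : k < m := by exact_mod_cast h1
  have h2 : m < k + 1 := by exact_mod_cast h2
  omega

lemma th1_eta_ne {τ : ℂ} (hτ : 0 < τ.im) : th1 ηc τ ≠ 0 := by
  have := th1_real_ne_zero hτ (1 / 3) 0 (fun h => not_int_of_between 0 (by norm_num) (by norm_num) h.1)
  convert this using 2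
  unfold ηc; push_cast; ring

lemma th2_zero_ne {τ : ℂ} (hτ : 0 < τ.im) : th2 0 τ ≠ 0 := by
  have := th1_real_ne_zero hτ (1 / 2) 0 (fun h => not_int_of_between 0 (by norm_num) (by norm_num) h.1)
  rw [← th1_add_half_pi]
  convert this using 2
  push_cast; ring

lemma th2_eta_ne {τ : ℂ} (hτ : 0 < τ.im) : th2 ηc τ ≠ 0 := by
  have := th1_real_ne_zero hτ (5 / 6) 0 (fun h => not_int_of_between 0 (by norm_num) (by norm_num) h.1)
  rw [← th1_add_half_pi]
  convert this using 2
  unfold ηc; push_cast; ring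

lemma two_eta : 2 * ηc = Real.pi - ηc := by unfold ηc; ring

lemma th1_add_two_eta (y τ : ℂ) : th1 (y + 2 * ηc) τ = -th1 (y - ηc) τ := by
  rw [two_eta, ← th1_add_pi]; congr 1; ring

lemma th1_sub_two_eta (y τ : ℂ) : th1 (y - 2 * ηc) τ = -th1 (y + ηc) τ := by
  rw [two_eta, ← th1_sub_pi]; congr 1; ring

lemma th4_add_two_eta (y τ : ℂ) : th4 (y + 2 * ηc) τ = th4 (y - ηc) τ := by
  rw [two_eta, ← th4_add_pi (y - ηc)]; congr 1; ring

lemma th2_add_two_eta (y τ : ℂ) : th2 (y + 2 * ηc) τ = -th2 (y - ηc) τ := by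
  rw [two_eta, ← th2_add_pi]; congr 1; ring

lemma th1_two_eta (τ : ℂ) : th1 (2 * ηc) τ = th1 ηc τ := by
  have := th1_add_two_eta 0 τ
  rwa [zero_add, zero_sub, th1_neg, neg_neg] at this

lemma th4_two_eta (τ : ℂ) : th4 (2 * ηc) τ = th4 ηc τ := by
  have := th4_add_two_eta 0 τ
  rwa [zero_add, zero_sub, th4_neg] at this

lemma th2_two_eta (τ : ℂ) : th2 (2 * ηc) τ = -th2 ηc τ := by
  have := th2_add_two_eta 0 τ
  rwa [zero_add, zero_sub, th2_neg] at this

lemma th14_eta_ne {τ : ℂ} (hτ : 0 < τ.im) : th1 ηc (2 * τ) ≠ 0 ∧ th4 ηc (2 * τ) ≠ 0 := by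
  have h := th1_mul_th2_zero ηc hτ
  have h' := mul_ne_zero (th1_eta_ne hτ) (th2_zero_ne hτ)
  rw [h] at h'
  have := (mul_ne_zero_iff.mp h').2
  exact mul_ne_zero_iff.mp this

lemma th4_zero_ne {τ : ℂ} (hτ : 0 < τ.im) : th4 0 (2 * τ) ≠ 0 := by
  have h := th1_mul_th2_self ηc hτ
  have h' := mul_ne_zero (th1_eta_ne hτ) (th2_eta_ne hτ)
  rw [h] at h'
  exact (mul_ne_zero_iff.mp h').1

/-- The prefactor `κ` of `w`. -/
def kap (τ : ℂ) : ℂ := th4 ηc (2*τ) / th4 0 (2*τ)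

/-- The denominator of `w`. -/
def Dth (τ x : ℂ) : ℂ := th1 (x - ηc) τ * th1 (x + ηc) τ

lemma kap_ne {τ : ℂ} (hτ : 0 < τ.im) : kap τ ≠ 0 := div_ne_zero (th14_eta_ne hτ).2 (th4_zero_ne hτ)

lemma wfun_mul_Dth {τ x : ℂ} (h : Dth τ x ≠ 0) : wfun τ x * Dth τ x = kap τ * th1 x τ ^ 2 := by
  unfold wfun
  rw [← Dth, div_mul_cancel₀ _ h, kap]

lemma kap_mul_th2_eta {τ : ℂ} (hτ : 0 < τ.im) : kap τ * th2 ηc τ = th2 0 τ / 2 := by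
  have h1 := th1_mul_th2_self ηc hτ
  have h2 := th1_mul_th2_zero ηc hτ
  rw [th1_two_eta] at h1
  unfold kap
  have h0 := th4_zero_ne hτ
  have hT := th1_eta_ne hτ
  field_simp
  apply mul_left_cancel₀ hT
  linear_combination 2 * th4 ηc (2*τ) * h1 - th4 0 (2*τ) * h2

/-- The three-term relation. -/
lemma th1_three_term (x y : ℂ) {τ : ℂ} (hτ : 0 < τ.im) :
    th1 (x + y) τ * th1 (x - y) τ * th1 ηc τ ^ 2 =
      Dth τ x * th1 y τ ^ 2 - th1 x τ ^ 2 * Dth τ y := by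
  have h := two_th1_mul_th1_half x y hτ
  have h1 := two_th1_mul_th1_half x ηc hτ
  have h2 := two_th1_mul_th1_half y ηc hτ
  have h3 := two_th1_mul_th1_half x 0 hτ
  have h4 := two_th1_mul_th1_half y 0 hτ
  have h5 := two_th1_mul_th1_half ηc 0 hτ
  simp only [add_zero, sub_zero] at h3 h4 h5
  unfold Dth
  have q0 := eq_div_of_mul_eq (two_ne_zero) ((mul_comm _ _).trans h)
  have q1 : th1 (x - ηc) τ * th1 (x + ηc) τ = _ :=
    (mul_comm _ _).trans (eq_div_of_mul_eq (two_ne_zero) ((mul_comm _ _).trans h1))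
  have q2 : th1 (y - ηc) τ * th1 (y + ηc) τ = _ :=
    (mul_comm _ _).trans (eq_div_of_mul_eq (two_ne_zero) ((mul_comm _ _).trans h2))
  have q3 := eq_div_of_mul_eq (two_ne_zero) ((mul_comm _ _).trans h3)
  have q4 := eq_div_of_mul_eq (two_ne_zero) ((mul_comm _ _).trans h4)
  have q5 := eq_div_of_mul_eq (two_ne_zero) ((mul_comm _ _).trans h5)
  rw [sq, sq, sq, q0, q1, q2, q3, q4, q5]
  ring

lemma wfun_sub {x y τ : ℂ} (hτ : 0 < τ.im) (hx : Dth τ x ≠ 0) (hy : Dth τ y ≠ 0) :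
    th1 (x + y) τ * th1 (x - y) τ * th1 ηc τ ^ 2 * kap τ =
      Dth τ x * Dth τ y * (wfun τ y - wfun τ x) := by
  rw [th1_three_term x y hτ]
  linear_combination -Dth τ x * wfun_mul_Dth hy + Dth τ y * wfun_mul_Dth hx

lemma wfun_neg (τ x : ℂ) : wfun τ (-x) = wfun τ x := by
  unfold wfun
  rw [show -x - ηc = -(x + ηc) by ring, show -x + ηc = -(x - ηc) by ring, th1_neg, th1_neg, th1_neg]
  congr 1 <;> ring

lemma wfun_add_pi (τ x : ℂ) : wfun τ (x + Real.pi) = wfun τ x := by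
  unfold wfun
  rw [show x + Real.pi - ηc = x - ηc + Real.pi by ring, show x + Real.pi + ηc = x + ηc + Real.pi by ring,
    th1_add_pi, th1_add_pi, th1_add_pi]
  congr 1 <;> ring

lemma kap_pow_zet {τ : ℂ} (hτ : 0 < τ.im) : kap τ ^ 3 * (1 - zet τ ^ 2) = 1 := by
  have h := th4_two_mul ηc hτ
  rw [th4_two_eta] at h
  have h4 := (th14_eta_ne hτ).2
  have h0 := th4_zero_ne hτ
  unfold kap zet
  field_simp
  linear_combination -h

lemma one_sub_zet_ne {τ : ℂ} (hτ : 0 < τ.im) : 1 - zet τ ^ 2 ≠ 0 := fun h => by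
  have := kap_pow_zet hτ
  rw [h, mul_zero] at this
  exact zero_ne_one this

lemma Dth_add_eta (τ y : ℂ) : Dth τ (y + ηc) = -(th1 y τ * th1 (y - ηc) τ) := by
  unfold Dth
  rw [add_sub_cancel_right, show y + ηc + ηc = y + 2 * ηc by ring, th1_add_two_eta]; ring

lemma Dth_sub_eta (τ y : ℂ) : Dth τ (y - ηc) = -(th1 y τ * th1 (y + ηc) τ) := by
  unfold Dth
  rw [sub_add_cancel, show y - ηc - ηc = y - 2 * ηc by ring, th1_sub_two_eta]; ring

lemma Dth_neg (τ y : ℂ) : Dth τ (-y) = Dth τ y := by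
  unfold Dth
  rw [show -y - ηc = -(y + ηc) by ring, show -y + ηc = -(y - ηc) by ring, th1_neg, th1_neg]; ring

lemma Dth_mem {τ : ℂ} (hτ : 0 < τ.im) : Dth τ ∈ evenTheta τ 1 := by
  have := th1_mul_mem_evenTheta hτ ηc
  rw [show Dth τ = fun z => th1 (z + ηc) τ * th1 (z - ηc) τ from funext fun z => mul_comm _ _]
  exact this

lemma th1_sq_mem {τ : ℂ} (hτ : 0 < τ.im) : (fun z => th1 z τ ^ 2) ∈ evenTheta τ 1 := by
  have := th1_mul_mem_evenTheta hτ 0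
  simpa [sq] using this

lemma wfun_beta2 {τ : ℂ} (hτ : 0 < τ.im) : wfun τ β2c = J2c := by
  have h := kap_mul_th2_eta hτ
  unfold kap at h
  unfold wfun β2c J2c
  rw [th1_add_half_pi, show ηc + (Real.pi : ℂ) / 2 - ηc = 0 + Real.pi / 2 by ring, th1_add_half_pi,
    show ηc + (Real.pi : ℂ) / 2 + ηc = 2 * ηc + Real.pi / 2 by ring, th1_add_half_pi, th2_two_eta]
  have h1 := th2_zero_ne hτ
  have h2 := th2_eta_ne hτ
  rw [show th4 ηc (2 * τ) / th4 0 (2 * τ) * th2 ηc τ ^ 2 = th4 ηc (2 * τ) / th4 0 (2 * τ) * th2 ηc τ * th2 ηc τ by ring,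
    h]
  field_simp

lemma Dth_beta2 {τ : ℂ} (hτ : 0 < τ.im) : Dth τ β2c * (2 * kap τ) = -th2 0 τ ^ 2 := by
  have h := kap_mul_th2_eta hτ
  unfold Dth β2c
  rw [show ηc + (Real.pi : ℂ) / 2 - ηc = 0 + Real.pi / 2 by ring, th1_add_half_pi,
    show ηc + (Real.pi : ℂ) / 2 + ηc = 2 * ηc + Real.pi / 2 by ring, th1_add_half_pi, th2_two_eta]
  linear_combination (-2 * th2 0 τ) * h

lemma th1_cube_mem {τ : ℂ} (hτ : 0 < τ.im) :
    (fun y => th1 y τ * (th1 (y + ηc) τ ^ 3 + th1 (y - ηc) τ ^ 3)) ∈ evenTheta τ 2 := by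
  have hd := th1_differentiable hτ
  have hda : Differentiable ℂ fun y => th1 (y + ηc) τ := hd.comp (f := fun y : ℂ => y + ηc) (by fun_prop)
  have hds : Differentiable ℂ fun y => th1 (y - ηc) τ := hd.comp (f := fun y : ℂ => y - ηc) (by fun_prop)
  refine ⟨hd.mul ((hda.pow 3).add (hds.pow 3)), fun z => ?_, fun z => ?_, fun z => ?_⟩
  · dsimp only
    rw [show z + Real.pi - ηc = z - ηc + Real.pi by ring, show z + Real.pi + ηc = z + ηc + Real.pi by ring,
      th1_add_pi, th1_add_pi, th1_add_pi]; ring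
  · dsimp only
    rw [show z + Real.pi * τ - ηc = z - ηc + Real.pi * τ by ring,
      show z + Real.pi * τ + ηc = z + ηc + Real.pi * τ by ring,
      th1_add_pi_tau, th1_add_pi_tau, th1_add_pi_tau]
    have e : ∀ t : ℂ, (t = ηc ∨ t = -ηc) → Complex.exp (-(Complex.I * (Real.pi * τ + 2 * z))) *
      Complex.exp (-(Complex.I * (Real.pi * τ + 2 * (z + t)))) ^ 3 =
        Complex.exp (-((2 : ℕ) * (2 * Complex.I * (Real.pi * τ + 2 * z)))) := by
      rintro t ht
      rw [← Complex.exp_nat_mul, ← Complex.exp_add]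
      rcases ht with rfl | rfl
      · rw [← mul_one (Complex.exp (-((2 : ℕ) * (2 * Complex.I * (Real.pi * τ + 2 * z))))),
          ← Complex.exp_int_mul_two_pi_mul_I (-1), ← Complex.exp_add]
        congr 1; unfold ηc; push_cast; ring
      · rw [← mul_one (Complex.exp (-((2 : ℕ) * (2 * Complex.I * (Real.pi * τ + 2 * z))))),
          ← Complex.exp_int_mul_two_pi_mul_I 1, ← Complex.exp_add]
        congr 1; unfold ηc; push_cast; ring
    have e1 := e ηc (Or.inl rfl)
    have e2 := e (-ηc) (Or.inr rfl)
    rw [← sub_eq_add_neg] at e2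
    linear_combination (th1 z τ * th1 (z + ηc) τ ^ 3) * e1 + (th1 z τ * th1 (z - ηc) τ ^ 3) * e2
  · dsimp only
    rw [show -z - ηc = -(z + ηc) by ring, show -z + ηc = -(z - ηc) by ring, th1_neg, th1_neg, th1_neg]
    ring

lemma th1_half_pi (τ : ℂ) : th1 (Real.pi / 2) τ = th2 0 τ := by rw [← th1_add_half_pi, zero_add]

lemma th1_nodes_ne {τ : ℂ} (hτ : 0 < τ.im) (i j : Fin 3) (hij : i ≠ j) :
    th1 ((![0, ηc, (Real.pi / 2 : ℂ)] : Fin 3 → ℂ) i + (![0, ηc, (Real.pi / 2 : ℂ)] : Fin 3 → ℂ) j) τ ≠ 0 ∧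
    th1 ((![0, ηc, (Real.pi / 2 : ℂ)] : Fin 3 → ℂ) i - (![0, ηc, (Real.pi / 2 : ℂ)] : Fin 3 → ℂ) j) τ ≠ 0 := by
  have hp := th2_zero_ne hτ
  have hp2 := th1_half_pi τ
  have h1 := th1_eta_ne hτ
  have h2 : th1 (ηc + Real.pi / 2) τ ≠ 0 := by rw [th1_add_half_pi]; exact th2_eta_ne hτ
  have h3 : th1 (ηc - Real.pi / 2) τ ≠ 0 := by
    have := th1_sub_pi (ηc + Real.pi / 2) τ
    rw [show ηc + (Real.pi : ℂ) / 2 - Real.pi = ηc - Real.pi / 2 by ring] at this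
    rw [this]; exact neg_ne_zero.mpr h2
  have h4 : th1 (Real.pi / 2 - ηc) τ ≠ 0 := by
    rw [← neg_sub, th1_neg]; exact neg_ne_zero.mpr h3
  fin_cases i <;> fin_cases j <;> first | exact absurd rfl hij | skip
  all_goals simp [th1_neg, hp2, hp, h1, h2, h3, h4, add_comm (Real.pi / 2 : ℂ) ηc]

lemma evenTheta_two_eq_smul {τ : ℂ} (hτ : 0 < τ.im) {f g : ℂ → ℂ} (hf : f ∈ evenTheta τ 2)
    (hg : g ∈ evenTheta τ 2) (f0 : f 0 = 0) (f1 : f ηc = 0) (g0 : g 0 = 0) (g1 : g ηc = 0)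
    (g2 : g (Real.pi / 2) ≠ 0) : ∃ C : ℂ, ∀ y, f y = C * g y := by
  refine ⟨f (Real.pi / 2) / g (Real.pi / 2), fun y => ?_⟩
  have key := evenTheta_eq_zero_of_zeros hτ (l := 2) (by norm_num) (ι := Fin 3)
    ![0, ηc, Real.pi / 2] (by simp) (th1_nodes_ne hτ)
    ((evenTheta τ 2).sub_mem hf ((evenTheta τ 2).smul_mem (f (Real.pi / 2) / g (Real.pi / 2)) hg)) (by
      intro i
      fin_cases i
      · simp [f0, g0]
      · simp [f1, g1]
      · simp [div_mul_cancel₀ _ g2])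
  have := congrFun key y
  simpa [sub_eq_zero] using this

lemma th1_sq_mul_Dth_mem {τ : ℂ} (hτ : 0 < τ.im) :
    (fun y => th1 y τ ^ 2 * Dth τ y) ∈ evenTheta τ 2 := by
  have h := evenTheta_mul (th1_sq_mem hτ) (Dth_mem hτ)
  rwa [one_add_one_eq_two] at h

lemma th1_pow_four_mem {τ : ℂ} (hτ : 0 < τ.im) : (fun y => th1 y τ ^ 4) ∈ evenTheta τ 2 := by
  have := evenTheta_pow (th1_sq_mem hτ) 2
  simpa [← pow_mul] using this

/-- The cubic relation behind the addition theorem for `w`. -/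
lemma th1_cubic {τ : ℂ} (hτ : 0 < τ.im) : ∃ C : ℂ, ∀ y, th1 y τ ≠ 0 →
    th1 y τ ^ 3 - th1 (y + ηc) τ ^ 3 - th1 (y - ηc) τ ^ 3 =
      C * (th1 y τ * th1 (y + ηc) τ * th1 (y - ηc) τ) := by
  have m1 : (fun y => th1 y τ ^ 4) ∈ evenTheta τ 2 :=
    th1_pow_four_mem hτ
  have m2 : (fun y => th1 y τ ^ 2 * Dth τ y) ∈ evenTheta τ 2 :=
    th1_sq_mul_Dth_mem hτ
  have hD : Dth τ (Real.pi / 2) ≠ 0 := by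
    unfold Dth
    rw [show (Real.pi : ℂ) / 2 - ηc = -ηc + Real.pi / 2 by ring, add_comm _ ηc, th1_add_half_pi,
      th1_add_half_pi, th2_neg]
    exact mul_ne_zero (th2_eta_ne hτ) (th2_eta_ne hτ)
  have m3 : (fun y => th1 y τ ^ 4 - th1 y τ * (th1 (y + ηc) τ ^ 3 + th1 (y - ηc) τ ^ 3)) ∈
      evenTheta τ 2 := (evenTheta τ 2).sub_mem m1 (th1_cube_mem hτ)
  have f0 : th1 0 τ ^ 4 - th1 0 τ * (th1 (0 + ηc) τ ^ 3 + th1 (0 - ηc) τ ^ 3) = 0 := by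
    rw [th1_zero]; ring
  have f1 : th1 ηc τ ^ 4 - th1 ηc τ * (th1 (ηc + ηc) τ ^ 3 + th1 (ηc - ηc) τ ^ 3) = 0 := by
    rw [sub_self, th1_zero, ← two_mul, th1_two_eta]; ring
  have g0 : th1 0 τ ^ 2 * Dth τ 0 = 0 := by rw [th1_zero]; ring
  have g1 : th1 ηc τ ^ 2 * Dth τ ηc = 0 := by rw [Dth, sub_self, th1_zero]; ring
  have g2 : th1 (Real.pi / 2) τ ^ 2 * Dth τ (Real.pi / 2) ≠ 0 :=
    mul_ne_zero (pow_ne_zero 2 (by rw [th1_half_pi]; exact th2_zero_ne hτ)) hD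
  obtain ⟨C, hC⟩ := evenTheta_two_eq_smul hτ m3 m2 f0 f1 g0 g1 g2
  refine ⟨C, fun y hy => mul_left_cancel₀ hy ?_⟩
  have := hC y
  dsimp only [Dth] at this
  linear_combination this

lemma w_triple_prod {τ y : ℂ} (hτ : 0 < τ.im) (h0 : th1 y τ ≠ 0) (hp : th1 (y + ηc) τ ≠ 0)
    (hm : th1 (y - ηc) τ ≠ 0) :
    wfun τ y * wfun τ (y + ηc) * wfun τ (y - ηc) * (1 - zet τ ^ 2) = 1 := by
  have e : wfun τ y * wfun τ (y + ηc) * wfun τ (y - ηc) = kap τ ^ 3 := by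
    unfold wfun
    rw [add_sub_cancel_right, sub_add_cancel, show y + ηc + ηc = y + 2 * ηc by ring,
      show y - ηc - ηc = y - 2 * ηc by ring, th1_add_two_eta, th1_sub_two_eta, ← kap]
    field_simp
  rw [e, kap_pow_zet hτ]

lemma w_triple_sum {τ y : ℂ} (hτ : 0 < τ.im) (h0 : th1 y τ ≠ 0) (hp : th1 (y + ηc) τ ≠ 0)
    (hm : th1 (y - ηc) τ ≠ 0) :
    (wfun τ y + wfun τ (y + ηc) + wfun τ (y - ηc)) * (1 - zet τ ^ 2) = 3 + zet τ ^ 2 := by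
  obtain ⟨C, hC⟩ := th1_cubic hτ
  have key : ∀ y, th1 y τ ≠ 0 → th1 (y + ηc) τ ≠ 0 → th1 (y - ηc) τ ≠ 0 →
      wfun τ y + wfun τ (y + ηc) + wfun τ (y - ηc) = kap τ * C := by
    intro y h0 hp hm
    unfold wfun
    rw [add_sub_cancel_right, sub_add_cancel, show y + ηc + ηc = y + 2 * ηc by ring,
      show y - ηc - ηc = y - 2 * ηc by ring, th1_add_two_eta, th1_sub_two_eta, ← kap]
    field_simp
    linear_combination kap τ * hC y h0
  have q0 : th1 (Real.pi / 2) τ ≠ 0 := by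
    have := th2_zero_ne hτ
    rwa [← th1_add_half_pi, zero_add] at this
  have q1 : th1 (Real.pi / 2 + ηc) τ ≠ 0 := by
    rw [add_comm, th1_add_half_pi]; exact th2_eta_ne hτ
  have q2 : th1 (Real.pi / 2 - ηc) τ ≠ 0 := by
    rw [sub_eq_add_neg, add_comm, th1_add_half_pi, th2_neg]; exact th2_eta_ne hτ
  have k1 := key _ q0 q1 q2
  have k2 := w_triple_prod hτ q0 q1 q2
  have e1 : wfun τ (Real.pi / 2 + ηc) = J2c := by
    rw [← wfun_beta2 hτ, β2c, add_comm]
  have e2 : wfun τ (Real.pi / 2 - ηc) = J2c := by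
    rw [← wfun_neg, ← wfun_add_pi, ← wfun_beta2 hτ, β2c]; congr 1; ring
  rw [e1, e2] at k1 k2
  unfold J2c at k1 k2
  rw [key y h0 hp hm]
  linear_combination (-(1 - zet τ ^ 2)) * k1 + 4 * k2

/-- The rational span of the period lattice of `ϑ₁`. -/
def latQ (τ : ℂ) : Submodule ℚ ℂ := Submodule.span ℚ {(Real.pi : ℂ), (Real.pi : ℂ) * τ}

/-- A sequence which is linearly independent over `ℚ` modulo the period lattice. -/
def Gen (τ : ℂ) (x : ℕ → ℂ) : Prop := LinearIndependent ℚ fun i => (latQ τ).mkQ (x i)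

lemma exists_gen (τ : ℂ) : ∃ x, Gen τ x := by
  have hK : Module.Finite ℚ (latQ τ) :=
    Module.Finite.span_of_finite ℚ (Set.toFinite _)
  have hQ : ¬ Module.Finite ℚ (ℂ ⧸ latQ τ) := by
    intro h
    have hC : Module.Finite ℚ ℂ := Module.Finite.of_submodule_quotient (latQ τ)
    have e := (Module.finBasis ℚ ℂ).equivFun.toEquiv
    have : Countable ℂ := e.injective.countable
    have hR : Countable ℝ := Complex.ofReal_injective.countable
    exact Cardinal.not_countable_real (Set.countable_univ_iff.mpr hR)
  let b := Module.Free.chooseBasis ℚ (ℂ ⧸ latQ τ)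
  have hinf : Infinite (Module.Free.ChooseBasisIndex ℚ (ℂ ⧸ latQ τ)) := by
    by_contra hfin
    rw [not_infinite_iff_finite] at hfin
    exact hQ (Module.Finite.of_basis b)
  have hsurj := (latQ τ).mkQ_surjective
  choose g hg using hsurj
  refine ⟨fun i => g (b (Infinite.natEmbedding _ i)), ?_⟩
  unfold Gen
  simp only [hg]
  exact b.linearIndependent.comp _ (Infinite.natEmbedding _).injective

lemma Gen.comp {τ : ℂ} {x : ℕ → ℂ} (h : Gen τ x) {f : ℕ → ℕ} (hf : Function.Injective f) :
    Gen τ fun i => x (f i) := LinearIndependent.comp h f hf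

lemma Gen.smul {τ : ℂ} {x : ℕ → ℂ} (h : Gen τ x) (c : ℕ → ℚ) (hc : ∀ i, c i ≠ 0) :
    Gen τ fun i => (c i : ℂ) * x i := by
  have := LinearIndependent.units_smul h fun i => Units.mk0 (c i) (hc i)
  unfold Gen
  convert this using 2 with i
  simp only [Pi.smul_apply', Units.smul_mk0]
  rw [← map_smul, Rat.smul_def]

lemma Gen.update_smul {τ : ℂ} {x : ℕ → ℂ} (h : Gen τ x) (j : ℕ) {c : ℚ} (hc : c ≠ 0) :
    Gen τ (Function.update x j (c * x j)) := by
  have := h.smul (Function.update (fun _ => 1) j c) (fun i => by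
    by_cases hi : i = j
    · subst hi; simpa using hc
    · simp [Function.update_of_ne hi])
  convert this using 2 with i
  by_cases hi : i = j
  · subst hi; simp
  · simp [Function.update_of_ne hi]

lemma Gen.update_neg {τ : ℂ} {x : ℕ → ℂ} (h : Gen τ x) (j : ℕ) :
    Gen τ (Function.update x j (-x j)) := by
  have := h.update_smul j (c := -1) (by norm_num)
  simpa using this

lemma Gen.th1_ne {τ : ℂ} (hτ : 0 < τ.im) {x : ℕ → ℂ} (h : Gen τ x) {i j : ℕ} (hij : i ≠ j) {a : ℚ}
    (ha : a ≠ 0) (b r s : ℚ) :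
    th1 (a * x i + b * x j + (r * Real.pi + s * (Real.pi * τ))) τ ≠ 0 := by
  intro h0
  obtain ⟨m, n, hmn⟩ := th1_eq_zero hτ h0
  have hp' : LinearIndependent ℚ ![(latQ τ).mkQ (x i), (latQ τ).mkQ (x j)] := by
    have := LinearIndependent.comp h ![i, j] (by
      intro k l hkl
      fin_cases k <;> fin_cases l <;> simp_all)
    convert this using 1
    ext k
    fin_cases k <;> rfl
  have hp := LinearIndependent.pair_iff.mp hp' a b (by
    rw [← map_smul, ← map_smul, ← map_add]
    refine (Submodule.Quotient.mk_eq_zero _).mpr ?_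
    have e : a • x i + b • x j = ((m : ℚ) - r) • (Real.pi : ℂ) + ((n : ℚ) - s) • ((Real.pi : ℂ) * τ) := by
      simp only [Rat.smul_def]
      push_cast
      linear_combination hmn
    rw [e]
    exact Submodule.add_mem _ (Submodule.smul_mem _ _ (Submodule.subset_span (by simp)))
      (Submodule.smul_mem _ _ (Submodule.subset_span (by simp))))
  exact ha hp.1

lemma Gen.th1_ne_one {τ : ℂ} (hτ : 0 < τ.im) {x : ℕ → ℂ} (h : Gen τ x) (i : ℕ) {a : ℚ}
    (ha : a ≠ 0) (r s : ℚ) :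
    th1 (a * x i + (r * Real.pi + s * (Real.pi * τ))) τ ≠ 0 := by
  have := h.th1_ne hτ (i := i) (j := i + 1) (by omega) ha 0 r s
  simpa using this

/-- Concatenation of the first `k` entries of two sequences. -/
def seqAB (k : ℕ) (a b : ℕ → ℂ) : Fin (2 * k) → ℂ :=
  fun j => if (j : ℕ) < k then a j else b (j - k)

lemma firstHalf_seqAB (k : ℕ) (a b : ℕ → ℂ) (i : Fin k) : firstHalf (seqAB k a b) i = a i := by
  simp [firstHalf, seqAB]

lemma secondHalf_seqAB (k : ℕ) (a b : ℕ → ℂ) (i : Fin k) : secondHalf (seqAB k a b) i = b i := by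
  simp [secondHalf, seqAB]

/-- The numerator polynomial of `H_{2k}`. -/
def Npol (ζ : ℂ) (k : ℕ) (a b : ℕ → ℂ) : ℂ :=
  ∑ σ : Equiv.Perm (Fin k), ((Equiv.Perm.sign σ : ℤ) : ℂ) *
    ∏ j : Fin k, ∏ i ∈ Finset.univ.erase (σ j), hpol ζ (a i) (b j)

/-- Vandermonde product of the first `k` entries of a sequence. -/
def vd (k : ℕ) (a : ℕ → ℂ) : ℂ := vdm fun i : Fin k => a i

lemma vd_eq_det (k : ℕ) (a : ℕ → ℂ) :
    vd k a = (Matrix.vandermonde fun i : Fin k => a i).det := by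
  rw [Matrix.det_vandermonde, vd, vdm]
  refine Finset.prod_congr rfl fun i _ => ?_
  rw [← Finset.prod_filter]
  refine Finset.prod_congr ?_ fun _ _ => rfl
  ext j; simp

lemma vd_ne_zero {k : ℕ} {a : ℕ → ℂ} (h : ∀ i < k, ∀ j < k, i ≠ j → a i ≠ a j) : vd k a ≠ 0 := by
  rw [vd_eq_det, Matrix.det_vandermonde_ne_zero_iff]
  intro i j hij
  by_contra hne
  exact h i i.2 j j.2 (fun h => hne (Fin.ext h)) hij

lemma vd_succ (k : ℕ) (a : ℕ → ℂ) :
    vd (k + 1) a = (∏ i : Fin k, (a (i + 1) - a 0)) * vd k fun i => a (i + 1) := by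
  rw [vd_eq_det, vd_eq_det, Matrix.det_vandermonde, Matrix.det_vandermonde, Fin.prod_univ_succ]
  congr 1
  · rw [Fin.prod_Ioi_zero]
    simp
  · refine Finset.prod_congr rfl fun i _ => ?_
    rw [Fin.prod_Ioi_succ]
    simp

/-- The points at which the ratio defining `H_{2k}` makes sense. -/
def Good (ζ : ℂ) (k : ℕ) (a b : ℕ → ℂ) : Prop :=
  (∀ i < k, ∀ j < k, i ≠ j → a i ≠ a j) ∧ (∀ i < k, ∀ j < k, i ≠ j → b i ≠ b j) ∧
    ∀ i < k, ∀ j < k, hpol ζ (a i) (b j) ≠ 0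

lemma Npol_eq_det {ζ : ℂ} {k : ℕ} {a b : ℕ → ℂ}
    (h : ∀ i < k, ∀ j < k, hpol ζ (a i) (b j) ≠ 0) :
    (∏ i : Fin k, ∏ j : Fin k, hpol ζ (a i) (b j)) *
      Matrix.det (Matrix.of fun i j : Fin k => (hpol ζ (a i) (b j))⁻¹) = Npol ζ k a b := by
  rw [Matrix.det_apply', Npol, Finset.mul_sum]
  refine Finset.sum_congr rfl fun σ _ => ?_
  rw [Finset.prod_comm, mul_left_comm, ← Finset.prod_mul_distrib]
  congr 1
  refine Finset.prod_congr rfl fun j _ => ?_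
  rw [Matrix.of_apply, ← Finset.mul_prod_erase Finset.univ _ (Finset.mem_univ (σ j)),
    mul_comm, ← mul_assoc, inv_mul_cancel₀ (h _ (σ j).2 _ j.2), one_mul]

lemma eventually_ne_of_entire {f : ℂ → ℂ} (hf : Differentiable ℂ f) (h1 : f 1 ≠ 0) :
    ∀ᶠ s in 𝓝[≠] (0 : ℂ), f s ≠ 0 := by
  have ha : AnalyticOnNhd ℂ f Set.univ := fun z _ => hf.analyticAt z
  by_contra hcon
  have hfr : ∃ᶠ s in 𝓝[≠] (0 : ℂ), f s = 0 := by
    rw [Filter.not_eventually] at hcon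
    exact hcon.mono fun s hs => not_not.mp hs
  exact h1 (ha.eqOn_zero_of_preconnected_of_frequently_eq_zero isPreconnected_univ
    (Set.mem_univ _) hfr (Set.mem_univ 1))

lemma eventually_forall_lt {k : ℕ} {p : ℕ → ℂ → Prop} {l : Filter ℂ} (h : ∀ i < k, ∀ᶠ s in l, p i s) :
    ∀ᶠ s in l, ∀ i < k, p i s := by
  have := (Filter.eventually_all_finset (l := l) (Finset.range k) (p := p)).mpr
    (fun i hi => h i (Finset.mem_range.mp hi))
  filter_upwards [this] with s hs i hi using hs i (Finset.mem_range.mpr hi)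

lemma exists_good (ζ : ℂ) (k : ℕ) : ∃ g, Good ζ k g g := by
  have h1 : ∀ᶠ t in 𝓝[≠] (0 : ℂ), ∀ i < k, ∀ j < k, hpol ζ (t * i) (t * j) ≠ 0 := by
    refine eventually_forall_lt fun i _ => eventually_forall_lt fun j _ => ?_
    refine Filter.Eventually.filter_mono nhdsWithin_le_nhds ?_
    have hc : Continuous fun t : ℂ => hpol ζ (t * i) (t * j) := by unfold hpol; fun_prop
    exact hc.continuousAt.eventually_ne (by simp [hpol])
  have h2 : ∀ᶠ t in 𝓝[≠] (0 : ℂ), t ≠ 0 := eventually_mem_nhdsWithin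
  obtain ⟨t, ht, ht0⟩ := (h1.and h2).exists
  have hd : ∀ i < k, ∀ j < k, i ≠ j → t * (i : ℂ) ≠ t * (j : ℂ) := fun i _ j _ hij h =>
    hij (by exact_mod_cast mul_left_cancel₀ ht0 h)
  exact ⟨fun i => t * i, hd, hd, ht⟩

lemma dense_good (ζ : ℂ) (k : ℕ) : Dense {p : (ℕ → ℂ) × (ℕ → ℂ) | Good ζ k p.1 p.2} := by
  rintro ⟨a, b⟩
  obtain ⟨g, hg1, hg2, hg3⟩ := exists_good ζ k
  let ln : (ℕ → ℂ) → ℂ → ℕ → ℂ := fun a s i => (1 - s) * a i + s * g i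
  have hln : ∀ a, Filter.Tendsto (ln a) (𝓝[≠] 0) (𝓝 a) := by
    intro a
    have : Continuous (ln a) := by
      refine continuous_pi fun i => ?_
      simp only [ln]; fun_prop
    have h2 := this.tendsto 0
    have e : ln a 0 = a := by ext i; simp [ln]
    rw [e] at h2
    exact h2.mono_left nhdsWithin_le_nhds
  have hdist : ∀ a : ℕ → ℂ, ∀ᶠ s in 𝓝[≠] (0 : ℂ), ∀ i < k, ∀ j < k, i ≠ j → ln a s i ≠ ln a s j := by
    intro a
    refine eventually_forall_lt fun i hi => eventually_forall_lt fun j hj => ?_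
    by_cases hij : i = j
    · simp [hij]
    have := eventually_ne_of_entire (f := fun s => ln a s i - ln a s j)
      (by simp only [ln]; fun_prop) (by simpa [ln, sub_eq_zero] using hg1 i hi j hj hij)
    filter_upwards [this] with s hs _ using sub_ne_zero.mp hs
  have hh : ∀ᶠ s in 𝓝[≠] (0 : ℂ), ∀ i < k, ∀ j < k, hpol ζ (ln a s i) (ln b s j) ≠ 0 := by
    refine eventually_forall_lt fun i hi => eventually_forall_lt fun j hj => ?_
    exact eventually_ne_of_entire (f := fun s => hpol ζ (ln a s i) (ln b s j))
      (by simp only [ln, hpol]; fun_prop) (by simpa [ln] using hg3 i hi j hj)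
  refine mem_closure_of_tendsto ((hln a).prodMk_nhds (hln b)) ?_
  filter_upwards [hdist a, hdist b, hh] with s h1 h2 h3 using ⟨h1, h2, h3⟩

section HFamily

variable {ζ : ℂ} {H : (k : ℕ) → (Fin (2 * k) → ℂ) → ℂ}

/-- `H_{2k}` as a function of two sequences. -/
def Fab (H : (k : ℕ) → (Fin (2 * k) → ℂ) → ℂ) (k : ℕ) (a b : ℕ → ℂ) : ℂ := H k (seqAB k a b)

lemma continuous_seqAB (k : ℕ) : Continuous fun p : (ℕ → ℂ) × (ℕ → ℂ) => seqAB k p.1 p.2 := by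
  refine continuous_pi fun j => ?_
  unfold seqAB
  split_ifs <;> fun_prop

lemma continuous_Fab (hH : IsHFamily ζ H) (k : ℕ) :
    Continuous fun p : (ℕ → ℂ) × (ℕ → ℂ) => Fab H k p.1 p.2 := by
  obtain ⟨P, hP⟩ := hH.2.1 k
  have : (fun p : (ℕ → ℂ) × (ℕ → ℂ) => Fab H k p.1 p.2) =
      fun p => MvPolynomial.eval (seqAB k p.1 p.2) P := by
    ext p; exact hP _
  rw [this]
  exact (MvPolynomial.continuous_eval P).comp (continuous_seqAB k)

lemma continuous_Npol (ζ : ℂ) (k : ℕ) :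
    Continuous fun p : (ℕ → ℂ) × (ℕ → ℂ) => Npol ζ k p.1 p.2 := by
  unfold Npol hpol
  fun_prop

lemma continuous_vd (k : ℕ) : Continuous fun a : ℕ → ℂ => vd k a := by
  simp only [vd_eq_det, Matrix.det_vandermonde]
  fun_prop

lemma Fab_eq_of_good (hH : IsHFamily ζ H) {k : ℕ} {a b : ℕ → ℂ} (h : Good ζ k a b) :
    Fab H k a b = Npol ζ k a b / (vd k a * vd k b) := by
  have := hH.2.2 k (seqAB k a b) (by
    simp only [HratioDefined, firstHalf_seqAB, secondHalf_seqAB]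
    exact ⟨fun i j hij => h.1 i i.2 j j.2 (Fin.val_ne_of_ne hij),
      fun i j hij => h.2.1 i i.2 j j.2 (Fin.val_ne_of_ne hij), fun i j => h.2.2 i i.2 j j.2⟩)
  rw [Fab, this, ← Npol_eq_det h.2.2, Hratio]
  simp only [vdm, vd, firstHalf_seqAB, secondHalf_seqAB]
  ring

lemma Fab_mul_vd (hH : IsHFamily ζ H) (k : ℕ) (a b : ℕ → ℂ) :
    vd k a * vd k b * Fab H k a b = Npol ζ k a b := by
  have h := Continuous.ext_on (dense_good ζ k)
    (f := fun p : (ℕ → ℂ) × (ℕ → ℂ) => vd k p.1 * vd k p.2 * Fab H k p.1 p.2)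
    (g := fun p => Npol ζ k p.1 p.2)
    ((((continuous_vd k).comp continuous_fst).mul ((continuous_vd k).comp continuous_snd)).mul
      (continuous_Fab hH k)) (continuous_Npol ζ k) (by
      rintro ⟨a, b⟩ hab
      dsimp only
      rw [Fab_eq_of_good hH hab]
      exact mul_div_cancel₀ _ (mul_ne_zero (vd_ne_zero hab.1) (vd_ne_zero hab.2.1)))
  exact congrFun h (a, b)

lemma Fab_congr (H) {k : ℕ} {a b a' b' : ℕ → ℂ} (ha : ∀ i < k, a i = a' i) (hb : ∀ i < k, b i = b' i) :
    Fab H k a b = Fab H k a' b' := by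
  unfold Fab
  congr 1
  ext j
  unfold seqAB
  split_ifs with h
  · exact ha _ h
  · exact hb _ (by have := j.2; omega)

lemma Fab_zero (hH : IsHFamily ζ H) (a b : ℕ → ℂ) : Fab H 0 a b = 1 := hH.1 _

lemma Fab_one (hH : IsHFamily ζ H) (a b : ℕ → ℂ) : Fab H 1 a b = 1 := by
  have h := Fab_mul_vd hH 1 a b
  have e : ∀ a, vd 1 a = 1 := fun a => by simp [vd, vdm]
  rw [e, e, one_mul, one_mul] at h
  rw [h]
  simp [Npol]

lemma Fab_comm (hH : IsHFamily ζ H) (k : ℕ) (a b : ℕ → ℂ) : Fab H k a b = Fab H k b a := by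
  have h := Continuous.ext_on (dense_good ζ k)
    (f := fun p : (ℕ → ℂ) × (ℕ → ℂ) => Fab H k p.1 p.2)
    (g := fun p => Fab H k p.2 p.1)
    (continuous_Fab hH k) ((continuous_Fab hH k).comp continuous_swap) (by
      rintro ⟨a, b⟩ hab
      have hsymm : ∀ x y, hpol ζ x y = hpol ζ y x := fun x y => by unfold hpol; ring
      have hba : Good ζ k b a := ⟨hab.2.1, hab.1, fun i hi j hj => by
        rw [hsymm]; exact hab.2.2 j hj i hi⟩
      dsimp only
      rw [Fab_eq_of_good hH hab, Fab_eq_of_good hH hba, mul_comm (vd k b), ← Npol_eq_det hab.2.2,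
        ← Npol_eq_det hba.2.2, Finset.prod_comm, ← Matrix.det_transpose]
      simp only [hsymm (b _) (a _)]
      rfl)
  exact congrFun h (a, b)

lemma Fab_swap_left (hH : IsHFamily ζ H) {k i j : ℕ} (hi : i < k) (hj : j < k) (a b : ℕ → ℂ) :
    Fab H k (fun l => a (Equiv.swap i j l)) b = Fab H k a b := by
  by_cases hij : i = j
  · simp [hij]
  have hsw : ∀ l : Fin k, Equiv.swap i j (l : ℕ) = (Equiv.swap (⟨i, hi⟩ : Fin k) ⟨j, hj⟩ l : Fin k) := by
    intro l
    simp only [Equiv.swap_apply_def, Fin.ext_iff]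
    split_ifs <;> rfl
  have h := Continuous.ext_on (dense_good ζ k)
    (f := fun p : (ℕ → ℂ) × (ℕ → ℂ) => Fab H k (fun l => p.1 (Equiv.swap i j l)) p.2)
    (g := fun p => Fab H k p.1 p.2)
    ((continuous_Fab hH k).comp (f := fun p : (ℕ → ℂ) × (ℕ → ℂ) =>
      ((fun l => p.1 (Equiv.swap i j l)), p.2)) (by fun_prop)) (continuous_Fab hH k) (by
      rintro ⟨a, b⟩ hab
      have hlt : ∀ l < k, Equiv.swap i j l < k := fun l hl => by
        rw [hsw ⟨l, hl⟩]; exact Fin.is_lt _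
      have hab' : Good ζ k (fun l => a (Equiv.swap i j l)) b :=
        ⟨fun l hl m hm hlm => hab.1 _ (hlt l hl) _ (hlt m hm) (fun e => hlm (Equiv.injective _ e)),
          hab.2.1, fun l hl m hm => hab.2.2 _ (hlt l hl) m hm⟩
      dsimp only
      rw [Fab_eq_of_good hH hab, Fab_eq_of_good hH hab', ← Npol_eq_det hab.2.2,
        ← Npol_eq_det hab'.2.2]
      simp only [vd_eq_det, hsw]
      set π := Equiv.swap (⟨i, hi⟩ : Fin k) ⟨j, hj⟩ with hπ
      have e1 := Matrix.det_permute π (Matrix.vandermonde fun l : Fin k => a l)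
      have e2 := Matrix.det_permute π (Matrix.of fun l m : Fin k => (hpol ζ (a l) (b m))⁻¹)
      have e1' : (Matrix.vandermonde fun l : Fin k => a (π l)) =
        (Matrix.vandermonde fun l : Fin k => a l).submatrix π id := rfl
      have e2' : (Matrix.of fun l m : Fin k => (hpol ζ (a (π l)) (b m))⁻¹) =
        (Matrix.of fun l m : Fin k => (hpol ζ (a l) (b m))⁻¹).submatrix π id := rfl
      rw [e1', e2', e1, e2, Equiv.prod_comp π fun l => ∏ m : Fin k, hpol ζ (a l) (b m), hπ,
        Equiv.Perm.sign_swap (by simpa using hij)]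
      push_cast
      rw [show ∀ x y z w : ℂ, x * (-1 * y) / (-1 * z * w) = -(x * y) / -(z * w) from fun _ _ _ _ => by ring,
        neg_div_neg_eq])
  exact congrFun h (a, b)

lemma Fab_swap_right (hH : IsHFamily ζ H) {k i j : ℕ} (hi : i < k) (hj : j < k) (a b : ℕ → ℂ) :
    Fab H k a (fun l => b (Equiv.swap i j l)) = Fab H k a b := by
  rw [Fab_comm hH, Fab_swap_left hH hi hj, Fab_comm hH]

end HFamily

lemma prod_erase_eq_ite {n : ℕ} (s : Fin n) (f : Fin n → ℂ) :
    ∏ i ∈ Finset.univ.erase s, f i = ∏ i, if i = s then 1 else f i := by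
  rw [← Finset.mul_prod_erase Finset.univ (fun i => if i = s then 1 else f i) (Finset.mem_univ s),
    if_pos rfl, one_mul]
  exact Finset.prod_congr rfl fun i hi => (if_neg (Finset.ne_of_mem_erase hi)).symm

lemma Npol_succ {ζ : ℂ} {k : ℕ} {a b : ℕ → ℂ} (h : hpol ζ (a 0) (b 0) = 0) :
    Npol ζ (k + 1) a b = (∏ i : Fin k, hpol ζ (a (i + 1)) (b 0) * hpol ζ (a 0) (b (i + 1))) *
      Npol ζ k (fun i => a (i + 1)) (fun i => b (i + 1)) := by
  unfold Npol
  rw [← Equiv.sum_comp Equiv.Perm.decomposeFin.symm, Fintype.sum_prod_type, Fin.sum_univ_succ]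
  have hz : ∀ p : Fin k, ∑ e : Equiv.Perm (Fin k),
      ((Equiv.Perm.sign (Equiv.Perm.decomposeFin.symm (p.succ, e)) : ℤ) : ℂ) *
        ∏ j : Fin (k + 1), ∏ i ∈ Finset.univ.erase (Equiv.Perm.decomposeFin.symm (p.succ, e) j),
          hpol ζ (a i) (b j) = 0 := by
    intro p
    refine Finset.sum_eq_zero fun e _ => ?_
    rw [Fin.prod_univ_succ, Equiv.Perm.decomposeFin_symm_apply_zero,
      Finset.prod_eq_zero (i := (0 : Fin (k + 1)))
        (Finset.mem_erase.mpr ⟨(Fin.succ_ne_zero p).symm, Finset.mem_univ _⟩) (by simpa using h)]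
    ring
  rw [Finset.sum_eq_zero fun p _ => hz p, add_zero, Finset.mul_sum]
  refine Finset.sum_congr rfl fun e _ => ?_
  rw [Equiv.Perm.decomposeFin.symm_sign, if_pos rfl, one_mul, mul_left_comm]
  congr 1
  simp only [prod_erase_eq_ite]
  rw [Fin.prod_univ_succ, Equiv.Perm.decomposeFin_symm_apply_zero, Finset.prod_mul_distrib, mul_assoc,
    ← Finset.prod_mul_distrib]
  congr 1
  · rw [Fin.prod_univ_succ, if_pos rfl, one_mul]
    refine Finset.prod_congr rfl fun i _ => ?_
    rw [if_neg (Fin.succ_ne_zero i)]; rfl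
  · refine Finset.prod_congr rfl fun j _ => ?_
    rw [Equiv.Perm.decomposeFin_symm_apply_succ, Equiv.swap_self, Equiv.refl_apply, Fin.prod_univ_succ,
      if_neg (Fin.succ_ne_zero _).symm]
    simp [Fin.ext_iff]

lemma eventually_distinct (a : ℕ → ℂ) (k : ℕ) :
    ∀ᶠ t in 𝓝[≠] (0 : ℂ), ∀ i < k, ∀ j < k, i ≠ j → a i + t * i ≠ a j + t * j := by
  refine eventually_forall_lt fun i hi => eventually_forall_lt fun j hj => ?_
  by_cases hij : i = j
  · simp [hij]
  by_cases he : a i = a j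
  · filter_upwards [eventually_mem_nhdsWithin] with t ht _ h
    rw [he] at h
    exact hij (by exact_mod_cast mul_left_cancel₀ ht (add_left_cancel h))
  · have hc : Continuous fun t : ℂ => a i + t * i - (a j + t * j) := by fun_prop
    have : ∀ᶠ t : ℂ in 𝓝 0, a i + t * i - (a j + t * j) ≠ 0 :=
      (hc.continuousAt (x := 0)).eventually_ne (by simpa [sub_eq_zero] using he)
    filter_upwards [this.filter_mono nhdsWithin_le_nhds] with t ht _ using sub_ne_zero.mp ht

lemma eq_of_eventually_punctured {f g : ℂ → ℂ} (hf : Continuous f) (hg : Continuous g)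
    (h : ∀ᶠ t in 𝓝[≠] (0 : ℂ), f t = g t) : f 0 = g 0 :=
  tendsto_nhds_unique_of_eventuallyEq ((hf.tendsto 0).mono_left nhdsWithin_le_nhds)
    ((hg.tendsto 0).mono_left nhdsWithin_le_nhds) h

/-- The relations between three roots `a, b, c` related by the addition theorem. -/
structure Triple (ζ a b c : ℂ) : Prop where
  prod : (1 - ζ ^ 2) * a * b * c = 1
  sum : (1 - ζ ^ 2) * (a + b + c) = 3 + ζ ^ 2

lemma Triple.hpol_eq_zero {ζ a b c : ℂ} (h : Triple ζ a b c) : hpol ζ a b = 0 := by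
  unfold hpol
  rw [← h.sum]
  linear_combination -h.prod

lemma Triple.hpol_right {ζ a b c : ℂ} (h : Triple ζ a b c) (v : ℂ) :
    hpol ζ v b = (1 - ζ ^ 2) * b * (v - a) * (v - c) := by
  unfold hpol
  rw [← h.sum]
  linear_combination -h.prod

lemma Triple.hpol_left {ζ a b c : ℂ} (h : Triple ζ a b c) (v : ℂ) :
    hpol ζ a v = (1 - ζ ^ 2) * a * (v - b) * (v - c) := by
  unfold hpol
  rw [← h.sum]
  linear_combination -h.prod

section HFamily

variable {ζ : ℂ} {H : (k : ℕ) → (Fin (2 * k) → ℂ) → ℂ}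

lemma Fab_succ_of_distinct (hH : IsHFamily ζ H) {k : ℕ} {a b : ℕ → ℂ} {c : ℂ}
    (h : Triple ζ (a 0) (b 0) c) (ha : ∀ i < k + 1, ∀ j < k + 1, i ≠ j → a i ≠ a j)
    (hb : ∀ i < k + 1, ∀ j < k + 1, i ≠ j → b i ≠ b j) :
    Fab H (k + 1) a b = (1 - ζ ^ 2) ^ (2 * k) * (a 0 * b 0) ^ k *
      (∏ i : Fin k, (a (i + 1) - c) * (b (i + 1) - c)) *
        Fab H k (fun i => a (i + 1)) (fun i => b (i + 1)) := by
  have e := Fab_mul_vd hH (k + 1) a b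
  have hne := mul_ne_zero (vd_ne_zero ha) (vd_ne_zero hb)
  refine mul_left_cancel₀ hne ?_
  rw [e, Npol_succ h.hpol_eq_zero, ← Fab_mul_vd hH, vd_succ, vd_succ]
  have : ∏ i : Fin k, hpol ζ (a (i + 1)) (b 0) * hpol ζ (a 0) (b (i + 1)) =
      (∏ i : Fin k, (a (i + 1) - a 0)) * (∏ i : Fin k, (b (i + 1) - b 0)) *
        ((1 - ζ ^ 2) ^ (2 * k) * (a 0 * b 0) ^ k *
          ∏ i : Fin k, (a (i + 1) - c) * (b (i + 1) - c)) := by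
    have e3 : (1 - ζ ^ 2) ^ (2 * k) * (a 0 * b 0) ^ k =
        ∏ _i : Fin k, ((1 - ζ ^ 2) ^ 2 * (a 0 * b 0)) := by
      rw [Finset.prod_const, Finset.card_univ, Fintype.card_fin, mul_pow, pow_mul, mul_pow,
        mul_pow]
    rw [e3, ← Finset.prod_mul_distrib, ← Finset.prod_mul_distrib, ← Finset.prod_mul_distrib]
    refine Finset.prod_congr rfl fun i _ => ?_
    rw [h.hpol_right, h.hpol_left]
    ring
  rw [this]
  ring

/-- The recursion relation for the polynomials `H_{2k}`. -/
lemma Fab_succ (hH : IsHFamily ζ H) {k : ℕ} {a b : ℕ → ℂ} {c : ℂ} (h : Triple ζ (a 0) (b 0) c) :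
    Fab H (k + 1) a b = (1 - ζ ^ 2) ^ (2 * k) * (a 0 * b 0) ^ k *
      (∏ i : Fin k, (a (i + 1) - c) * (b (i + 1) - c)) *
        Fab H k (fun i => a (i + 1)) (fun i => b (i + 1)) := by
  let sh : (ℕ → ℂ) → ℂ → ℕ → ℂ := fun a t i => a i + t * i
  have hc : ∀ k, Continuous fun p : (ℕ → ℂ) × (ℕ → ℂ) => Fab H k p.1 p.2 := continuous_Fab hH
  have h1 : Continuous fun t => Fab H (k + 1) (sh a t) (sh b t) :=
    (hc (k + 1)).comp (f := fun t => (sh a t, sh b t)) (by simp only [sh]; fun_prop)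
  have h2 : Continuous fun t => (1 - ζ ^ 2) ^ (2 * k) * (a 0 * b 0) ^ k *
      (∏ i : Fin k, (sh a t (i + 1) - c) * (sh b t (i + 1) - c)) *
        Fab H k (fun i => sh a t (i + 1)) (fun i => sh b t (i + 1)) := by
    refine Continuous.mul (by simp only [sh]; fun_prop) ?_
    exact (hc k).comp (f := fun t => ((fun i => sh a t (i + 1)), fun i => sh b t (i + 1)))
      (by simp only [sh]; fun_prop)
  have h0 : ∀ a, sh a 0 = a := fun a => by ext i; simp [sh]
  have key := eq_of_eventually_punctured h1 h2 (by
    filter_upwards [eventually_distinct a (k + 1), eventually_distinct b (k + 1)] with t hta htb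
    have := Fab_succ_of_distinct hH (k := k) (a := sh a t) (b := sh b t) (c := c)
      (by simpa [sh] using h) hta htb
    simpa [sh] using this)
  simpa only [h0] using key

end HFamily

/-- `f` is a polynomial function of degree at most `d`. -/
def PolyDeg (d : ℕ) (f : ℂ → ℂ) : Prop := ∃ Q : Polynomial ℂ, Q.natDegree ≤ d ∧ ∀ t, f t = Q.eval t

lemma PolyDeg.const (c : ℂ) : PolyDeg 0 fun _ => c := ⟨Polynomial.C c, by simp, by simp⟩

lemma PolyDeg.mono {d e : ℕ} {f : ℂ → ℂ} (h : PolyDeg d f) (hde : d ≤ e) : PolyDeg e f := by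
  obtain ⟨Q, hQ, hf⟩ := h
  exact ⟨Q, hQ.trans hde, hf⟩

lemma PolyDeg.mul {d e : ℕ} {f g : ℂ → ℂ} (hf : PolyDeg d f) (hg : PolyDeg e g) :
    PolyDeg (d + e) fun t => f t * g t := by
  obtain ⟨Q, hQ, hf⟩ := hf
  obtain ⟨R, hR, hg⟩ := hg
  exact ⟨Q * R, Polynomial.natDegree_mul_le.trans (add_le_add hQ hR), fun t => by
    dsimp only; rw [hf, hg, Polynomial.eval_mul]⟩

lemma PolyDeg.sum {ι : Type*} {d : ℕ} {f : ι → ℂ → ℂ} (s : Finset ι) (h : ∀ i ∈ s, PolyDeg d (f i)) :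
    PolyDeg d fun t => ∑ i ∈ s, f i t := by
  choose! Q hQ hf using h
  refine ⟨∑ i ∈ s, Q i, Polynomial.natDegree_sum_le_of_forall_le s Q hQ, fun t => ?_⟩
  rw [Polynomial.eval_finsetSum]
  exact Finset.sum_congr rfl fun i hi => hf i hi t

lemma PolyDeg.prod {ι : Type*} {d : ι → ℕ} {f : ι → ℂ → ℂ} (s : Finset ι)
    (h : ∀ i ∈ s, PolyDeg (d i) (f i)) : PolyDeg (∑ i ∈ s, d i) fun t => ∏ i ∈ s, f i t := by
  choose! Q hQ hf using h
  refine ⟨∏ i ∈ s, Q i, (Polynomial.natDegree_prod_le s Q).trans (Finset.sum_le_sum hQ), fun t => ?_⟩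
  rw [Polynomial.eval_prod]
  exact Finset.prod_congr rfl fun i hi => hf i hi t

lemma polyDeg_hpol (ζ b : ℂ) : PolyDeg 2 fun t => hpol ζ t b := by
  refine ⟨Polynomial.C ((1 - ζ ^ 2) * b) * Polynomial.X ^ 2 +
    Polynomial.C ((1 - ζ ^ 2) * b ^ 2 - (3 + ζ ^ 2) * b) * Polynomial.X + Polynomial.C 1,
    Polynomial.natDegree_quadratic_le, fun t => ?_⟩
  simp [hpol]
  ring

lemma polyDeg_Npol (ζ : ℂ) (k : ℕ) (a b : ℕ → ℂ) :
    PolyDeg (2 * k) fun t => Npol ζ (k + 1) (Function.update a 0 t) b := by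
  unfold Npol
  refine PolyDeg.sum _ fun σ _ => ?_
  have h1 : ∀ j i : Fin (k + 1), PolyDeg (if i = 0 then 2 else 0)
      fun t => hpol ζ (Function.update a 0 t i) (b j) := by
    intro j i
    by_cases hi : i = 0
    · subst hi
      simpa using polyDeg_hpol ζ (b j)
    · have hi' : (i : ℕ) ≠ 0 := fun h => hi (Fin.ext h)
      simpa [hi, Function.update_of_ne hi'] using PolyDeg.const (hpol ζ (a i) (b j))
  have h2 : ∀ j : Fin (k + 1), PolyDeg (if σ j = 0 then 0 else 2)
      fun t => ∏ i ∈ Finset.univ.erase (σ j), hpol ζ (Function.update a 0 t i) (b j) := by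
    intro j
    refine (PolyDeg.prod _ fun i _ => h1 j i).mono ?_
    rw [Finset.sum_ite_eq']
    by_cases h : σ j = 0
    · simp [h]
    · rw [if_neg h]; split_ifs <;> omega
  have h3 := (PolyDeg.const ((Equiv.Perm.sign σ : ℤ) : ℂ)).mul (PolyDeg.prod Finset.univ fun j _ => h2 j)
  refine h3.mono ?_
  have : ∑ j : Fin (k + 1), (if σ j = 0 then 0 else 2) = ∑ j : Fin (k + 1), if j = 0 then 0 else 2 :=
    Equiv.sum_comp σ fun j => if j = 0 then 0 else 2
  rw [this, Fin.sum_univ_succ]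
  simp [Fin.succ_ne_zero]
  omega

/-- Lagrange basis polynomials at the nodes `0, …, k`. -/
def lagr (k m : ℕ) : Polynomial ℂ := Lagrange.basis (Finset.range (k + 1)) (fun m : ℕ => (m : ℂ)) m

/-- The functional extracting the coefficient of degree `k`. -/
def Lop (k : ℕ) (f : ℂ → ℂ) : ℂ := ∑ m ∈ Finset.range (k + 1), f m * (lagr k m).coeff k

lemma lagrange_eq {k : ℕ} {Q : Polynomial ℂ} (hQ : Q.natDegree ≤ k) :
    Q = ∑ m ∈ Finset.range (k + 1), Polynomial.C (Q.eval (m : ℂ)) * lagr k m := by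
  have := Lagrange.eq_interpolate (s := Finset.range (k + 1)) (v := fun m : ℕ => (m : ℂ)) (f := Q)
    (Nat.cast_injective.injOn) (by
      rw [Finset.card_range]
      exact lt_of_le_of_lt Polynomial.degree_le_natDegree (by exact_mod_cast Nat.lt_succ_of_le hQ))
  rw [Lagrange.interpolate_apply] at this
  exact this

lemma natDegree_lagr_le (k m : ℕ) (hm : m ∈ Finset.range (k + 1)) : (lagr k m).natDegree ≤ k := by
  rw [lagr, Lagrange.natDegree_basis Nat.cast_injective.injOn hm, Finset.card_range]
  simp

lemma Lop_eq_coeff {k : ℕ} {Q : Polynomial ℂ} (hQ : Q.natDegree ≤ k) {f : ℂ → ℂ}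
    (hf : ∀ t, f t = Q.eval t) : Lop k f = Q.coeff k := by
  conv_rhs => rw [lagrange_eq hQ]
  rw [Polynomial.finsetSum_coeff, Lop]
  refine Finset.sum_congr rfl fun m _ => ?_
  rw [Polynomial.coeff_C_mul, hf]

lemma polyDeg_iff (k : ℕ) (f : ℂ → ℂ) :
    PolyDeg k f ↔ ∀ t, f t = ∑ m ∈ Finset.range (k + 1), f m * (lagr k m).eval t := by
  constructor
  · rintro ⟨Q, hQ, hf⟩ t
    rw [hf]
    conv_lhs => rw [lagrange_eq hQ]
    rw [Polynomial.eval_finsetSum]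
    refine Finset.sum_congr rfl fun m _ => ?_
    rw [Polynomial.eval_mul, Polynomial.eval_C, hf]
  · intro h
    refine ⟨∑ m ∈ Finset.range (k + 1), Polynomial.C (f m) * lagr k m,
      Polynomial.natDegree_sum_le_of_forall_le _ _ fun m hm => ?_, fun t => ?_⟩
    · exact (Polynomial.natDegree_C_mul_le _ _).trans (natDegree_lagr_le k m hm)
    · rw [h t, Polynomial.eval_finsetSum]
      simp

lemma Lop_sub_mul {k : ℕ} {f : ℂ → ℂ} (hf : PolyDeg k f) (A c : ℂ) :
    Lop (k + 1) (fun X => A * (X - c) * f X) = A * Lop k f := by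
  obtain ⟨Q, hQ, hf⟩ := hf
  rw [Lop_eq_coeff hQ hf, Lop_eq_coeff (Q := Polynomial.C A * ((Polynomial.X - Polynomial.C c) * Q))]
  · rw [Polynomial.coeff_C_mul, sub_mul, Polynomial.coeff_sub, Polynomial.coeff_X_mul,
      Polynomial.coeff_C_mul, Polynomial.coeff_eq_zero_of_natDegree_lt (by omega : Q.natDegree < k + 1)]
    ring
  · refine (Polynomial.natDegree_C_mul_le _ _).trans (Polynomial.natDegree_mul_le.trans ?_)
    rw [Polynomial.natDegree_X_sub_C]; omega
  · intro t
    rw [hf]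
    simp [mul_assoc]

lemma tendsto_eval_div_pow {k : ℕ} {Q : Polynomial ℂ} (hQ : Q.natDegree ≤ k) {X : ℕ → ℂ}
    (hX0 : ∀ n, X n ≠ 0) (hX : Filter.Tendsto (fun n => (X n)⁻¹) Filter.atTop (𝓝 0)) :
    Filter.Tendsto (fun n => Q.eval (X n) / X n ^ k) Filter.atTop (𝓝 (Q.coeff k)) := by
  have e : ∀ n, Q.eval (X n) / X n ^ k = (Q.reflect k).eval (X n)⁻¹ := by
    intro n
    let := invertibleOfNonzero (hX0 n)
    have := Polynomial.eval₂_reflect_mul_pow (RingHom.id ℂ) (X n) k Q hQ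
    rw [invOf_eq_inv] at this
    simp only [Polynomial.eval₂_id] at this
    rw [← this, mul_div_cancel_right₀ _ (pow_ne_zero _ (hX0 n))]
  simp only [e]
  have h := ((Q.reflect k).continuous.tendsto 0).comp hX
  have h0 : (Q.reflect k).eval 0 = Q.coeff k := by
    rw [← Polynomial.coeff_zero_eq_eval_zero, Polynomial.coeff_reflect]
    rw [Polynomial.revAt_le (Nat.zero_le k), Nat.sub_zero]
  rwa [h0] at h

lemma tendsto_Lop {k : ℕ} {F : ℂ → ℂ → ℂ} (hF : ∀ s, PolyDeg k (F s)) (hc : ∀ X, Continuous fun s => F s X)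
    {s X : ℕ → ℂ} (hs : Filter.Tendsto s Filter.atTop (𝓝 0)) (hX0 : ∀ n, X n ≠ 0)
    (hX : Filter.Tendsto (fun n => (X n)⁻¹) Filter.atTop (𝓝 0)) :
    Filter.Tendsto (fun n => F (s n) (X n) / X n ^ k) Filter.atTop (𝓝 (Lop k (F 0))) := by
  have e : ∀ n, F (s n) (X n) / X n ^ k =
      ∑ m ∈ Finset.range (k + 1), F (s n) m * ((lagr k m).eval (X n) / X n ^ k) := by
    intro n
    rw [(polyDeg_iff k _).mp (hF (s n)) (X n), Finset.sum_div]
    exact Finset.sum_congr rfl fun m _ => by ring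
  simp only [e]
  exact tendsto_finsetSum _ fun m hm => (((hc m).tendsto 0).comp hs).mul
    (tendsto_eval_div_pow (natDegree_lagr_le k m hm) hX0 hX)

section HFamily

variable {ζ : ℂ} {H : (k : ℕ) → (Fin (2 * k) → ℂ) → ℂ}

lemma exists_poly_Fab (hH : IsHFamily ζ H) (k : ℕ) (a b : ℕ → ℂ) (i : ℕ) :
    ∃ Q : Polynomial ℂ, ∀ t, Fab H k (Function.update a i t) b = Q.eval t := by
  obtain ⟨P, hP⟩ := hH.2.1 k
  refine ⟨MvPolynomial.aeval (fun j : Fin (2 * k) =>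
    if (j : ℕ) < k then (if (j : ℕ) = i then Polynomial.X else Polynomial.C (a j))
      else Polynomial.C (b (j - k))) P, fun t => ?_⟩
  rw [Fab, hP, MvPolynomial.aeval_def, ← Polynomial.coe_evalRingHom, MvPolynomial.hom_eval₂]
  have e1 : (Polynomial.evalRingHom t).comp (algebraMap ℂ (Polynomial ℂ)) = RingHom.id ℂ := by
    ext; simp
  rw [e1, MvPolynomial.eval, MvPolynomial.coe_eval₂Hom]
  congr 1
  ext j
  simp only [seqAB, Function.update_apply, Polynomial.coe_evalRingHom]
  split_ifs <;> simp

lemma polyDeg_Fab_of_distinct (hH : IsHFamily ζ H) {k : ℕ} {a b : ℕ → ℂ}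
    (ha : ∀ i < k + 1, ∀ j < k + 1, i ≠ j → a i ≠ a j)
    (hb : ∀ i < k + 1, ∀ j < k + 1, i ≠ j → b i ≠ b j) :
    PolyDeg k fun t => Fab H (k + 1) (Function.update a 0 t) b := by
  obtain ⟨Q, hQ⟩ := exists_poly_Fab hH (k + 1) a b 0
  obtain ⟨N, hN, hNe⟩ := polyDeg_Npol ζ k a b
  refine ⟨Q, ?_, hQ⟩
  by_cases hQ0 : Q = 0
  · simp [hQ0]
  set c := vd k (fun i => a (i + 1)) * vd (k + 1) b with hc
  have hc0 : c ≠ 0 := mul_ne_zero (vd_ne_zero fun i hi j hj hij => ha _ (by omega) _ (by omega) (by omega))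
    (vd_ne_zero hb)
  set V : Polynomial ℂ := ∏ i : Fin k, (Polynomial.X - Polynomial.C (a (i + 1))) with hV
  have hVm : V.Monic := Polynomial.monic_prod_of_monic _ _ fun i _ => Polynomial.monic_X_sub_C _
  have hVd : V.natDegree = k := by
    rw [hV, Polynomial.natDegree_prod_of_monic _ _ fun i _ => Polynomial.monic_X_sub_C _]
    simp
  have key : Polynomial.C ((-1) ^ k * c) * (V * Q) = N := by
    refine Polynomial.funext fun t => ?_
    rw [← hNe]
    dsimp only
    rw [← Fab_mul_vd hH, hQ, vd_succ]
    simp only [Polynomial.eval_mul, Polynomial.eval_C, hV, Polynomial.eval_prod, Polynomial.eval_sub,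
      Polynomial.eval_X, Function.update_self, hc]
    have e2 : ∏ i : Fin k, (Function.update a 0 t (i + 1) - t) =
        (-1) ^ k * ∏ i : Fin k, (t - a (i + 1)) := by
      have : ((-1 : ℂ)) ^ k = ∏ _i : Fin k, (-1 : ℂ) := by simp
      rw [this, ← Finset.prod_mul_distrib]
      refine Finset.prod_congr rfl fun i _ => ?_
      rw [Function.update_of_ne (by omega)]
      ring
    have e3 : (fun i => Function.update a 0 t (i + 1)) = fun i => a (i + 1) := by
      ext i; rw [Function.update_of_ne (by omega)]
    rw [e2, e3]
    ring
  rw [← key, Polynomial.natDegree_C_mul (mul_ne_zero (pow_ne_zero _ (by norm_num)) hc0),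
    hVm.natDegree_mul' hQ0, hVd] at hN
  omega

lemma polyDeg_Fab_zero (hH : IsHFamily ζ H) (k : ℕ) (a b : ℕ → ℂ) :
    PolyDeg k fun t => Fab H (k + 1) (Function.update a 0 t) b := by
  rw [polyDeg_iff]
  intro T
  let sh : (ℕ → ℂ) → ℂ → ℕ → ℂ := fun a t i => a i + t * i
  have hcont : ∀ m : ℂ, Continuous fun t => Fab H (k + 1) (Function.update (sh a t) 0 m) (sh b t) := by
    intro m
    refine (continuous_Fab hH (k + 1)).comp
      (f := fun t => (Function.update (sh a t) 0 m, sh b t)) ?_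
    refine Continuous.prodMk (Continuous.update (by simp only [sh]; fun_prop) 0 continuous_const) ?_
    simp only [sh]; fun_prop
  have h0 : ∀ a, sh a 0 = a := fun a => by ext i; simp [sh]
  have key := eq_of_eventually_punctured (hcont T)
    (continuous_finsetSum (Finset.range (k + 1)) fun m _ => (hcont m).mul
      (continuous_const (y := (lagr k m).eval T))) (by
    filter_upwards [eventually_distinct a (k + 1), eventually_distinct b (k + 1)] with t hta htb
    exact (polyDeg_iff k _).mp (polyDeg_Fab_of_distinct hH (a := sh a t) (b := sh b t) hta htb) T)
  simpa only [h0, Pi.mul_apply] using key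

lemma update_swap (a : ℕ → ℂ) (i j : ℕ) (t : ℂ) :
    (fun l => Function.update a i t (Equiv.swap i j l)) =
      Function.update (fun l => a (Equiv.swap i j l)) j t := by
  ext l
  by_cases h : l = j
  · subst h; simp
  · rw [Function.update_of_ne h, Function.update_of_ne]
    intro hl
    rw [Equiv.swap_apply_eq_iff, Equiv.swap_apply_left] at hl
    exact h hl

/-- The polynomial `H_{2(k+1)}` has degree at most `k` in each variable of the first group. -/
lemma polyDeg_Fab (hH : IsHFamily ζ H) {k i : ℕ} (hi : i < k + 1) (a b : ℕ → ℂ) :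
    PolyDeg k fun t => Fab H (k + 1) (Function.update a i t) b := by
  have := polyDeg_Fab_zero hH k (fun l => a (Equiv.swap i 0 l)) b
  simp only [← update_swap, Fab_swap_left hH hi (Nat.succ_pos k)] at this
  exact this

/-- The polynomial `H_{2(k+1)}` has degree at most `k` in each variable of the second group. -/
lemma polyDeg_Fab' (hH : IsHFamily ζ H) {k i : ℕ} (hi : i < k + 1) (a b : ℕ → ℂ) :
    PolyDeg k fun t => Fab H (k + 1) a (Function.update b i t) := by
  simp only [Fab_comm hH (k + 1) a]
  exact polyDeg_Fab hH hi b a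

/-- Sequences of triples degenerating to `(0, ∞, ∞)`. -/
lemma exists_triple_seq {ζ : ℂ} (hq : 1 - ζ ^ 2 ≠ 0) : ∃ a X c : ℕ → ℂ,
    (∀ n, Triple ζ (a n) (X n) (c n)) ∧ (∀ n, X n ≠ 0) ∧
    Filter.Tendsto a Filter.atTop (𝓝 0) ∧
    Filter.Tendsto (fun n => (X n)⁻¹) Filter.atTop (𝓝 0) ∧
    Filter.Tendsto (fun n => a n * c n) Filter.atTop (𝓝 0) ∧
    Filter.Tendsto (fun n => a n * c n ^ 2) Filter.atTop (𝓝 (-(1 - ζ ^ 2)⁻¹)) := by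
  set q := 1 - ζ ^ 2 with hqd
  set S := (3 + ζ ^ 2) / q with hS
  let a : ℕ → ℂ := fun n => 1 / ((n : ℂ) + 1)
  let m : ℕ → ℂ := fun n => (S - a n) / 2
  have ha0 : ∀ n, a n ≠ 0 := fun n => by
    simp only [a]; exact one_div_ne_zero (by exact_mod_cast Nat.succ_ne_zero n)
  have hd : ∀ n, ∃ d : ℂ, d ^ 2 = m n ^ 2 - 1 / (q * a n) := fun n =>
    IsAlgClosed.exists_pow_nat_eq _ (by norm_num)
  choose d hd using hd
  have ta : Filter.Tendsto a Filter.atTop (𝓝 0) := by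
    have := tendsto_one_div_add_atTop_nhds_zero_nat (𝕜 := ℝ)
    have h2 := (Complex.continuous_ofReal.tendsto 0).comp this
    refine (h2.congr fun n => ?_).trans (by simp)
    simp [a]
  have tm : Filter.Tendsto m Filter.atTop (𝓝 (S / 2)) := by
    simpa using ((tendsto_const_nhds (x := S)).sub ta).div_const 2
  have tad : Filter.Tendsto (fun n => a n * d n ^ 2) Filter.atTop (𝓝 (-q⁻¹)) := by
    have h : Filter.Tendsto (fun n => a n * m n ^ 2 - q⁻¹) Filter.atTop (𝓝 (0 * (S / 2) ^ 2 - q⁻¹)) :=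
      (ta.mul (tm.pow 2)).sub tendsto_const_nhds
    rw [zero_mul, zero_sub] at h
    refine h.congr fun n => ?_
    rw [hd]
    have := ha0 n
    field_simp
  have hq' : -q⁻¹ ≠ 0 := neg_ne_zero.mpr (inv_ne_zero hq)
  have hdne : ∀ᶠ n in Filter.atTop, d n ≠ 0 := by
    filter_upwards [tad.eventually_ne hq'] with n hn h
    exact hn (by rw [h]; ring)
  have te : Filter.Tendsto (fun n => (d n)⁻¹) Filter.atTop (𝓝 0) := by
    have h : Filter.Tendsto (fun n => ((d n)⁻¹) ^ 2) Filter.atTop (𝓝 0) := by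
      have h2 := ta.mul (tad.inv₀ hq')
      rw [zero_mul] at h2
      refine h2.congr fun n => ?_
      have := ha0 n
      by_cases hdn : d n = 0
      · simp [hdn]
      · field_simp
    rw [tendsto_zero_iff_norm_tendsto_zero] at h ⊢
    have h3 := (Real.continuous_sqrt.tendsto 0).comp h
    rw [Real.sqrt_zero] at h3
    refine h3.congr fun n => ?_
    simp [norm_pow, Real.sqrt_sq (norm_nonneg _)]
  have tX : Filter.Tendsto (fun n => (m n + d n) * (d n)⁻¹) Filter.atTop (𝓝 1) := by
    have h := (tm.mul te).add_const 1
    rw [mul_zero, zero_add] at h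
    refine h.congr' ?_
    filter_upwards [hdne] with n hn
    field_simp
  have tc : Filter.Tendsto (fun n => (m n - d n) * (d n)⁻¹) Filter.atTop (𝓝 (-1)) := by
    have h := (tm.mul te).sub_const 1
    rw [mul_zero, zero_sub] at h
    refine h.congr' ?_
    filter_upwards [hdne] with n hn
    field_simp
  have hXc : ∀ n, (m n + d n) * (m n - d n) = 1 / (q * a n) := fun n => by
    linear_combination -(hd n)
  have hXc0 : ∀ n, (m n + d n) * (m n - d n) ≠ 0 := fun n => by
    rw [hXc]; exact one_div_ne_zero (mul_ne_zero hq (ha0 n))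
  have tac : Filter.Tendsto (fun n => a n * (m n - d n) ^ 2) Filter.atTop (𝓝 (-q⁻¹)) := by
    have h := tad.mul (tc.pow 2)
    rw [show -q⁻¹ * (-1) ^ 2 = -q⁻¹ by ring] at h
    refine h.congr' ?_
    filter_upwards [hdne] with n hn
    field_simp
  refine ⟨a, fun n => m n + d n, fun n => m n - d n, fun n => ⟨?_, ?_⟩, fun n =>
    left_ne_zero_of_mul (hXc0 n), ta, ?_, ?_, tac⟩
  · rw [mul_assoc, hXc]
    have := ha0 n
    rw [← hqd]
    field_simp
  · simp only [m, hS]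
    rw [← hqd]
    field_simp
    ring
  · have h := te.mul (tX.inv₀ one_ne_zero)
    rw [zero_mul] at h
    refine h.congr' ?_
    filter_upwards [hdne] with n hn
    rw [mul_inv, inv_inv, mul_left_comm, inv_mul_cancel₀ hn, mul_one]
  · have h := tac.mul (te.mul (tc.inv₀ (by norm_num)))
    rw [zero_mul, mul_zero] at h
    refine h.congr' ?_
    filter_upwards [hdne] with n hn
    have := right_ne_zero_of_mul (hXc0 n)
    field_simp

/-- The leading coefficient of `H_{2(k+1)}` when one variable of the other group vanishes. -/
lemma Lop_Fab (hH : IsHFamily ζ H) (hq : 1 - ζ ^ 2 ≠ 0) (k : ℕ) (a b : ℕ → ℂ) (ha : a 0 = 0) :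
    Lop k (fun X => Fab H (k + 1) a (Function.update b 0 X)) =
      (-(1 - ζ ^ 2)) ^ k * Fab H k (fun i => a (i + 1)) (fun i => b (i + 1)) := by
  obtain ⟨s, X, c, hT, hX0, ts, tX, tac, tac2⟩ := exists_triple_seq hq
  have hu : Continuous fun s : ℂ => Function.update a 0 s := continuous_const.update 0 continuous_id
  have h := tendsto_Lop (k := k) (F := fun s X => Fab H (k + 1) (Function.update a 0 s) (Function.update b 0 X))
    (fun s => polyDeg_Fab' hH (Nat.succ_pos k) _ _)
    (fun X => (continuous_Fab hH (k + 1)).comp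
      (f := fun s => (Function.update a 0 s, Function.update b 0 X))
      (hu.prodMk continuous_const)) ts hX0 tX
  rw [show Function.update a 0 0 = a by rw [← ha, Function.update_eq_self]] at h
  refine tendsto_nhds_unique h ?_
  have e : ∀ n, Fab H (k + 1) (Function.update a 0 (s n)) (Function.update b 0 (X n)) / X n ^ k =
      (∏ i : Fin k, (1 - ζ ^ 2) ^ 2 * (s n * (a (i + 1) - c n) * (b (i + 1) - c n))) *
        Fab H k (fun i => a (i + 1)) (fun i => b (i + 1)) := by
    intro n
    have hu : ∀ (a : ℕ → ℂ) t (i : ℕ), Function.update a 0 t (i + 1) = a (i + 1) := fun a t i =>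
      Function.update_of_ne (by omega) _ _
    rw [Fab_succ hH (c := c n) (by simpa using hT n)]
    simp only [hu, Function.update_self]
    have hp : ∏ i : Fin k, (1 - ζ ^ 2) ^ 2 * (s n * (a (i + 1) - c n) * (b (i + 1) - c n)) =
        (1 - ζ ^ 2) ^ (2 * k) * s n ^ k * ∏ i : Fin k, (a (i + 1) - c n) * (b (i + 1) - c n) := by
      have : (1 - ζ ^ 2) ^ (2 * k) * s n ^ k = ∏ _i : Fin k, ((1 - ζ ^ 2) ^ 2 * s n) := by
        rw [Finset.prod_const, Finset.card_univ, Fintype.card_fin, mul_pow, pow_mul]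
      rw [this, ← Finset.prod_mul_distrib]
      exact Finset.prod_congr rfl fun i _ => by ring
    rw [hp, mul_pow]
    have := pow_ne_zero k (hX0 n)
    field_simp
  simp only [e]
  refine Filter.Tendsto.mul_const _ ?_
  have h1 : ∀ i : Fin k, Filter.Tendsto
      (fun n => (1 - ζ ^ 2) ^ 2 * (s n * (a (i + 1) - c n) * (b (i + 1) - c n))) Filter.atTop
      (𝓝 (-(1 - ζ ^ 2))) := by
    intro i
    have h2 := ((((ts.mul_const (a (i + 1) * b (i + 1))).sub
      (tac.mul_const (a (i + 1) + b (i + 1)))).add tac2).const_mul ((1 - ζ ^ 2) ^ 2))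
    have h3 : (1 - ζ ^ 2) ^ 2 * (0 * (a (i + 1) * b (i + 1)) - 0 * (a (i + 1) + b (i + 1)) +
        -(1 - ζ ^ 2)⁻¹) = -(1 - ζ ^ 2) := by field_simp; ring
    rw [h3] at h2
    refine h2.congr fun n => ?_
    ring
  simpa using tendsto_finsetProd (Finset.univ : Finset (Fin k)) fun i _ => h1 i

end HFamily

/-- Even-indexed entries. -/
def ev (w : ℕ → ℂ) : ℕ → ℂ := fun i => w (2 * i)
/-- Odd-indexed entries. -/
def od (w : ℕ → ℂ) : ℕ → ℂ := fun i => w (2 * i + 1)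

/-- The polynomial factor for an even number of variables. -/
def Rev (H : (k : ℕ) → (Fin (2 * k) → ℂ) → ℂ) (k : ℕ) (w : ℕ → ℂ) : ℂ :=
  Fab H k (ev w) (od w) *
    Lop k fun X => Fab H (k + 1) (Function.update (ev w) k J2c) (Function.update (od w) k X)

/-- The polynomial factor for an odd number of variables. -/
def Rod (H : (k : ℕ) → (Fin (2 * k) → ℂ) → ℂ) (k : ℕ) (w : ℕ → ℂ) : ℂ :=
  Fab H (k + 1) (Function.update (ev w) k J2c) (Function.update (od w) k (w (2 * k))) *
    Lop k fun X => Fab H (k + 1) (Function.update (ev w) k X) (Function.update (od w) k (w (2 * k)))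

/-- The symmetric polynomial to which the scalar product with `n` pairs is proportional. -/
def Rn (H : (k : ℕ) → (Fin (2 * k) → ℂ) → ℂ) (n : ℕ) (w : ℕ → ℂ) : ℂ :=
  if n % 2 = 0 then Rev H (n / 2) w else Rod H (n / 2) w

lemma Rn_even (H) (k : ℕ) (w : ℕ → ℂ) : Rn H (2 * k) w = Rev H k w := by
  rw [Rn, if_pos (by omega), show 2 * k / 2 = k by omega]

lemma Rn_odd (H) (k : ℕ) (w : ℕ → ℂ) : Rn H (2 * k + 1) w = Rod H k w := by
  rw [Rn, if_neg (by omega), show (2 * k + 1) / 2 = k by omega]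

lemma prod_range_two_mul (f : ℕ → ℂ) (k : ℕ) :
    ∏ i ∈ Finset.range (2 * k), f i = ∏ i ∈ Finset.range k, f (2 * i) * f (2 * i + 1) := by
  induction k with
  | zero => simp
  | succ k ih =>
    rw [show 2 * (k + 1) = 2 * k + 1 + 1 by ring, Finset.prod_range_succ, Finset.prod_range_succ, ih,
      Finset.prod_range_succ, mul_assoc]

lemma update_succ_shift (a : ℕ → ℂ) (k : ℕ) (t : ℂ) :
    (fun i => Function.update a (k + 1) t (i + 1)) = Function.update (fun i => a (i + 1)) k t := by
  ext i
  by_cases h : i = k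
  · subst h; simp
  · rw [Function.update_of_ne h, Function.update_of_ne (by omega)]

lemma ev_shift (w : ℕ → ℂ) : (fun i => ev w (i + 1)) = ev fun i => w (i + 2) := by
  ext i; simp only [ev]; congr 1

lemma od_shift (w : ℕ → ℂ) : (fun i => od w (i + 1)) = od fun i => w (i + 2) := by
  ext i; simp only [od]; congr 1

section HFamily

variable {ζ : ℂ} {H : (k : ℕ) → (Fin (2 * k) → ℂ) → ℂ}

lemma polyDeg_const_mul {d : ℕ} {f : ℂ → ℂ} (hf : PolyDeg d f) (A : ℂ) : PolyDeg d fun X => A * f X :=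
  ((PolyDeg.const A).mul hf).mono (by omega)

lemma Fab_succ_update (hH : IsHFamily ζ H) {k : ℕ} {w : ℕ → ℂ} {c : ℂ} (h : Triple ζ (w 0) (w 1) c)
    (X Y : ℂ) :
    Fab H (k + 2) (Function.update (ev w) (k + 1) X) (Function.update (od w) (k + 1) Y) =
      (1 - ζ ^ 2) ^ (2 * k + 2) * (w 0 * w 1) ^ (k + 1) *
        (∏ i ∈ Finset.range (2 * k), (w (i + 2) - c)) * ((X - c) * (Y - c)) *
          Fab H (k + 1) (Function.update (ev fun i => w (i + 2)) k X)
            (Function.update (od fun i => w (i + 2)) k Y) := by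
  have h1 : ∀ (X : ℂ), Function.update (ev w) (k + 1) X 0 = w 0 := fun X =>
    Function.update_of_ne (by omega) _ _
  have h2 : ∀ (X : ℂ), Function.update (od w) (k + 1) X 0 = w 1 := fun X =>
    Function.update_of_ne (by omega) _ _
  rw [Fab_succ hH (c := c) (by rw [h1, h2]; exact h), h1, h2, update_succ_shift, update_succ_shift,
    ev_shift, od_shift]
  congr 1
  rw [show 2 * (k + 1) = 2 * k + 2 by ring, mul_assoc _ (∏ i ∈ _, _)]
  congr 1
  rw [Fin.prod_univ_eq_prod_range
    (fun i => (Function.update (ev w) (k + 1) X (i + 1) - c) * (Function.update (od w) (k + 1) Y (i + 1) - c)),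
    Finset.prod_range_succ, Function.update_self, Function.update_self, prod_range_two_mul]
  congr 1
  refine Finset.prod_congr rfl fun i hi => ?_
  rw [Finset.mem_range] at hi
  rw [Function.update_of_ne (by omega), Function.update_of_ne (by omega)]
  rfl

lemma Rn_add_two (hH : IsHFamily ζ H) {n : ℕ} {w : ℕ → ℂ} {c : ℂ} (h : Triple ζ (w 0) (w 1) c) :
    Rn H (n + 2) w = (1 - ζ ^ 2) ^ (2 * n + 2) * (w 0 * w 1) ^ (n + 1) * (J2c - c) *
      (∏ i ∈ Finset.range n, (w (i + 2) - c)) ^ 2 * Rn H n fun i => w (i + 2) := by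
  obtain ⟨k, rfl | rfl⟩ := Nat.even_or_odd' n
  · rw [show 2 * k + 2 = 2 * (k + 1) by ring, Rn_even, Rn_even, Rev, Rev]
    rw [Fab_succ hH (c := c) (by simpa [ev, od] using h), ev_shift, od_shift,
      Fin.prod_univ_eq_prod_range (fun i => (ev w (i + 1) - c) * (od w (i + 1) - c)),
      show ∏ i ∈ Finset.range k, (ev w (i + 1) - c) * (od w (i + 1) - c) =
        ∏ i ∈ Finset.range (2 * k), (w (i + 2) - c) from (prod_range_two_mul (fun i => w (i + 2) - c) k).symm]
    simp only [Fab_succ_update hH h]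
    set P := ∏ i ∈ Finset.range (2 * k), (w (i + 2) - c)
    set f := fun X => Fab H (k + 1) (Function.update (ev fun i => w (i + 2)) k J2c)
            (Function.update (od fun i => w (i + 2)) k X) with hf
    have := Lop_sub_mul (f := f) (k := k) (polyDeg_Fab' hH (Nat.lt_succ_self k) _ _)
      ((1 - ζ ^ 2) ^ (2 * k + 2) * (w 0 * w 1) ^ (k + 1) * P * (J2c - c)) c
    have e : (fun X => (1 - ζ ^ 2) ^ (2 * k + 2) * (w 0 * w 1) ^ (k + 1) * P * ((J2c - c) * (X - c)) * f X) =
      fun X => (1 - ζ ^ 2) ^ (2 * k + 2) * (w 0 * w 1) ^ (k + 1) * P * (J2c - c) * (X - c) * f X := by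
      ext X; ring
    have e' := congrArg (Lop (k + 1)) e
    rw [this] at e'
    rw [show ev w 0 = w 0 from rfl, show od w 0 = w 1 from rfl]
    linear_combination (exp := 1) ((1 - ζ ^ 2) ^ (2 * k) * (w 0 * w 1) ^ k * P *
      Fab H k (ev fun i => w (i + 2)) (od fun i => w (i + 2))) * e'
  · rw [show 2 * k + 1 + 2 = 2 * (k + 1) + 1 by ring, Rn_odd, Rn_odd, Rod, Rod]
    simp only [Fab_succ_update hH h, show 2 * (k + 1) = 2 * k + 2 by ring]
    rw [Finset.prod_range_succ]
    set P := ∏ i ∈ Finset.range (2 * k), (w (i + 2) - c)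
    set v := w (2 * k + 2)
    set f := fun X => Fab H (k + 1) (Function.update (ev fun i => w (i + 2)) k X)
            (Function.update (od fun i => w (i + 2)) k v) with hf
    have := Lop_sub_mul (f := f) (k := k) (polyDeg_Fab hH (Nat.lt_succ_self k) _ _)
      ((1 - ζ ^ 2) ^ (2 * k + 2) * (w 0 * w 1) ^ (k + 1) * P * (v - c)) c
    have e : (fun X => (1 - ζ ^ 2) ^ (2 * k + 2) * (w 0 * w 1) ^ (k + 1) * P * ((X - c) * (v - c)) * f X) =
      fun X => (1 - ζ ^ 2) ^ (2 * k + 2) * (w 0 * w 1) ^ (k + 1) * P * (v - c) * (X - c) * f X := by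
      ext X; ring
    have e' := congrArg (Lop (k + 1)) e
    rw [this] at e'
    linear_combination (exp := 1) ((1 - ζ ^ 2) ^ (2 * k + 2) * (w 0 * w 1) ^ (k + 1) * P *
      ((J2c - c) * (v - c)) * f J2c) * e'

lemma ev_update_zero (w : ℕ → ℂ) (t : ℂ) : ev (Function.update w 0 t) = Function.update (ev w) 0 t := by
  ext i; simp [ev, Function.update_apply]

lemma od_update_zero (w : ℕ → ℂ) (t : ℂ) : od (Function.update w 0 t) = od w := by
  ext i; simp [od]

lemma polyDeg_Lop {d k : ℕ} {F : ℂ → ℂ → ℂ} (h : ∀ X, PolyDeg d fun t => F t X) :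
    PolyDeg d fun t => Lop k (F t) := by
  unfold Lop
  refine PolyDeg.sum _ fun m _ => ?_
  have := polyDeg_const_mul (h m) ((lagr k m).coeff k)
  simpa only [mul_comm] using this

lemma polyDeg_Rn (hH : IsHFamily ζ H) (n : ℕ) (w : ℕ → ℂ) :
    PolyDeg (n + 1) fun t => Rn H (n + 2) (Function.update w 0 t) := by
  have hc : ∀ (k : ℕ) (t X : ℂ), Function.update (Function.update (ev w) 0 t) (k + 1) X =
      Function.update (Function.update (ev w) (k + 1) X) 0 t := fun k t X =>
    Function.update_comm (by omega) _ _ _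
  obtain ⟨k, rfl | rfl⟩ := Nat.even_or_odd' n
  · simp only [show 2 * k + 2 = 2 * (k + 1) by ring, Rn_even, Rev, ev_update_zero, od_update_zero, hc]
    exact ((polyDeg_Fab_zero hH k _ _).mul (polyDeg_Lop fun X => polyDeg_Fab_zero hH (k + 1) _ _)).mono
      (by omega)
  · have hw : ∀ t, Function.update w 0 t (2 * (k + 1)) = w (2 * (k + 1)) := fun t =>
      Function.update_of_ne (by omega) _ _
    simp only [show 2 * k + 1 + 2 = 2 * (k + 1) + 1 by ring, Rn_odd, Rod, ev_update_zero, od_update_zero, hc,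
      hw]
    exact ((polyDeg_Fab_zero hH (k + 1) _ _).mul
      (polyDeg_Lop fun X => polyDeg_Fab_zero hH (k + 1) _ _)).mono (by omega)

lemma Rn_swap_odd (hH : IsHFamily ζ H) {n i : ℕ} (hi : 2 * i + 1 < n) (w : ℕ → ℂ) :
    Rn H n (fun l => w (Equiv.swap 1 (2 * i + 1) l)) = Rn H n w := by
  have hev : ev (fun l => w (Equiv.swap 1 (2 * i + 1) l)) = ev w := by
    ext l
    simp only [ev]
    rw [Equiv.swap_apply_of_ne_of_ne (by omega) (by omega)]
  have hod : od (fun l => w (Equiv.swap 1 (2 * i + 1) l)) = fun l => od w (Equiv.swap 0 i l) := by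
    ext l
    simp only [od]
    congr 1
    simp only [Equiv.swap_apply_def]
    split_ifs <;> omega
  have hup : ∀ {k} X, i < k → Function.update (fun l => od w (Equiv.swap 0 i l)) k X =
      fun l => Function.update (od w) k X (Equiv.swap 0 i l) := by
    intro k X hk
    ext l
    by_cases h : l = k
    · subst h
      rw [Equiv.swap_apply_of_ne_of_ne (by omega) (by omega)]; simp
    · rw [Function.update_of_ne h, Function.update_of_ne]
      simp only [Equiv.swap_apply_def]
      split_ifs <;> omega
  obtain ⟨k, rfl | rfl⟩ := Nat.even_or_odd' n
  · have hk : i < k := by omega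
    simp only [Rn_even, Rev, hev, hod, hup _ hk]
    simp only [Fab_swap_right hH (k := k) (by omega : 0 < k) hk,
      Fab_swap_right hH (k := k + 1) (by omega : 0 < k + 1) (by omega : i < k + 1)]
  · have hk : i < k := by omega
    have hw : w (Equiv.swap 1 (2 * i + 1) (2 * k)) = w (2 * k) := by
      rw [Equiv.swap_apply_of_ne_of_ne (by omega) (by omega)]
    simp only [Rn_odd, Rod, hev, hod, hw, hup _ hk]
    simp only [Fab_swap_right hH (k := k + 1) (by omega : 0 < k + 1) (by omega : i < k + 1)]

lemma Rn_swap_last (hH : IsHFamily ζ H) {k : ℕ} (hk : 0 < k) (w : ℕ → ℂ) :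
    Rn H (2 * k + 1) (fun l => w (Equiv.swap 1 (2 * k) l)) = Rn H (2 * k + 1) w := by
  have hev : ∀ X, ∀ l < k + 1, Function.update (ev (fun l => w (Equiv.swap 1 (2 * k) l))) k X l =
      Function.update (ev w) k X l := by
    intro X l hl
    by_cases h : l = k
    · subst h; simp
    · rw [Function.update_of_ne h, Function.update_of_ne h]
      simp only [ev]
      rw [Equiv.swap_apply_of_ne_of_ne (by omega) (by omega)]
  have hod : ∀ l < k + 1, Function.update (od (fun l => w (Equiv.swap 1 (2 * k) l))) k (w 1) l =
      Function.update (od w) k (w (2 * k)) (Equiv.swap 0 k l) := by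
    intro l hl
    by_cases h : l = k
    · subst h
      rw [Equiv.swap_apply_right, Function.update_self, Function.update_of_ne (by omega)]; rfl
    · rw [Function.update_of_ne h]
      by_cases h0 : l = 0
      · subst h0
        rw [Equiv.swap_apply_left, Function.update_self]
        simp [od]
      · rw [Equiv.swap_apply_of_ne_of_ne h0 h, Function.update_of_ne h]
        simp only [od]
        rw [Equiv.swap_apply_of_ne_of_ne (by omega) (by omega)]
  have hF : ∀ X, Fab H (k + 1) (Function.update (ev (fun l => w (Equiv.swap 1 (2 * k) l))) k X)
      (Function.update (od (fun l => w (Equiv.swap 1 (2 * k) l))) k (w 1)) =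
      Fab H (k + 1) (Function.update (ev w) k X) (Function.update (od w) k (w (2 * k))) := by
    intro X
    rw [Fab_congr H (hev X) hod, Fab_swap_right hH (by omega) (by omega)]
  simp only [Rn_odd, Rod, Equiv.swap_apply_right, hF]

lemma Fab_update_zero (hH : IsHFamily ζ H) {k : ℕ} (t : ℂ) {i : ℕ} (hi : i < k) :
    Fab H k (Function.update (fun _ => 0) i t) (fun _ => 0) = H k (padded [t]) := by
  rw [← Fab_swap_left hH hi (by omega : 0 < k), update_swap, Fab]
  congr 1
  ext j
  simp only [seqAB, padded, Function.update_apply]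
  rcases j with ⟨_ | j, hj⟩
  · simp [show 0 < k by omega]
  · simp

lemma Rn_even_zero (hH : IsHFamily ζ H) (hq : 1 - ζ ^ 2 ≠ 0) (k : ℕ) :
    Rn H (2 * k) (fun _ => 0) = (-(1 - ζ ^ 2)) ^ k * H k (fun _ => 0) * H k (padded [J2c]) := by
  have h0 : ∀ k, Fab H k (fun _ => 0) (fun _ => 0) = H k fun _ => 0 := fun k => by
    rw [Fab]; congr 1; ext j; simp [seqAB]
  have e1 : ev (fun _ => 0) = fun _ => 0 := rfl
  have e2 : od (fun _ => 0) = fun _ => 0 := rfl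
  rw [Rn_even, Rev, e1, e2, h0]
  rcases k with _ | k
  · simp only [Nat.zero_add, Fab_one hH]
    rw [Lop_eq_coeff (Q := 1) (by simp) (by simp)]
    simp [hH.1]
  · have : ∀ X, Fab H (k + 1 + 1) (Function.update (fun _ => 0) (k + 1) J2c)
        (Function.update (fun _ => 0) (k + 1) X) = Fab H (k + 1 + 1)
        (Function.update (fun _ => 0) (k + 1) J2c) (Function.update (fun _ => 0) 0 X) := by
      intro X
      rw [← Fab_swap_right hH (i := k + 1) (j := 0) (by omega) (by omega), update_swap]
    simp only [this]
    rw [Lop_Fab hH hq (k + 1) _ _ (Function.update_of_ne (by omega) _ _), update_succ_shift,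
      Fab_update_zero hH J2c (Nat.lt_succ_self k)]
    ring

lemma Rn_odd_zero (hH : IsHFamily ζ H) (hq : 1 - ζ ^ 2 ≠ 0) (k : ℕ) :
    Rn H (2 * k + 1) (fun _ => 0) =
      (-(1 - ζ ^ 2)) ^ k * H k (fun _ => 0) * H (k + 1) (padded [J2c]) := by
  have h0 : ∀ k, Fab H k (fun _ => 0) (fun _ => 0) = H k fun _ => 0 := fun k => by
    rw [Fab]; congr 1; ext j; simp [seqAB]
  have e1 : ev (fun _ => 0) = fun _ => 0 := rfl
  have e2 : od (fun _ => 0) = fun _ => 0 := rfl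
  have e3 : Function.update (fun _ : ℕ => (0 : ℂ)) k 0 = fun _ => 0 := Function.update_eq_self k _
  have : ∀ X, Fab H (k + 1) (Function.update (fun _ => 0) k X) (fun _ => 0) =
      Fab H (k + 1) (fun _ => 0) (Function.update (fun _ => 0) 0 X) := by
    intro X
    rw [← Fab_swap_left hH (i := k) (j := 0) (by omega) (by omega), update_swap, Fab_comm hH]
  rw [Rn_odd, Rod, e1, e2, e3, Fab_update_zero hH J2c (Nat.lt_succ_self k)]
  simp only [this]
  rw [Lop_Fab hH hq k _ _ rfl, h0]
  ring

lemma Rn_zero (hH : IsHFamily ζ H) (w : ℕ → ℂ) : Rn H 0 w = 1 := by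
  rw [show 0 = 2 * 0 from rfl, Rn_even, Rev]
  simp only [Nat.zero_add, Fab_one hH, Fab_zero hH]
  rw [Lop_eq_coeff (Q := 1) (by simp) (by simp)]
  simp

lemma Rn_one (hH : IsHFamily ζ H) (w : ℕ → ℂ) : Rn H 1 w = 1 := by
  rw [show 1 = 2 * 0 + 1 from rfl, Rn_odd, Rod]
  simp only [Nat.zero_add, Fab_one hH]
  rw [Lop_eq_coeff (Q := 1) (by simp) (by simp)]
  simp

lemma continuous_Rn (hH : IsHFamily ζ H) (n : ℕ) : Continuous fun w => Rn H n w := by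
  have hev : Continuous ev := by unfold ev; fun_prop
  have hod : Continuous od := by unfold od; fun_prop
  have hF : ∀ k {f g : (ℕ → ℂ) → ℕ → ℂ}, Continuous f → Continuous g →
      Continuous fun w => Fab H k (f w) (g w) := fun k f g hf hg =>
    (continuous_Fab hH k).comp (f := fun w => (f w, g w)) (hf.prodMk hg)
  obtain ⟨k, rfl | rfl⟩ := Nat.even_or_odd' n
  · simp only [Rn_even, Rev, Lop]
    refine (hF _ hev hod).mul (continuous_finsetSum _ fun m _ => Continuous.mul (hF _ ?_ ?_) continuous_const)
    · exact hev.update _ continuous_const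
    · exact hod.update _ continuous_const
  · simp only [Rn_odd, Rod, Lop]
    refine (hF _ ?_ ?_).mul (continuous_finsetSum _ fun m _ => Continuous.mul (hF _ ?_ ?_) continuous_const)
    · exact hev.update _ continuous_const
    · exact hod.update _ (by fun_prop)
    · exact hev.update _ continuous_const
    · exact hod.update _ (by fun_prop)

end HFamily

/-- The component `↑↓` (`s = 0`) or `↓↑` (`s = 1`) of the boundary vector. -/
def chi (τ : ℂ) (s : Fin 2) (x : ℂ) : ℂ :=
  if s = 0 then th1 (x - 2 * ηc) (2 * τ) * th4 x (2 * τ) else th1 x (2 * τ) * th4 (x - 2 * ηc) (2 * τ)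

lemma two_chi_zero (x : ℂ) {τ : ℂ} (hτ : 0 < τ.im) :
    2 * chi τ 0 x = th1 (x - ηc) τ * th2 ηc τ - th2 (x - ηc) τ * th1 ηc τ := by
  have h := two_th1_mul_th4 (x - ηc) (-ηc) hτ
  rw [th1_neg, th2_neg] at h
  rw [chi, if_pos rfl]
  ring_nf at h ⊢
  exact h

lemma chi_add (x : ℂ) {τ : ℂ} (hτ : 0 < τ.im) :
    chi τ 0 x + chi τ 1 x = th1 (x - ηc) τ * th2 ηc τ := by
  have h := th1_mul_th2 (x - ηc) (-ηc) hτ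
  rw [th2_neg] at h
  rw [chi, chi, if_pos rfl, if_neg (by decide), h]
  ring_nf

lemma two_chi_one (x : ℂ) {τ : ℂ} (hτ : 0 < τ.im) :
    2 * chi τ 1 x = th1 (x - ηc) τ * th2 ηc τ + th2 (x - ηc) τ * th1 ηc τ := by
  linear_combination 2 * chi_add x hτ - two_chi_zero x hτ

lemma rv_eq (u : ℂ) {τ : ℂ} (hτ : 0 < τ.im) :
    rv τ u = th4 (2 * ηc) (2 * τ) * (th1 (u + ηc) τ * th2 ηc τ) := by
  rw [th1_mul_th2 _ _ hτ, rv, av, bv, show u + ηc + ηc = u + 2 * ηc by ring, add_sub_cancel_right]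
  ring

lemma cv_add_bv (x : ℂ) {τ : ℂ} (hτ : 0 < τ.im) : cv τ (2 * x) + bv τ (2 * x) =
    th4 (2 * x + 2 * ηc) (2 * τ) * (th1 (ηc + x) τ * th2 (ηc - x) τ) := by
  rw [th1_mul_th2 _ _ hτ, cv, bv, show ηc + x + (ηc - x) = 2 * ηc by ring,
    show ηc + x - (ηc - x) = 2 * x by ring]
  ring

lemma cv_sub_bv (x : ℂ) {τ : ℂ} (hτ : 0 < τ.im) : cv τ (2 * x) - bv τ (2 * x) =
    th4 (2 * x + 2 * ηc) (2 * τ) * (th1 (ηc - x) τ * th2 (ηc + x) τ) := by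
  rw [th1_mul_th2 _ _ hτ, cv, bv, show ηc - x + (ηc + x) = 2 * ηc by ring,
    show ηc - x - (ηc + x) = -(2 * x) by ring, th4_neg, th1_neg]
  ring

/-- The scalar by which a reflection acts on the boundary vector. -/
def rho (τ x : ℂ) : ℂ := th4 (2 * ηc - 2 * x) (2 * τ) * (th1 (x + ηc) τ * th2 (x + ηc) τ)

lemma reflect_zero (x : ℂ) {τ : ℂ} (hτ : 0 < τ.im) :
    cv τ (-2 * x) * chi τ 0 (-x) + bv τ (-2 * x) * chi τ 1 (-x) = rho τ x * chi τ 0 x := by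
  have e1 := cv_add_bv (-x) hτ
  have e2 := cv_sub_bv (-x) hτ
  have f1 := two_chi_zero (-x) hτ
  have f2 := two_chi_one (-x) hτ
  have g1 := two_chi_zero x hτ
  rw [show 2 * -x = -2 * x by ring] at e1 e2
  rw [show ηc + -x = -(x - ηc) by ring, show ηc - -x = x + ηc by ring] at e1 e2
  rw [show -x - ηc = -(x + ηc) by ring] at f1 f2
  rw [show -2 * x + 2 * ηc = 2 * ηc - 2 * x by ring] at e1 e2
  rw [th1_neg] at e1 f1 f2
  rw [th2_neg] at e2 f1 f2
  rw [rho]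
  have hc : 2 * cv τ (-2 * x) = th4 (2 * ηc - 2 * x) (2 * τ) * (-th1 (x - ηc) τ * th2 (x + ηc) τ) +
    th4 (2 * ηc - 2 * x) (2 * τ) * (th1 (x + ηc) τ * th2 (x - ηc) τ) := by linear_combination e1 + e2
  have hb : 2 * bv τ (-2 * x) = th4 (2 * ηc - 2 * x) (2 * τ) * (-th1 (x - ηc) τ * th2 (x + ηc) τ) -
    th4 (2 * ηc - 2 * x) (2 * τ) * (th1 (x + ηc) τ * th2 (x - ηc) τ) := by linear_combination e1 - e2
  have : (2 * cv τ (-2 * x)) * (2 * chi τ 0 (-x)) + (2 * bv τ (-2 * x)) * (2 * chi τ 1 (-x)) =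
    2 * (th4 (2 * ηc - 2 * x) (2 * τ) * (th1 (x + ηc) τ * th2 (x + ηc) τ)) * (2 * chi τ 0 x) := by
    rw [hc, hb, f1, f2, g1]; ring
  linear_combination this / 4

lemma reflect_one (x : ℂ) {τ : ℂ} (hτ : 0 < τ.im) :
    cv τ (-2 * x) * chi τ 1 (-x) + bv τ (-2 * x) * chi τ 0 (-x) = rho τ x * chi τ 1 x := by
  have e1 := cv_add_bv (-x) hτ
  have h0 := reflect_zero x hτ
  have f := chi_add (-x) hτ
  have g := chi_add x hτ
  rw [show 2 * -x = -2 * x by ring, show ηc + -x = -(x - ηc) by ring, show ηc - -x = x + ηc by ring,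
    show -2 * x + 2 * ηc = 2 * ηc - 2 * x by ring, th1_neg] at e1
  rw [show -x - ηc = -(x + ηc) by ring, th1_neg] at f
  have : (cv τ (-2 * x) + bv τ (-2 * x)) * (chi τ 0 (-x) + chi τ 1 (-x)) =
      rho τ x * (chi τ 0 x + chi τ 1 x) := by
    rw [e1, f, g, rho]; ring
  linear_combination this - h0

/-- The local action of `Ř(u)`. -/
def loc (τ u : ℂ) (p q : Fin 2) (F : Fin 2 → Fin 2 → ℂ) : ℂ :=
  if p = q then av τ u * F p q + dv τ u * F (flipS p) (flipS q) else cv τ u * F p q + bv τ u * F q p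

lemma loc_mul (τ u c : ℂ) (p q : Fin 2) (F : Fin 2 → Fin 2 → ℂ) :
    c * loc τ u p q F = loc τ u p q fun p q => c * F p q := by
  unfold loc
  split_ifs <;> ring

lemma sum_Rcheckent (τ u : ℂ) (p q : Fin 2) (F : Fin 2 → Fin 2 → ℂ) :
    ∑ s : Fin 2, ∑ t : Fin 2, Rcheckent τ u (p, q) (s, t) * F s t = loc τ u p q F := by
  fin_cases p <;> fin_cases q <;> simp [Fin.sum_univ_two, Rcheckent, Rent, loc, flipS]
  all_goals ring

lemma chi_mul_sub (x y : ℂ) {τ : ℂ} (hτ : 0 < τ.im) :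
    chi τ 0 x * chi τ 0 y - chi τ 1 x * chi τ 1 y =
      th1 ηc τ * th2 ηc τ * (th1 (-x - y + 2 * ηc) (2 * τ) * th4 (x - y) (2 * τ)) := by
  have h := two_th1_mul_th4 (x - ηc) (y - ηc) hτ
  rw [show x - ηc + (y - ηc) = -(-x - y + 2 * ηc) by ring, th1_neg,
    show x - ηc - (y - ηc) = x - y by ring] at h
  have e : (2 * chi τ 0 x) * (2 * chi τ 0 y) - (2 * chi τ 1 x) * (2 * chi τ 1 y) =
      4 * (th1 ηc τ * th2 ηc τ * (th1 (-x - y + 2 * ηc) (2 * τ) * th4 (x - y) (2 * τ))) := by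
    rw [two_chi_zero x hτ, two_chi_zero y hτ, two_chi_one x hτ, two_chi_one y hτ]
    linear_combination 2 * th1 ηc τ * th2 ηc τ * h
  linear_combination e / 4

lemma chi_mul_sub' (x y : ℂ) {τ : ℂ} (hτ : 0 < τ.im) :
    chi τ 0 x * chi τ 1 y - chi τ 1 x * chi τ 0 y =
      th1 ηc τ * th2 ηc τ * (th1 (x - y) (2 * τ) * th4 (-x - y + 2 * ηc) (2 * τ)) := by
  have h := two_th1_mul_th4 (x - ηc) (-(y - ηc)) hτ
  rw [show x - ηc + -(y - ηc) = x - y by ring,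
    show x - ηc - -(y - ηc) = -(-x - y + 2 * ηc) by ring, th4_neg, th1_neg, th2_neg] at h
  have e : (2 * chi τ 0 x) * (2 * chi τ 1 y) - (2 * chi τ 1 x) * (2 * chi τ 0 y) =
      4 * (th1 ηc τ * th2 ηc τ * (th1 (x - y) (2 * τ) * th4 (-x - y + 2 * ηc) (2 * τ))) := by
    rw [two_chi_zero x hτ, two_chi_zero y hτ, two_chi_one x hτ, two_chi_one y hτ]
    linear_combination -2 * th1 ηc τ * th2 ηc τ * h
  linear_combination e / 4

/-- The boundary Yang–Baxter relation in components. -/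
lemma bybe_local {τ : ℂ} (hτ : 0 < τ.im) (x y : ℂ) {P A₁ A B₁ B : Fin 2 → Fin 2 → Fin 2 → Fin 2 → ℂ}
    (hA₁ : ∀ p q s t, rv τ (x - y) * A₁ p q s t = loc τ (x - y) p q fun p q => P p q s t)
    (hA : ∀ p q s t, rv τ (-x - y) * A p q s t = loc τ (-x - y) q s fun q s => A₁ p q s t)
    (hB₁ : ∀ p q s t, rv τ (x - y) * B₁ p q s t = loc τ (x - y) s t fun s t => P p q s t)
    (hB : ∀ p q s t, rv τ (-x - y) * B p q s t = loc τ (-x - y) q s fun q s => B₁ p q s t)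
    (hu : rv τ (x - y) ≠ 0) (hv : rv τ (-x - y) ≠ 0) :
    ∑ s, ∑ t, chi τ s x * chi τ t y * A s (flipS s) t (flipS t) =
      ∑ s, ∑ t, chi τ s y * chi τ t x * B s (flipS s) t (flipS t) := by
  have i1 : cv τ (x - y) * av τ (-x - y) * (chi τ 0 x * chi τ 1 y - chi τ 1 x * chi τ 0 y) =
      bv τ (x - y) * cv τ (-x - y) * (chi τ 0 x * chi τ 0 y - chi τ 1 x * chi τ 1 y) := by
    rw [chi_mul_sub x y hτ, chi_mul_sub' x y hτ, av, bv, cv, cv]; ring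
  have i2 : av τ (x - y) * dv τ (-x - y) * (chi τ 0 x * chi τ 1 y - chi τ 1 x * chi τ 0 y) =
      dv τ (x - y) * bv τ (-x - y) * (chi τ 0 x * chi τ 0 y - chi τ 1 x * chi τ 1 y) := by
    rw [chi_mul_sub x y hτ, chi_mul_sub' x y hτ, av, bv, dv, dv]; ring
  have hA' : ∀ p q s t, rv τ (x - y) * rv τ (-x - y) * A p q s t =
      loc τ (-x - y) q s fun q s => loc τ (x - y) p q fun p q => P p q s t := by
    intro p q s t
    rw [mul_assoc, hA, loc_mul]
    simp only [hA₁]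
  have hB' : ∀ p q s t, rv τ (x - y) * rv τ (-x - y) * B p q s t =
      loc τ (-x - y) q s fun q s => loc τ (x - y) s t fun s t => P p q s t := by
    intro p q s t
    rw [mul_assoc, hB, loc_mul]
    simp only [hB₁]
  refine mul_left_cancel₀ (mul_ne_zero hu hv) ?_
  rw [Finset.mul_sum, Finset.mul_sum]
  simp only [Finset.mul_sum, mul_left_comm _ (chi τ _ _ * chi τ _ _), hA', hB']
  simp only [Fin.sum_univ_two, loc, flipS]
  simp
  linear_combination (P 0 1 1 0 - P 1 0 0 1) * i1 + (P 0 0 0 0 - P 1 1 1 1) * i2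

/-- Entire functions with period `π` and a multiplier `C exp(-2iNz)` along `πτ`. -/
def quasiPer (τ C : ℂ) (N : ℕ) : Submodule ℂ (ℂ → ℂ) where
  carrier := {f | Differentiable ℂ f ∧ (∀ z, f (z + Real.pi) = f z) ∧
    ∀ z, f (z + Real.pi * τ) = C * Complex.exp (-(2 * N * Complex.I * z)) * f z}
  add_mem' := by
    rintro f g ⟨a, b, c⟩ ⟨a', b', c'⟩
    refine ⟨a.add a', fun z => ?_, fun z => ?_⟩
    · simp [b, b']
    · simp only [Pi.add_apply, c, c']; ring
  zero_mem' := by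
    refine ⟨differentiable_const 0, ?_, ?_⟩ <;> simp
  smul_mem' := by
    rintro r f ⟨a, b, c⟩
    refine ⟨a.const_smul r, fun z => ?_, fun z => ?_⟩
    · simp [b]
    · simp only [Pi.smul_apply, smul_eq_mul, c]; ring

lemma quasiPer_fourierInt {τ C : ℂ} {N : ℕ} {f : ℂ → ℂ} (hf : f ∈ quasiPer τ C N) (n : ℤ) :
    fourierInt f n = C * Complex.exp (-(2 * n * Complex.I * (Real.pi * τ))) * fourierInt f (n + N) := by
  obtain ⟨a, b, c⟩ := hf
  have h := integral_period_shift (F := fun z => f z * Complex.exp (-(2 * n * Complex.I * z)))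
    (a.mul (by fun_prop)) (fun z => by
      have := Complex.exp_int_mul_two_pi_mul_I (-n)
      rw [b, show -(2 * (n : ℂ) * Complex.I * (z + Real.pi)) =
        -(2 * n * Complex.I * z) + ((-n : ℤ) : ℂ) * (2 * Real.pi * Complex.I) by push_cast; ring,
        Complex.exp_add, this, mul_one]) (Real.pi * τ)
  unfold fourierInt
  rw [← h, ← intervalIntegral.integral_const_mul]
  congr 1
  funext x
  have e : Complex.exp (-(2 * N * Complex.I * x)) * Complex.exp (-(2 * n * Complex.I * (x + Real.pi * τ))) =
      Complex.exp (-(2 * n * Complex.I * (Real.pi * τ))) *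
        Complex.exp (-(2 * ((n + N : ℤ) : ℂ) * Complex.I * x)) := by
    rw [← Complex.exp_add, ← Complex.exp_add]
    congr 1
    push_cast
    ring
  rw [c]
  linear_combination C * f x * e

lemma quasiPer_eq_zero {τ C : ℂ} (hC : C ≠ 0) {N : ℕ} (hN : 0 < N) {f : ℂ → ℂ}
    (hf : f ∈ quasiPer τ C N) (h : ∀ n : ℕ, n < N → fourierInt f n = 0) : f = 0 := by
  have step : ∀ n : ℤ, fourierInt f n = 0 ↔ fourierInt f (n + N) = 0 := fun n => by
    rw [quasiPer_fourierInt hf n]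
    simp [hC, Complex.exp_ne_zero]
  have key : ∀ q r : ℤ, fourierInt f (r + N * q) = 0 ↔ fourierInt f r = 0 := by
    intro q r
    induction q using Int.induction_on with
    | zero => simp
    | succ q ih => rw [← ih, step (r + N * q)]; congr! 2; ring
    | pred q ih => rw [← ih, step (r + N * (-q - 1))]; congr! 2; ring
  refine eq_zero_of_fourierInt hf.1 hf.2.1 fun n => ?_
  rw [← Int.emod_add_mul_ediv n N, key]
  have h0 := Int.emod_nonneg n (b := N) (by omega)
  have h1 := Int.emod_lt_of_pos n (b := N) (by omega)
  obtain ⟨m, hm⟩ := Int.eq_ofNat_of_zero_le h0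
  rw [hm]
  exact_mod_cast h m (by omega)

lemma fourierInt_smul (c : ℂ) (f : ℂ → ℂ) (n : ℤ) :
    fourierInt (c • f) n = c * fourierInt f n := by
  unfold fourierInt
  rw [← intervalIntegral.integral_const_mul]
  simp only [Pi.smul_apply, smul_eq_mul, mul_assoc]

lemma quasiPer_finite {τ C : ℂ} (hC : C ≠ 0) {N : ℕ} (hN : 0 < N) :
    FiniteDimensional ℂ (quasiPer τ C N) := by
  let L : quasiPer τ C N →ₗ[ℂ] (Fin N → ℂ) :=
    { toFun := fun f n => fourierInt f (n : ℕ)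
      map_add' := fun f g => by
        funext n
        exact fourierInt_add f.2.1.continuous g.2.1.continuous _
      map_smul' := fun c f => by
        funext n
        exact fourierInt_smul c _ _ }
  refine Module.Finite.of_injective L ?_
  rw [← LinearMap.ker_eq_bot, LinearMap.ker_eq_bot']
  intro f hf
  apply Subtype.ext
  exact quasiPer_eq_zero hC hN f.2 fun n hn => congrFun hf ⟨n, hn⟩

lemma differentiable_of_finite (d : ℕ) : ∀ (W : Submodule ℂ (ℂ → ℂ)) [FiniteDimensional ℂ W],
    Module.finrank ℂ W = d → (∀ f ∈ W, Differentiable ℂ f) → ∀ G : ℂ → ℂ → ℂ,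
    (∀ b, (fun a => G a b) ∈ W) → (∀ a, Differentiable ℂ (G a)) →
    Differentiable ℂ fun z => G z (-(2 * z)) := by
  induction d with
  | zero =>
    intro W _ hd hW G h1 h2
    rw [Submodule.finrank_eq_zero] at hd
    have : (fun z => G z (-(2 * z))) = fun _ => 0 := by
      funext z
      have := h1 (-(2 * z))
      rw [hd, Submodule.mem_bot] at this
      exact congrFun this z
    rw [this]
    exact differentiable_const 0
  | succ d ih =>
    intro W _ hd hW G h1 h2
    have hne : W ≠ ⊥ := by
      rintro rfl
      simp at hd
    obtain ⟨f₀, hf₀, hf₀'⟩ := Submodule.exists_mem_ne_zero_of_ne_bot hne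
    obtain ⟨a₀, ha₀⟩ : ∃ a, f₀ a ≠ 0 := by
      by_contra! h
      exact hf₀' (funext h)
    let W' : Submodule ℂ (ℂ → ℂ) := W ⊓ LinearMap.ker (LinearMap.proj (R := ℂ) (φ := fun _ : ℂ => ℂ) a₀)
    have hle : W' ≤ W := inf_le_left
    have : FiniteDimensional ℂ W' := Submodule.finiteDimensional_of_le hle
    let ev : W →ₗ[ℂ] ℂ := (LinearMap.proj (R := ℂ) (φ := fun _ : ℂ => ℂ) a₀).comp W.subtype
    have hsurj : Function.Surjective ev := LinearMap.surjective (fun h => ha₀ (by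
      simpa [ev] using LinearMap.congr_fun h ⟨f₀, hf₀⟩))
    have hrank := LinearMap.finrank_range_add_finrank_ker ev
    rw [LinearMap.range_eq_top.2 hsurj, finrank_top, Module.finrank_self, hd] at hrank
    have hW' : Module.finrank ℂ W' = d := by
      have e : Module.finrank ℂ W' = Module.finrank ℂ (LinearMap.ker ev) := by
        have : W' = (LinearMap.ker ev).map W.subtype := by
          ext f
          simp [W', ev, and_comm]
        rw [this]
        exact (Submodule.equivSubtypeMap W (LinearMap.ker ev)).finrank_eq.symm
      omega
    have key := ih W' hW' (fun f hf => hW f (hle hf)) (fun a b => G a b - G a₀ b / f₀ a₀ * f₀ a)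
      (fun b => by
        refine ⟨W.sub_mem (h1 b) (W.smul_mem (G a₀ b / f₀ a₀) hf₀), ?_⟩
        simp [LinearMap.mem_ker, ha₀])
      (fun a => ((h2 a).sub (((h2 a₀).div_const _).mul_const _)))
    have e : (fun z => G z (-(2 * z))) = fun z => (G z (-(2 * z)) - G a₀ (-(2 * z)) / f₀ a₀ * f₀ z) +
        G a₀ (-(2 * z)) / f₀ a₀ * f₀ z := by
      funext z; ring
    rw [e]
    refine key.add (((Differentiable.comp (h2 a₀) (f := fun z : ℂ => -(2 * z)) (by fun_prop)).div_const _).mul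
      (hW _ hf₀))

lemma differentiable_antidiag {τ C : ℂ} (hτ : 0 < τ.im) (hC : C ≠ 0) (n : ℕ) {f : ℂ → ℂ → ℂ}
    (ha : ∀ b, Differentiable ℂ fun a => f a b) (hb : ∀ a, Differentiable ℂ (f a))
    (hper : ∀ a b, f (a + 2 * Real.pi) b = f a b)
    (hq : ∀ a b, f (a + 2 * Real.pi * τ) b =
      C * Complex.exp (-(4 * n * Complex.I * a) + 2 * Complex.I * b) * f a b) :
    Differentiable ℂ fun z => f z (-z) := by
  set C' : ℂ := -C * Complex.exp (-(2 * Complex.I * (Real.pi * τ))) with hC'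
  have hC'0 : C' ≠ 0 := mul_ne_zero (neg_ne_zero.2 hC) (Complex.exp_ne_zero _)
  have hfin := quasiPer_finite (τ := τ) hC'0 (N := 4 * n + 2) (by omega)
  have hd4 := th4_differentiable (double_im_pos hτ)
  have h := differentiable_of_finite _ (quasiPer τ C' (4 * n + 2)) rfl (fun f hf => hf.1)
    (fun a b => f (2 * a) b * th4 (2 * a + b) (2 * τ)) (fun b => ⟨?_, fun a => ?_, fun a => ?_⟩) fun a => ?_
  · have h' := (h.comp (f := fun z : ℂ => z / 2) (by fun_prop)).mul_const (th4 0 (2 * τ))⁻¹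
    refine (congrArg (Differentiable ℂ) (funext fun z => ?_)).mp h'
    rw [Function.comp_apply, show 2 * (z / 2) = z by ring, add_neg_cancel, mul_assoc, mul_inv_cancel₀ (th4_zero_ne hτ), mul_one]
  · exact ((ha b).comp (f := fun a : ℂ => 2 * a) (by fun_prop)).mul
      (hd4.comp (f := fun a : ℂ => 2 * a + b) (by fun_prop))
  · dsimp only
    rw [show 2 * (a + (Real.pi : ℂ)) = 2 * a + 2 * Real.pi by ring, hper,
      show 2 * a + 2 * (Real.pi : ℂ) + b = 2 * a + b + Real.pi + Real.pi by ring, th4_add_pi, th4_add_pi]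
  · dsimp only
    rw [show 2 * (a + (Real.pi : ℂ) * τ) = 2 * a + 2 * Real.pi * τ by ring, hq,
      show 2 * a + 2 * (Real.pi : ℂ) * τ + b = 2 * a + b + Real.pi * (2 * τ) by ring, th4_add_pi_tau, hC']
    have e : Complex.exp (-(4 * n * Complex.I * (2 * a)) + 2 * Complex.I * b) *
        Complex.exp (-(Complex.I * (Real.pi * (2 * τ) + 2 * (2 * a + b)))) =
        Complex.exp (-(2 * Complex.I * (Real.pi * τ))) *
          Complex.exp (-(2 * ((4 * n + 2 : ℕ) : ℂ) * Complex.I * a)) := by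
      rw [← Complex.exp_add, ← Complex.exp_add]
      congr 1
      push_cast
      ring
    linear_combination (-C * f (2 * a) b * th4 (2 * a + b) (2 * τ)) * e
  · exact (hb _).mul (hd4.comp (f := fun b : ℂ => 2 * a + b) (by fun_prop))

/-- Sum of `F` over the spins at the first `n` sites, the remaining spins being `0`. -/
def Sg : ℕ → ((ℕ → Fin 2) → ℂ) → ℂ
  | 0, F => F fun _ => 0
  | n + 1, F => Sg n fun σ => ∑ s, F (Function.update σ n s)

lemma Sg_mul (n : ℕ) (c : ℂ) (F : (ℕ → Fin 2) → ℂ) : Sg n (fun σ => c * F σ) = c * Sg n F := by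
  induction n generalizing F with
  | zero => rfl
  | succ n ih => simp only [Sg, ← Finset.mul_sum, ih]

lemma Sg_site {n m : ℕ} (hm : m < n) {F G : (ℕ → Fin 2) → ℂ}
    (h : ∀ σ, ∑ s, F (Function.update σ m s) = ∑ s, G (Function.update σ m s)) : Sg n F = Sg n G := by
  induction n generalizing F G with
  | zero => omega
  | succ n ih =>
    simp only [Sg]
    by_cases hmn : m = n
    · subst hmn; simp only [h]
    · refine ih (by omega) fun σ => ?_
      rw [Finset.sum_comm, Finset.sum_comm (f := fun s t => G _)]
      refine Finset.sum_congr rfl fun s _ => ?_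
      simp only [Function.update_comm hmn]
      exact h _

lemma Sg_two_site {n m : ℕ} (hm : m + 1 < n) {F G : (ℕ → Fin 2) → ℂ}
    (h : ∀ σ, ∑ s, ∑ t, F (Function.update (Function.update σ m s) (m + 1) t) =
      ∑ s, ∑ t, G (Function.update (Function.update σ m s) (m + 1) t)) : Sg n F = Sg n G := by
  induction n generalizing F G with
  | zero => omega
  | succ n ih =>
    by_cases hmn : m + 1 = n
    · subst hmn; simp only [Sg, h]
    · simp only [Sg]
      refine ih (by omega) fun σ => ?_
      have key : ∀ F : (ℕ → Fin 2) → ℂ, ∑ s, ∑ t, ∑ r,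
          F (Function.update (Function.update (Function.update σ m s) (m + 1) t) n r) =
          ∑ r, ∑ s, ∑ t, F (Function.update (Function.update (Function.update σ n r) m s) (m + 1) t) := by
        intro F
        rw [Finset.sum_comm' (t' := Finset.univ) (s' := fun _ => Finset.univ) (by simp)]
        simp only [Fin.sum_univ_two, Function.update_comm (show m + 1 ≠ n by omega),
          Function.update_comm (show m ≠ n by omega)]
        ring
      rw [key, key]
      exact Finset.sum_congr rfl fun s _ => h _

lemma Sg_congr (n : ℕ) {F G : (ℕ → Fin 2) → ℂ} (h : ∀ σ, F σ = G σ) : Sg n F = Sg n G := by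
  rw [funext h]

lemma Sg_differentiable (n : ℕ) {F : ℂ → (ℕ → Fin 2) → ℂ}
    (h : ∀ σ, Differentiable ℂ fun x => F x σ) : Differentiable ℂ fun x => Sg n (F x) := by
  induction n generalizing F with
  | zero => exact h _
  | succ n ih => exact ih fun σ => Differentiable.fun_sum fun s _ => h _

lemma Sg_eq_single {n : ℕ} {F : (ℕ → Fin 2) → ℂ}
    (h : ∀ σ m, m < n → σ m ≠ 0 → F σ = 0) : Sg n F = F fun _ => 0 := by
  induction n generalizing F with
  | zero => rfl
  | succ n ih =>
    have e : ∀ σ, ∑ s, F (Function.update σ n s) = F (Function.update σ n 0) := fun σ => by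
      rw [Fin.sum_univ_two, h (Function.update σ n 1) n (by omega) (by simp), add_zero]
    simp only [Sg, e]
    rw [ih fun σ m hm hσ => h _ m (by omega) (by rwa [Function.update_of_ne (by omega)])]
    congr 1
    exact Function.update_eq_self n _

/-- Prepend an entry to a sequence. -/
def ncons {X : Type*} (a : X) (u : ℕ → X) : ℕ → X
  | 0 => a
  | j + 1 => u j

lemma ncons_update {X : Type*} (a : X) (u : ℕ → X) (m : ℕ) (b : X) :
    ncons a (Function.update u m b) = Function.update (ncons a u) (m + 1) b := by
  funext j
  cases j with
  | zero => simp [ncons, Function.update]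
  | succ j => simp [ncons, Function.update]

lemma Sg_succ' (n : ℕ) (F : (ℕ → Fin 2) → ℂ) : Sg (n + 1) F = ∑ s, Sg n fun σ => F (ncons s σ) := by
  induction n generalizing F with
  | zero =>
    simp only [Sg]
    refine Finset.sum_congr rfl fun s _ => congrArg F ?_
    funext j
    cases j <;> simp [ncons]
  | succ n ih =>
    rw [Sg, ih]
    simp only [Sg, ncons_update]

/-- `Ψ_n` as a function of sequences, of which only the first `2n+1` entries matter. -/
def PsiN (Ψ : PsiFam) (n : ℕ) (u : ℕ → ℂ) (α : ℕ → Fin 2) : ℂ := Ψ n (fun j => u j) (fun j => α j)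

lemma PsiN_congr (Ψ : PsiFam) (n : ℕ) {u v : ℕ → ℂ} {α β : ℕ → Fin 2}
    (hu : ∀ j < 2 * n + 1, u j = v j) (hα : ∀ j < 2 * n + 1, α j = β j) :
    PsiN Ψ n u α = PsiN Ψ n v β := by
  unfold PsiN
  congr 1
  · funext j; exact hu j j.2
  · funext j; exact hα j j.2

lemma update_fin {X : Type*} {L : ℕ} (u : ℕ → X) (i : ℕ) (hi : i < L) (b : X) :
    (fun j : Fin L => Function.update u i b j) = Function.update (fun j : Fin L => u j) ⟨i, hi⟩ b := by
  funext j
  by_cases h : (j : ℕ) = i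
  · have : j = ⟨i, hi⟩ := Fin.ext h
    subst this; simp
  · rw [Function.update_of_ne h, Function.update_of_ne (fun h' => h (by rw [h']))]

lemma PsiN_exchange {τ : ℂ} {Ψ : PsiFam} (h1 : PsiP1 τ Ψ) {n i : ℕ} (hi : i + 1 < 2 * n + 1)
    (u : ℕ → ℂ) (α : ℕ → Fin 2) :
    rv τ (u (i + 1) - u i) * PsiN Ψ n (fun l => u (Equiv.swap i (i + 1) l)) α =
      loc τ (u (i + 1) - u i) (α i) (α (i + 1)) fun s t =>
        PsiN Ψ n u (Function.update (Function.update α i s) (i + 1) t) := by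
  have h := congrFun (h1 n (fun j => u j) ⟨i, by omega⟩ ⟨i + 1, hi⟩ rfl) fun j => α j
  rw [applyRc, sum_Rcheckent τ (u (i + 1) - u i) (α i) (α (i + 1)) fun s t => Ψ n (fun j => u j)
    (Function.update (Function.update (fun j => α j) ⟨i, by omega⟩ s) ⟨i + 1, hi⟩ t)] at h
  simp only [← update_fin] at h
  rw [show (fun s t => PsiN Ψ n u (Function.update (Function.update α i s) (i + 1) t)) = fun s t =>
    Ψ n (fun j => u j) fun j => Function.update (Function.update α i s) (i + 1) t j from rfl, h]
  simp only [PsiN]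
  congr 2
  funext l
  congr 1
  simp only [Equiv.swap_apply_def, Fin.ext_iff]
  split_ifs <;> rfl

lemma PsiN_flip {τ : ℂ} {Ψ : PsiFam} (h2 : PsiP2 τ Ψ) {n i : ℕ} (hi : i < 2 * n + 1)
    (u : ℕ → ℂ) (α : ℕ → Fin 2) :
    PsiN Ψ n u (Function.update α i (flipS (α i))) = (-(pnome τ)) ^ n *
      Complex.exp (-Complex.I * ∑ j ∈ Finset.range (2 * n + 1), (u j - u i)) *
        PsiN Ψ n (Function.update u i (u i + Real.pi * τ)) α := by
  have h := h2 n (fun j => u j) ⟨i, hi⟩ fun j => α j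
  simp only [← update_fin] at h
  rw [PsiN, h, Finset.sum_range]
  rfl

/-- The sign of a spin. -/
def sgn (s : Fin 2) : ℂ := if s = 0 then 1 else -1

lemma PsiN_period {τ : ℂ} {Ψ : PsiFam} (h3 : PsiP3 τ Ψ) {n i : ℕ} (hi : i < 2 * n + 1)
    (u : ℕ → ℂ) (α : ℕ → Fin 2) :
    PsiN Ψ n (Function.update u i (u i + Real.pi)) α = 
      sgn (α i) * (∏ j ∈ Finset.range (2 * n + 1), sgn (α j)) * PsiN Ψ n u α := by
  have h := congrFun (h3 n (fun j => u j) ⟨i, hi⟩).1 fun j => α j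
  simp only [← update_fin] at h
  rw [PsiN, h, Finset.prod_range, ← Finset.mul_prod_erase _ _ (Finset.mem_univ (⟨i, hi⟩ : Fin (2 * n + 1))),
    ← mul_assoc]
  have e : sgn (α i) * sgn (α i) = 1 := by unfold sgn; split_ifs <;> ring
  rw [e, one_mul]
  rfl

lemma PsiN_quasi {τ : ℂ} {Ψ : PsiFam} (h3 : PsiP3 τ Ψ) {n i : ℕ} (hi : i < 2 * n + 1)
    (u : ℕ → ℂ) (α : ℕ → Fin 2) :
    PsiN Ψ n (Function.update u i (u i + 2 * Real.pi * τ)) α = (pnome τ ^ (4 * n))⁻¹ *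
      Complex.exp (-2 * Complex.I * ∑ j ∈ Finset.range (2 * n + 1), (u i - u j)) * PsiN Ψ n u α := by
  have h := congrFun (h3 n (fun j => u j) ⟨i, hi⟩).2 fun j => α j
  simp only [← update_fin] at h
  rw [PsiN, h, Finset.sum_range]
  rfl

lemma PsiN_differentiable {Ψ : PsiFam} (hent : PsiEntire Ψ) {n i : ℕ} (hi : i < 2 * n + 1)
    (u : ℕ → ℂ) (α : ℕ → Fin 2) : Differentiable ℂ fun z => PsiN Ψ n (Function.update u i z) α := by
  have h := hent n (fun j => u j) ⟨i, hi⟩ fun j => α j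
  simp only [← update_fin] at h
  exact h

/-- Delete the entries `i`, `i+1` of a sequence. -/
def ndel {X : Type*} (i : ℕ) (u : ℕ → X) : ℕ → X := fun j => if j < i then u j else u (j + 2)

lemma PsiN_reduce {τ : ℂ} {Ψ : PsiFam} (h5 : PsiP5 τ Ψ) {n i : ℕ} (hi : i + 1 < 2 * (n + 1) + 1)
    (u : ℕ → ℂ) (hu : u (i + 1) = u i + 2 * ηc) (α : ℕ → Fin 2) :
    PsiN Ψ (n + 1) u α = (∏ j ∈ Finset.range (2 * n + 1), th1 (u i - ndel i u j - 2 * ηc) τ) *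
      singletC (α i) (α (i + 1)) * PsiN Ψ n (ndel i u) (ndel i α) := by
  have h := congrFun (h5 n (fun j => u j) i hi hu) fun j => α j
  rw [PsiN, h]
  have e : ∀ {X : Type} (v : ℕ → X), delTwo i (fun j : Fin (2 * (n + 1) + 1) => v j) =
      fun j : Fin (2 * n + 1) => ndel i v j := fun v => by
    funext j; simp [delTwo, ndel]
  rw [e, e]
  congr 2
  rw [Finset.prod_range]
  refine Finset.prod_nbij' (fun j => if h : (j : ℕ) < i then ⟨j, by omega⟩ else ⟨(j : ℕ) - 2, by omega⟩)
    (fun j => if (j : ℕ) < i then ⟨j, by omega⟩ else ⟨(j : ℕ) + 2, by omega⟩) ?_ ?_ ?_ ?_ ?_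
  · simp
  · intro j _
    simp only [Finset.mem_erase, Finset.mem_univ, and_true, ne_eq, Fin.ext_iff]
    split_ifs <;> constructor <;> dsimp only <;> omega
  · intro j hj
    simp only [Finset.mem_erase, Finset.mem_univ, and_true, ne_eq, Fin.ext_iff] at hj
    simp only [Fin.ext_iff]
    split_ifs <;> simp_all <;> omega
  · intro j _
    by_cases h : (j : ℕ) < i
    · simp [h]
    · simp [h, show ¬ (j : ℕ) + 2 < i by omega]
  · intro j hj
    simp only [Finset.mem_erase, Finset.mem_univ, and_true, ne_eq, Fin.ext_iff] at hj
    by_cases h : (j : ℕ) < i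
    · simp [h, ndel]
    · simp [h, ndel, show ¬ (j : ℕ) - 2 < i by omega, show (j : ℕ) - 2 + 2 = j by omega]

/-- Replace the entries `i`, `i+1` of a sequence. -/
def put2 {X : Type*} (i : ℕ) (a b : X) (u : ℕ → X) : ℕ → X := fun j =>
  if j = i then a else if j = i + 1 then b else u j

/-- Replace the entries `i`, …, `i+3` of a sequence. -/
def put4 {X : Type*} (i : ℕ) (a b c d : X) (u : ℕ → X) : ℕ → X := fun j =>
  if j = i then a else if j = i + 1 then b else if j = i + 1 + 1 then c
    else if j = i + 1 + 1 + 1 then d else u j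

/-- The sequence `(x₀, g x₀, x₁, g x₁, …, x_{n-1}, g x_{n-1}, z, z, …)`. -/
def itl {X : Type*} (g : X → X) (z : X) (n : ℕ) (x : ℕ → X) : ℕ → X := fun j =>
  if j < 2 * n then (if j % 2 = 0 then x (j / 2) else g (x (j / 2))) else z

section put
variable {X : Type*} (i : ℕ) (a b c d a' b' : X) (u : ℕ → X)

lemma put2_swap : (fun l => put2 i a b u (Equiv.swap i (i + 1) l)) = put2 i b a u := by
  funext l; simp only [put2, Equiv.swap_apply_def]; split_ifs <;> first | rfl | omega
lemma put2_update : Function.update (Function.update (put2 i a b u) i a') (i + 1) b' = put2 i a' b' u := by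
  funext l; simp only [put2, Function.update_apply]; split_ifs <;> first | rfl | omega
lemma put2_left : put2 i a b u i = a := by simp [put2]
lemma put2_right : put2 i a b u (i + 1) = b := by simp [put2]
lemma put2_update_left : Function.update (put2 i a b u) i a' = put2 i a' b u := by
  funext l; simp only [put2, Function.update_apply]; split_ifs <;> rfl
lemma put2_update_right : Function.update (put2 i a b u) (i + 1) b' = put2 i a b' u := by
  funext l; simp only [put2, Function.update_apply]; split_ifs <;> first | rfl | omega
lemma put2_put2 : put2 i a b (put2 i c d u) = put2 i a b u := by
  funext l; simp only [put2]; split_ifs <;> rfl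
lemma put4_swap01 : (fun l => put4 i a b c d u (Equiv.swap i (i + 1) l)) = put4 i b a c d u := by
  funext l; simp only [put4, Equiv.swap_apply_def]; split_ifs <;> first | rfl | omega
lemma put4_swap12 :
    (fun l => put4 i a b c d u (Equiv.swap (i + 1) (i + 1 + 1) l)) = put4 i a c b d u := by
  funext l; simp only [put4, Equiv.swap_apply_def]; split_ifs <;> first | rfl | omega
lemma put4_swap23 :
    (fun l => put4 i a b c d u (Equiv.swap (i + 1 + 1) (i + 1 + 1 + 1) l)) = put4 i a b d c u := by
  funext l; simp only [put4, Equiv.swap_apply_def]; split_ifs <;> first | rfl | omega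
lemma put4_update01 :
    Function.update (Function.update (put4 i a b c d u) i a') (i + 1) b' = put4 i a' b' c d u := by
  funext l; simp only [put4, Function.update_apply]; split_ifs <;> first | rfl | omega
lemma put4_update12 : Function.update (Function.update (put4 i a b c d u) (i + 1) a') (i + 1 + 1) b' =
    put4 i a a' b' d u := by
  funext l; simp only [put4, Function.update_apply]; split_ifs <;> first | rfl | omega
lemma put4_update23 : Function.update (Function.update (put4 i a b c d u) (i + 1 + 1) a') (i + 1 + 1 + 1) b' =
    put4 i a b a' b' u := by
  funext l; simp only [put4, Function.update_apply]; split_ifs <;> first | rfl | omega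
lemma put4_zero : put4 i a b c d u i = a := by simp [put4]
lemma put4_one : put4 i a b c d u (i + 1) = b := by simp [put4]
lemma put4_two : put4 i a b c d u (i + 1 + 1) = c := by
  simp only [put4]; split_ifs <;> first | rfl | omega
lemma put4_three : put4 i a b c d u (i + 1 + 1 + 1) = d := by
  simp only [put4]; split_ifs <;> first | rfl | omega

lemma itl_put2 {g : X → X} {z : X} {n m : ℕ} (hm : m < n) {x y : ℕ → X} (h : ∀ l, l ≠ m → y l = x l) :
    itl g z n y = put2 (2 * m) (y m) (g (y m)) (itl g z n x) := by
  funext j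
  simp only [itl, put2]
  by_cases h0 : j = 2 * m
  · subst h0
    simp [hm]
  by_cases h1 : j = 2 * m + 1
  · subst h1
    rw [if_pos (by omega), if_neg (by omega), if_neg (by omega), if_pos rfl,
      show (2 * m + 1) / 2 = m by omega]
  · rw [if_neg h0, if_neg h1, h (j / 2) (by omega)]

lemma itl_put4 {g : X → X} {z : X} {n m : ℕ} (hm : m + 1 < n) {x y : ℕ → X}
    (h : ∀ l, l ≠ m → l ≠ m + 1 → y l = x l) : itl g z n y =
      put4 (2 * m) (y m) (g (y m)) (y (m + 1)) (g (y (m + 1))) (itl g z n x) := by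
  funext j
  rw [itl_put2 (m := m) (by omega) (x := Function.update y m (x m))
    (fun l hl => by rw [Function.update_of_ne hl]),
    itl_put2 hm (x := x) (y := Function.update y m (x m)) (fun l hl => by
      by_cases h' : l = m
      · subst h'; simp
      · rw [Function.update_of_ne h']; exact h l h' hl),
    Function.update_of_ne (show m + 1 ≠ m by omega)]
  simp only [put2, put4]
  split_ifs <;> first | rfl | omega
end put

lemma sum_put2 {i N : ℕ} (hi : i + 1 < N) (a b : ℂ) (u : ℕ → ℂ) :
    ∑ j ∈ Finset.range N, put2 i a b u j =
      (∑ j ∈ ((Finset.range N).erase i).erase (i + 1), u j) + (a + b) := by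
  rw [← Finset.add_sum_erase _ _ (Finset.mem_range.2 (show i < N by omega)),
    ← Finset.add_sum_erase ((Finset.range N).erase i) _ (a := i + 1)
      (Finset.mem_erase.2 ⟨by omega, Finset.mem_range.2 hi⟩), put2_left, put2_right]
  rw [Finset.sum_congr rfl (g := u) fun j hj => ?_]
  · ring
  · simp only [Finset.mem_erase] at hj
    simp [put2, hj]

lemma PsiN_exchange2 {τ : ℂ} {Ψ : PsiFam} (h1 : PsiP1 τ Ψ) {n i : ℕ} (hi : i + 1 < 2 * n + 1)
    (a b : ℂ) (p q : Fin 2) (u : ℕ → ℂ) (α : ℕ → Fin 2) :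
    rv τ (b - a) * PsiN Ψ n (put2 i b a u) (put2 i p q α) =
      loc τ (b - a) p q fun p q => PsiN Ψ n (put2 i a b u) (put2 i p q α) := by
  have h := PsiN_exchange h1 hi (put2 i a b u) (put2 i p q α)
  simpa only [put2_swap, put2_update, put2_left, put2_right] using h

lemma PsiN_differentiable_antidiag {τ : ℂ} (hτ : 0 < τ.im) {Ψ : PsiFam} (hent : PsiEntire Ψ)
    (h3 : PsiP3 τ Ψ) {n i : ℕ} (hi : i + 1 < 2 * n + 1) (u : ℕ → ℂ) (α : ℕ → Fin 2) :
    Differentiable ℂ fun z => PsiN Ψ n (put2 i z (-z) u) α := by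
  set S : ℂ := ∑ j ∈ ((Finset.range (2 * n + 1)).erase i).erase (i + 1), u j with hS
  have hC : (pnome τ ^ (4 * n))⁻¹ * Complex.exp (2 * Complex.I * S) ≠ 0 :=
    mul_ne_zero (inv_ne_zero (pow_ne_zero _ (Complex.exp_ne_zero _))) (Complex.exp_ne_zero _)
  refine differentiable_antidiag hτ hC n (f := fun a b => PsiN Ψ n (put2 i a b u) α)
    (fun b => ?_) (fun a => ?_) (fun a b => ?_) fun a b => ?_
  · have h := PsiN_differentiable hent (n := n) (i := i) (by omega) (put2 i 0 b u) α
    simpa only [put2_update_left] using h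
  · have h := PsiN_differentiable hent (n := n) (i := i + 1) (by omega) (put2 i a 0 u) α
    simpa only [put2_update_right] using h
  · have h : ∀ a, PsiN Ψ n (put2 i (a + Real.pi) b u) α = 
        sgn (α i) * (∏ j ∈ Finset.range (2 * n + 1), sgn (α j)) * PsiN Ψ n (put2 i a b u) α := fun a => by
      have h := PsiN_period h3 (n := n) (i := i) (by omega) (put2 i a b u) α
      simpa only [put2_update_left, put2_left] using h
    have hs : ∀ s, sgn s * sgn s = 1 := fun s => by unfold sgn; split_ifs <;> ring
    have hp : (∏ j ∈ Finset.range (2 * n + 1), sgn (α j)) * (∏ j ∈ Finset.range (2 * n + 1), sgn (α j)) = 1 := by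
      rw [← Finset.prod_mul_distrib]
      exact Finset.prod_eq_one fun j _ => hs _
    rw [show a + 2 * (Real.pi : ℂ) = a + Real.pi + Real.pi by ring, h, h]
    linear_combination (PsiN Ψ n (put2 i a b u) α) * (sgn (α i) * sgn (α i) * hp + hs (α i))
  · have h := PsiN_quasi h3 (n := n) (i := i) (by omega) (put2 i a b u) α
    rw [Finset.sum_sub_distrib, sum_put2 hi, put2_update_left, put2_left] at h
    rw [h, mul_assoc _ (Complex.exp _) (Complex.exp _), ← Complex.exp_add]
    congr 3
    simp only [Finset.sum_const, Finset.card_range, nsmul_eq_mul]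
    rw [← hS]
    push_cast
    ring

/-- The scalar product of `Ψ_n(x₁,-x₁,…,x_n,-x_n,0)` with the product of the boundary vectors. -/
def Zn (τ : ℂ) (Ψ : PsiFam) (n : ℕ) (x : ℕ → ℂ) : ℂ := Sg n fun σ =>
  (∏ l ∈ Finset.range n, chi τ (σ l) (x l)) * PsiN Ψ n (itl Neg.neg 0 n x) (itl flipS 0 n σ)

lemma prod_put2 {n m : ℕ} (hm : m < n) (f : Fin 2 → ℂ → ℂ) {x y : ℕ → ℂ} (h : ∀ l, l ≠ m → y l = x l)
    (σ : ℕ → Fin 2) (s : Fin 2) : ∏ l ∈ Finset.range n, f (Function.update σ m s l) (y l) =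
      f s (y m) * ∏ l ∈ (Finset.range n).erase m, f (σ l) (x l) := by
  rw [← Finset.mul_prod_erase _ _ (Finset.mem_range.2 hm), Function.update_self]
  congr 1
  refine Finset.prod_congr rfl fun l hl => ?_
  rw [Function.update_of_ne (Finset.ne_of_mem_erase hl), h l (Finset.ne_of_mem_erase hl)]

lemma itl_flip_update {n m : ℕ} (hm : m < n) (σ : ℕ → Fin 2) (s : Fin 2) :
    itl flipS 0 n (Function.update σ m s) = put2 (2 * m) s (flipS s) (itl flipS 0 n σ) := by
  rw [itl_put2 hm (x := σ) fun l hl => Function.update_of_ne hl _ _, Function.update_self]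

lemma chi_differentiable {τ : ℂ} (hτ : 0 < τ.im) (s : Fin 2) : Differentiable ℂ (chi τ s) := by
  have h1 := th1_differentiable (double_im_pos hτ)
  have h4 := th4_differentiable (double_im_pos hτ)
  unfold chi
  split_ifs
  · exact (h1.comp (f := fun x : ℂ => x - 2 * ηc) (by fun_prop)).mul h4
  · exact h1.mul (h4.comp (f := fun x : ℂ => x - 2 * ηc) (by fun_prop))

lemma Zn_differentiable {τ : ℂ} (hτ : 0 < τ.im) {Ψ : PsiFam} (hent : PsiEntire Ψ)
    (h3 : PsiP3 τ Ψ) {n m : ℕ} (hm : m < n) (x : ℕ → ℂ) :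
    Differentiable ℂ fun z => Zn τ Ψ n (Function.update x m z) := by
  refine Sg_differentiable n fun σ => Differentiable.mul (Differentiable.fun_finsetProd fun l _ => ?_) ?_
  · by_cases h : l = m
    · subst h
      simpa using chi_differentiable hτ (σ l)
    · simp [h]
  · have h : ∀ z, itl Neg.neg 0 n (Function.update x m z) = put2 (2 * m) z (-z) (itl Neg.neg 0 n x) :=
      fun z => by rw [itl_put2 hm (x := x) fun l hl => Function.update_of_ne hl _ _, Function.update_self]
    simp only [h]
    exact PsiN_differentiable_antidiag hτ hent h3 (by omega) _ _

lemma Zn_neg {τ : ℂ} (hτ : 0 < τ.im) {Ψ : PsiFam} (h1 : PsiP1 τ Ψ) {n m : ℕ} (hm : m < n) (x : ℕ → ℂ) :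
    rv τ (-2 * x m) * Zn τ Ψ n (Function.update x m (-x m)) = rho τ (x m) * Zn τ Ψ n x := by
  unfold Zn
  rw [← Sg_mul, ← Sg_mul]
  refine Sg_site hm fun σ => ?_
  have hy : ∀ l, l ≠ m → Function.update x m (-x m) l = x l := fun l hl => Function.update_of_ne hl _ _
  simp only [prod_put2 hm (chi τ) hy, prod_put2 hm (chi τ) (x := x) (y := x) (fun _ _ => rfl),
    itl_flip_update hm]
  rw [itl_put2 hm hy, Function.update_self, neg_neg,
    itl_put2 hm (x := x) (y := x) fun _ _ => rfl, put2_put2]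
  have e := fun p q => PsiN_exchange2 h1 (n := n) (i := 2 * m) (by omega) (x m) (-x m) p q
    (itl Neg.neg 0 n x) (itl flipS 0 n σ)
  have e01 := e 0 1
  have e10 := e 1 0
  rw [show -x m - x m = -2 * x m by ring] at e01 e10
  simp only [loc] at e01 e10
  rw [if_neg (by decide)] at e01 e10
  simp only [Fin.sum_univ_two, show flipS 0 = 1 from rfl, show flipS 1 = 0 from rfl]
  have r0 := reflect_zero (x m) hτ
  have r1 := reflect_one (x m) hτ
  generalize (∏ l ∈ (Finset.range n).erase m, chi τ (σ l) (x l)) = P at *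
  linear_combination chi τ 0 (-x m) * P * e01 + chi τ 1 (-x m) * P * e10 +
    P * PsiN Ψ n (put2 (2 * m) (x m) (-x m) (itl Neg.neg 0 n x)) (put2 (2 * m) 0 1 (itl flipS 0 n σ)) * r0 +
    P * PsiN Ψ n (put2 (2 * m) (x m) (-x m) (itl Neg.neg 0 n x)) (put2 (2 * m) 1 0 (itl flipS 0 n σ)) * r1

lemma prod_put4 {n m : ℕ} (hm : m + 1 < n) (f : Fin 2 → ℂ → ℂ) {x y : ℕ → ℂ}
    (h : ∀ l, l ≠ m → l ≠ m + 1 → y l = x l) (σ : ℕ → Fin 2) (s t : Fin 2) :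
    ∏ l ∈ Finset.range n, f (Function.update (Function.update σ m s) (m + 1) t l) (y l) =
      f s (y m) * f t (y (m + 1)) *
        ∏ l ∈ ((Finset.range n).erase m).erase (m + 1), f (σ l) (x l) := by
  rw [← Finset.mul_prod_erase _ _ (Finset.mem_range.2 (show m < n by omega)),
    ← Finset.mul_prod_erase ((Finset.range n).erase m) _ (a := m + 1)
      (Finset.mem_erase.2 ⟨by omega, Finset.mem_range.2 hm⟩), Function.update_self,
    Function.update_of_ne (by omega), Function.update_self, mul_assoc]
  congr 2
  refine Finset.prod_congr rfl fun l hl => ?_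
  simp only [Finset.mem_erase] at hl
  rw [Function.update_of_ne hl.1, Function.update_of_ne hl.2.1, h l hl.2.1 hl.1]

lemma itl_flip_update2 {n m : ℕ} (hm : m + 1 < n) (σ : ℕ → Fin 2) (s t : Fin 2) :
    itl flipS 0 n (Function.update (Function.update σ m s) (m + 1) t) =
      put4 (2 * m) s (flipS s) t (flipS t) (itl flipS 0 n σ) := by
  rw [itl_put4 hm (x := σ) fun l hl hl' => by rw [Function.update_of_ne hl', Function.update_of_ne hl],
    Function.update_self, Function.update_of_ne (by omega), Function.update_self]

lemma Zn_swap {τ : ℂ} (hτ : 0 < τ.im) {Ψ : PsiFam} (h1 : PsiP1 τ Ψ) {n m : ℕ} (hm : m + 1 < n) (x : ℕ → ℂ)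
    (hu : rv τ (x m - x (m + 1)) ≠ 0) (hv : rv τ (-x m - x (m + 1)) ≠ 0) :
    Zn τ Ψ n (fun l => x (Equiv.swap m (m + 1) l)) = Zn τ Ψ n x := by
  symm
  refine Sg_two_site hm fun σ => ?_
  have hy : ∀ l, l ≠ m → l ≠ m + 1 → x (Equiv.swap m (m + 1) l) = x l := fun l hl hl' => by
    rw [Equiv.swap_apply_of_ne_of_ne hl hl']
  simp only [prod_put4 hm (chi τ) hy, prod_put4 hm (chi τ) (x := x) (y := x) (fun _ _ _ => rfl),
    itl_flip_update2 hm]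
  have hx : itl Neg.neg 0 n x = _ := itl_put4 hm (x := x) (y := x) fun _ _ _ => rfl
  have hx' := itl_put4 (g := Neg.neg) (z := (0 : ℂ)) hm hy
  rw [Equiv.swap_apply_left, Equiv.swap_apply_right] at hx'
  simp only [hx', Equiv.swap_apply_left, Equiv.swap_apply_right]
  conv_lhs => enter [2, s, 2, t, 2]; rw [hx]
  generalize itl Neg.neg 0 n x = u
  generalize itl flipS 0 n σ = α
  have ex := fun (i : ℕ) (hi : i + 1 < 2 * n + 1) (u : ℕ → ℂ) (α : ℕ → Fin 2) => PsiN_exchange h1 hi u α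
  have e01 := fun a b c d p q s t => ex (2 * m) (by omega) (put4 (2 * m) a b c d u) (put4 (2 * m) p q s t α)
  have e12 := fun a b c d p q s t => ex (2 * m + 1) (by omega) (put4 (2 * m) a b c d u) (put4 (2 * m) p q s t α)
  have e23 := fun a b c d p q s t => ex (2 * m + 1 + 1) (by omega) (put4 (2 * m) a b c d u) (put4 (2 * m) p q s t α)
  simp only [put4_swap01, put4_swap12, put4_swap23, put4_update01, put4_update12, put4_update23,
    put4_zero, put4_one, put4_two, put4_three] at e01 e12 e23
  have key := bybe_local hτ (x m) (x (m + 1))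
    (P := fun p q s t => PsiN Ψ n (put4 (2 * m) (x (m + 1)) (x m) (-x m) (-x (m + 1)) u) (put4 (2 * m) p q s t α))
    (A₁ := fun p q s t => PsiN Ψ n (put4 (2 * m) (x m) (x (m + 1)) (-x m) (-x (m + 1)) u) (put4 (2 * m) p q s t α))
    (A := fun p q s t => PsiN Ψ n (put4 (2 * m) (x m) (-x m) (x (m + 1)) (-x (m + 1)) u) (put4 (2 * m) p q s t α))
    (B₁ := fun p q s t => PsiN Ψ n (put4 (2 * m) (x (m + 1)) (x m) (-x (m + 1)) (-x m) u) (put4 (2 * m) p q s t α))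
    (B := fun p q s t => PsiN Ψ n (put4 (2 * m) (x (m + 1)) (-x (m + 1)) (x m) (-x m) u) (put4 (2 * m) p q s t α))
    (fun p q s t => e01 _ _ _ _ _ _ _ _) (fun p q s t => e12 _ _ _ _ _ _ _ _)
    (fun p q s t => by
      have := e23 (x (m + 1)) (x m) (-x m) (-x (m + 1)) p q s t
      rwa [show -x (m + 1) - -x m = x m - x (m + 1) by ring] at this)
    (fun p q s t => by
      have := e12 (x (m + 1)) (x m) (-x (m + 1)) (-x m) p q s t
      rwa [show -x (m + 1) - x m = -x m - x (m + 1) by ring] at this) hu hv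
  have key' := congrArg (fun c => c * ∏ l ∈ ((Finset.range n).erase m).erase (m + 1), chi τ (σ l) (x l)) key
  simp only [Finset.sum_mul] at key'
  simp only [mul_right_comm _ (∏ l ∈ ((Finset.range n).erase m).erase (m + 1), chi τ (σ l) (x l))]
  exact key'

lemma PsiN_pair_period {τ : ℂ} {Ψ : PsiFam} (h3 : PsiP3 τ Ψ) {n i : ℕ} (hi : i + 1 < 2 * n + 1)
    (a : ℂ) (u : ℕ → ℂ) (s : Fin 2) (α : ℕ → Fin 2) :
    PsiN Ψ n (put2 i (a + Real.pi) (-(a + Real.pi)) u) (put2 i s (flipS s) α) =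
      -PsiN Ψ n (put2 i a (-a) u) (put2 i s (flipS s) α) := by
  have e1 := PsiN_period h3 (n := n) (i := i) (by omega) (put2 i a (-(a + Real.pi)) u) (put2 i s (flipS s) α)
  have e2 := PsiN_period h3 (n := n) (i := i + 1) (by omega) (put2 i a (-(a + Real.pi)) u)
    (put2 i s (flipS s) α)
  rw [put2_update_left, put2_left, put2_left] at e1
  rw [put2_update_right, put2_right, put2_right, show -(a + (Real.pi : ℂ)) + Real.pi = -a by ring] at e2
  have hs : sgn (flipS s) = -sgn s := by fin_cases s <;> simp [sgn, flipS]
  rw [e1, e2, hs]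
  ring

lemma PsiN_pair_flip {τ : ℂ} {Ψ : PsiFam} (h2 : PsiP2 τ Ψ) {n i : ℕ} (hi : i + 1 < 2 * n + 1)
    (a : ℂ) (u : ℕ → ℂ) (hS : ∑ j ∈ ((Finset.range (2 * n + 1)).erase i).erase (i + 1), u j = 0)
    (s : Fin 2) (α : ℕ → Fin 2) :
    PsiN Ψ n (put2 i (a + Real.pi * τ) (-(a + Real.pi * τ)) u) (put2 i s (flipS s) α) =
      Complex.exp (-(Complex.I * ((2 * n + 1) * (2 * a + Real.pi * τ)))) *
        PsiN Ψ n (put2 i a (-a) u) (put2 i (flipS s) s α) := by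
  have e1 := PsiN_flip h2 (n := n) (i := i) (by omega) (put2 i a (-(a + Real.pi * τ)) u)
    (put2 i s (flipS s) α)
  have e2 := PsiN_flip h2 (n := n) (i := i + 1) (by omega) (put2 i a (-(a + Real.pi * τ)) u)
    (put2 i (flipS s) s α)
  rw [put2_update_left, put2_update_left, put2_left, put2_left, Finset.sum_sub_distrib, sum_put2 hi, hS] at e1
  rw [put2_update_right, put2_update_right, put2_right, put2_right, Finset.sum_sub_distrib, sum_put2 hi, hS,
    show -(a + (Real.pi : ℂ) * τ) + Real.pi * τ = -a by ring] at e2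
  rw [e1] at e2
  simp only [Finset.sum_const, Finset.card_range, nsmul_eq_mul] at e2
  have hp : (-pnome τ) ^ n ≠ 0 := pow_ne_zero _ (neg_ne_zero.2 (Complex.exp_ne_zero _))
  rw [mul_assoc, mul_assoc] at e2
  have e3 := mul_left_cancel₀ hp e2
  refine mul_left_cancel₀ (Complex.exp_ne_zero
    (-I * (0 + (a + -(a + Real.pi * τ)) - ((2 * n + 1 : ℕ) : ℂ) * a))) (e3.trans ?_)
  rw [← mul_assoc, ← Complex.exp_add]
  congr 2
  push_cast
  ring

lemma sum_itl_neg (n : ℕ) (x : ℕ → ℂ) : ∑ j ∈ Finset.range (2 * n + 1), itl Neg.neg 0 n x j = 0 := by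
  have h : ∀ k ≤ n, ∑ j ∈ Finset.range (2 * k), itl Neg.neg 0 n x j = 0 := by
    intro k
    induction k with
    | zero => simp
    | succ k ih =>
      intro hk
      rw [show 2 * (k + 1) = 2 * k + 1 + 1 by ring, Finset.sum_range_succ, Finset.sum_range_succ, ih (by omega)]
      simp only [itl]
      rw [if_pos (by omega), if_pos (by omega), if_pos (by omega), if_neg (by omega),
        show 2 * k / 2 = k by omega, show (2 * k + 1) / 2 = k by omega]
      ring
  rw [Finset.sum_range_succ, h n le_rfl]
  simp [itl]

lemma sum_itl_neg_erase {n m : ℕ} (hm : m < n) (x : ℕ → ℂ) :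
    ∑ j ∈ ((Finset.range (2 * n + 1)).erase (2 * m)).erase (2 * m + 1), itl Neg.neg 0 n x j = 0 := by
  have h := sum_put2 (i := 2 * m) (N := 2 * n + 1) (by omega) (x m) (-x m) (itl Neg.neg 0 n x)
  rw [← itl_put2 hm (g := Neg.neg) (z := (0 : ℂ)) (x := x) (y := x) fun _ _ => rfl, sum_itl_neg] at h
  linear_combination -h

lemma chi_add_pi (τ x : ℂ) (s : Fin 2) : chi τ s (x + Real.pi) = -chi τ s x := by
  unfold chi
  rw [show x + (Real.pi : ℂ) - 2 * ηc = x - 2 * ηc + Real.pi by ring]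
  simp only [th1_add_pi, th4_add_pi]
  split_ifs <;> ring

lemma chi_add_pi_tau (τ x : ℂ) (s : Fin 2) : chi τ s (x + Real.pi * τ) =
    -Complex.exp (-(Complex.I * (Real.pi * τ + 2 * x - 2 * ηc))) * chi τ (flipS s) x := by
  have e : Complex.exp (-(I * (Real.pi * τ / 2 + x))) * Complex.exp (-(I * (Real.pi * τ / 2 + (x - 2 * ηc)))) =
      Complex.exp (-(Complex.I * (Real.pi * τ + 2 * x - 2 * ηc))) := by
    rw [← Complex.exp_add]; congr 1; ring
  rw [← e]
  unfold chi
  rw [show x + (Real.pi : ℂ) * τ - 2 * ηc = x - 2 * ηc + Real.pi * τ by ring]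
  simp only [th1_add_pi_tau_double, th4_add_pi_tau_double]
  fin_cases s
  · simp [flipS]
    linear_combination (cexp (-(I * (↑Real.pi * τ / 2 + (x - 2 * ηc)))) * th4 (x - 2 * ηc) (2 * τ) * 
      (cexp (-(I * (↑Real.pi * τ / 2 + x))) * th1 x (2 * τ))) * I_sq
  · simp [flipS]
    linear_combination (cexp (-(I * (↑Real.pi * τ / 2 + (x - 2 * ηc)))) * th1 (x - 2 * ηc) (2 * τ) * 
      (cexp (-(I * (↑Real.pi * τ / 2 + x))) * th4 x (2 * τ))) * I_sq

lemma Zn_add_pi {τ : ℂ} {Ψ : PsiFam} (h3 : PsiP3 τ Ψ) {n m : ℕ} (hm : m < n) (x : ℕ → ℂ) :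
    Zn τ Ψ n (Function.update x m (x m + Real.pi)) = Zn τ Ψ n x := by
  refine Sg_site hm fun σ => ?_
  have hy : ∀ l, l ≠ m → Function.update x m (x m + Real.pi) l = x l := fun l hl => Function.update_of_ne hl _ _
  simp only [prod_put2 hm (chi τ) hy, prod_put2 hm (chi τ) (x := x) (y := x) (fun _ _ => rfl),
    itl_flip_update hm]
  rw [itl_put2 hm hy, Function.update_self, itl_put2 hm (x := x) (y := x) fun _ _ => rfl, put2_put2]
  refine Finset.sum_congr rfl fun s _ => ?_
  rw [PsiN_pair_period h3 (by omega), chi_add_pi]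
  ring

lemma Zn_add_pi_tau {τ : ℂ} {Ψ : PsiFam} (h2 : PsiP2 τ Ψ) {n m : ℕ} (hm : m < n) (x : ℕ → ℂ) :
    Zn τ Ψ n (Function.update x m (x m + Real.pi * τ)) =
      -Complex.exp (-(Complex.I * ((2 * n + 1) * (2 * x m + Real.pi * τ) + (Real.pi * τ + 2 * x m - 2 * ηc)))) *
        Zn τ Ψ n x := by
  unfold Zn
  rw [← Sg_mul]
  refine Sg_site hm fun σ => ?_
  have hy : ∀ l, l ≠ m → Function.update x m (x m + Real.pi * τ) l = x l :=
    fun l hl => Function.update_of_ne hl _ _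
  simp only [prod_put2 hm (chi τ) hy, prod_put2 hm (chi τ) (x := x) (y := x) (fun _ _ => rfl),
    itl_flip_update hm]
  have hx : itl Neg.neg 0 n x = _ := itl_put2 hm (x := x) (y := x) fun _ _ => rfl
  rw [itl_put2 hm hy, Function.update_self]
  have e : Complex.exp (-(Complex.I * ((2 * n + 1) * (2 * x m + Real.pi * τ)))) *
      Complex.exp (-(Complex.I * (Real.pi * τ + 2 * x m - 2 * ηc))) = 
      Complex.exp (-(Complex.I * ((2 * n + 1) * (2 * x m + Real.pi * τ) + (Real.pi * τ + 2 * x m - 2 * ηc)))) := by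
    rw [← Complex.exp_add]; congr 1; ring
  simp only [PsiN_pair_flip h2 (n := n) (i := 2 * m) (by omega) (x m) (itl Neg.neg 0 n x)
    (sum_itl_neg_erase hm x), chi_add_pi_tau]
  rw [hx, put2_put2, ← hx, ← e]
  simp only [Fin.sum_univ_two, show flipS 0 = 1 from rfl, show flipS 1 = 0 from rfl]
  ring

/-- The factor `ϑ₄(2x+2η|2τ)`. -/
def Gf (τ x : ℂ) : ℂ := th4 (2 * x + 2 * ηc) (2 * τ)

lemma Gf_differentiable {τ : ℂ} (hτ : 0 < τ.im) : Differentiable ℂ (Gf τ) :=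
  (th4_differentiable (double_im_pos hτ)).comp (f := fun x : ℂ => 2 * x + 2 * ηc) (by fun_prop)

lemma Gf_add_pi (τ x : ℂ) : Gf τ (x + Real.pi) = Gf τ x := by
  rw [Gf, show 2 * (x + (Real.pi : ℂ)) + 2 * ηc = 2 * x + 2 * ηc + Real.pi + Real.pi by ring, th4_add_pi,
    th4_add_pi, Gf]

lemma Gf_sub_pi (τ x : ℂ) : Gf τ (x - Real.pi) = Gf τ x := by
  rw [← Gf_add_pi, sub_add_cancel]

lemma Gf_add_pi_tau (τ x : ℂ) : Gf τ (x + Real.pi * τ) =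
    -Complex.exp (-(I * (2 * Real.pi * τ + 4 * x + 4 * ηc))) * Gf τ x := by
  rw [Gf, show 2 * (x + (Real.pi : ℂ) * τ) + 2 * ηc = 2 * x + 2 * ηc + Real.pi * (2 * τ) by ring, th4_add_pi_tau, Gf]
  congr 3
  ring

lemma Gf_sub_pi_tau (τ x : ℂ) : Gf τ (x - Real.pi * τ) =
    -Complex.exp (-(I * (2 * Real.pi * τ - 4 * x - 4 * ηc))) * Gf τ x := by
  have h := Gf_add_pi_tau τ (x - Real.pi * τ)
  rw [sub_add_cancel] at h
  rw [h, ← mul_assoc, neg_mul_neg, ← Complex.exp_add]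
  rw [show -(I * (2 * ↑Real.pi * τ - 4 * x - 4 * ηc)) + -(I * (2 * ↑Real.pi * τ + 4 * (x - ↑Real.pi * τ) + 4 * ηc)) = 0 by
    ring, Complex.exp_zero, one_mul]

lemma exp_six_eta : Complex.exp (I * (6 * ηc)) = 1 := by
  rw [show I * (6 * ηc) = 2 * Real.pi * I by unfold ηc; ring, Complex.exp_two_pi_mul_I]

lemma rv_neg_two (x : ℂ) {τ : ℂ} (hτ : 0 < τ.im) :
    rv τ (-2 * x) = th4 0 (2 * τ) * th1 (2 * x + 2 * ηc) (2 * τ) * Gf τ x := by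
  have h0 := th1_mul_th2_zero (2 * x + 2 * ηc) hτ
  have hk := kap_mul_th2_eta hτ
  have h4 := th4_zero_ne hτ
  rw [rv_eq _ hτ, th4_two_eta, Gf, show -2 * x + ηc = -(2 * x - ηc) by ring, th1_neg]
  have e' := th1_add_two_eta (2 * x) τ
  have hd : kap τ * th4 0 (2 * τ) = th4 ηc (2 * τ) := by rw [kap]; field_simp
  rw [← hd]
  linear_combination (-kap τ * th4 0 (2 * τ) * th2 ηc τ) * e' + th4 0 (2 * τ) * th1 (2 * x + 2 * ηc) τ * hk +
    th4 0 (2 * τ) / 2 * h0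

lemma rho_eq (x : ℂ) {τ : ℂ} (hτ : 0 < τ.im) :
    rho τ x = th4 0 (2 * τ) * th1 (2 * x + 2 * ηc) (2 * τ) * Gf τ (-x) := by
  rw [rho, th1_mul_th2_self _ hτ, Gf, show 2 * (x + ηc) = 2 * x + 2 * ηc by ring,
    show 2 * -x + 2 * ηc = 2 * ηc - 2 * x by ring]
  ring

lemma Zn_neg_mul {τ : ℂ} (hτ : 0 < τ.im) {Ψ : PsiFam} (hent : PsiEntire Ψ) (h1 : PsiP1 τ Ψ) (h3 : PsiP3 τ Ψ)
    {n m : ℕ} (hm : m < n) (x : ℕ → ℂ) :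
    Zn τ Ψ n (Function.update x m (-x m)) * Gf τ (x m) = Zn τ Ψ n x * Gf τ (-x m) := by
  have hd := Zn_differentiable hτ hent h3 hm x
  have hG := Gf_differentiable hτ
  have hdiff : Differentiable ℂ fun z => Zn τ Ψ n (Function.update x m (-z)) * Gf τ z -
      Zn τ Ψ n (Function.update x m z) * Gf τ (-z) :=
    ((hd.comp (f := fun z : ℂ => -z) (by fun_prop)).mul hG).sub
      (hd.mul (hG.comp (f := fun z : ℂ => -z) (by fun_prop)))
  have ht := (th1_differentiable (double_im_pos hτ)).comp (f := fun z : ℂ => 2 * z + 2 * ηc) (by fun_prop)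
  have key : ∀ z, th1 (2 * z + 2 * ηc) (2 * τ) * (Zn τ Ψ n (Function.update x m (-z)) * Gf τ z -
      Zn τ Ψ n (Function.update x m z) * Gf τ (-z)) = 0 := fun z => by
    have h := Zn_neg hτ h1 hm (Function.update x m z)
    rw [Function.update_idem, Function.update_self, rv_neg_two _ hτ, rho_eq _ hτ] at h
    refine mul_left_cancel₀ (th4_zero_ne hτ) ?_
    linear_combination h
  rcases entire_mul_eq_zero ht hdiff key with h | h
  · refine absurd (fun z => ?_) (th1_ne_zero (double_im_pos hτ))
    have := h ((z - 2 * ηc) / 2)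
    simp only [Function.comp] at this
    rwa [show 2 * ((z - 2 * ηc) / 2) + 2 * ηc = z by ring] at this
  · have := h (x m)
    rw [Function.update_eq_self] at this
    exact sub_eq_zero.1 this

lemma Zn_mem {τ : ℂ} (hτ : 0 < τ.im) {Ψ : PsiFam} (hent : PsiEntire Ψ) (h1 : PsiP1 τ Ψ) (h2 : PsiP2 τ Ψ)
    (h3 : PsiP3 τ Ψ) {n m : ℕ} (hm : m < n) (x : ℕ → ℂ) :
    (fun z => Zn τ Ψ n (Function.update x m z) * Gf τ (-z)) ∈ evenTheta τ (n + 2) := by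
  refine ⟨(Zn_differentiable hτ hent h3 hm x).mul
    ((Gf_differentiable hτ).comp (f := fun z : ℂ => -z) (by fun_prop)), fun z => ?_, fun z => ?_, fun z => ?_⟩
  · have h := Zn_add_pi h3 hm (Function.update x m z)
    rw [Function.update_idem, Function.update_self] at h
    dsimp only
    rw [h, show -(z + (Real.pi : ℂ)) = -z - Real.pi by ring, Gf_sub_pi]
  · have h := Zn_add_pi_tau h2 hm (Function.update x m z)
    rw [Function.update_idem, Function.update_self] at h
    dsimp only
    rw [h, show -(z + (Real.pi : ℂ) * τ) = -z - Real.pi * τ by ring, Gf_sub_pi_tau]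
    have e : Complex.exp (-(I * ((2 * n + 1) * (2 * z + Real.pi * τ) + (Real.pi * τ + 2 * z - 2 * ηc)))) *
        Complex.exp (-(I * (2 * Real.pi * τ - 4 * -z - 4 * ηc))) =
        Complex.exp (-(((n + 2 : ℕ) : ℂ) * (2 * I * (Real.pi * τ + 2 * z)))) := by
      refine Eq.trans ?_ (mul_one _)
      conv_rhs => rw [← exp_six_eta]
      rw [← Complex.exp_add, ← Complex.exp_add]
      congr 1
      push_cast
      ring
    rw [← e]
    ring
  · have h := Zn_neg_mul hτ hent h1 h3 hm (Function.update x m z)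
    rw [Function.update_idem, Function.update_self] at h
    dsimp only
    rw [neg_neg, h]

section itl
variable {X : Type*} (g : X → X) (z : X) (n : ℕ) (x : ℕ → X)

lemma itl_zero : itl g z (n + 1) x 0 = x 0 := by simp [itl]
lemma itl_one : itl g z (n + 1) x 1 = g (x 0) := by
  rw [itl, if_pos (by omega), if_neg (by omega)]
lemma itl_two : itl g z (n + 2) x 2 = x 1 := by
  rw [itl, if_pos (by omega), if_pos (by omega)]
lemma itl_three : itl g z (n + 2) x 3 = g (x 1) := by
  rw [itl, if_pos (by omega), if_neg (by omega)]
lemma itl_last : itl g z n x (2 * n) = z := by simp [itl]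

end itl

lemma Gf_neg_beta4 (τ : ℂ) : Gf τ (-β4c τ) = 0 := by
  rw [Gf, show 2 * -β4c τ + 2 * ηc = -(0 + Real.pi * τ) by unfold β4c; ring, th4_neg, th4_add_pi_tau_double,
    th1_zero, mul_zero]

lemma Gf_neg_beta3 (τ : ℂ) : Gf τ (-β3c τ) = 0 := by
  rw [Gf, show 2 * -β3c τ + 2 * ηc = -(0 + Real.pi * τ + Real.pi) by unfold β3c; ring, th4_neg, th4_add_pi,
    th4_add_pi_tau_double, th1_zero, mul_zero]

lemma Zn_zero {τ : ℂ} {Ψ : PsiFam} (h6 : PsiP6 Ψ) (x : ℕ → ℂ) : Zn τ Ψ 0 x = 1 := by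
  simp only [Zn, Sg, Finset.range_zero, Finset.prod_empty, one_mul]
  exact h6 _ _

lemma Sg_zero' (n : ℕ) {F : (ℕ → Fin 2) → ℂ} (h : ∀ σ, F σ = 0) : Sg n F = 0 := by
  rw [Sg_congr n (G := fun σ => 0 * F σ) fun σ => by rw [h, mul_zero], Sg_mul, zero_mul]

lemma Zn_neg_eta {τ : ℂ} {Ψ : PsiFam} (h5 : PsiP5 τ Ψ) (n : ℕ) (x : ℕ → ℂ) (hx : x 0 = -ηc) :
    Zn τ Ψ (n + 1) x = 0 := by
  refine Sg_zero' _ fun σ => ?_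
  have h0 : itl Neg.neg 0 (n + 1) x 0 = -ηc := by simp [itl, hx]
  have hr := PsiN_reduce h5 (n := n) (i := 0) (by omega) (itl Neg.neg 0 (n + 1) x)
    (by rw [itl_zero, itl_one, hx]; ring) (itl flipS 0 (n + 1) σ)
  have : ndel 0 (itl Neg.neg 0 (n + 1) x) (2 * n) = 0 := itl_last _ _ (n + 1) x
  suffices hz : ∏ j ∈ Finset.range (2 * n + 1),
      th1 (itl Neg.neg 0 (n + 1) x 0 - ndel 0 (itl Neg.neg 0 (n + 1) x) j - 2 * ηc) τ = 0 by
    rw [hr, hz, zero_mul, zero_mul, mul_zero]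
  refine Finset.prod_eq_zero (i := 2 * n) (Finset.mem_range.2 (by omega)) ?_
  rw [h0, this, show -ηc - 0 - 2 * ηc = -(0 + Real.pi) by unfold ηc; ring, th1_neg, th1_add_pi, th1_zero]
  simp

lemma prod_itl_neg (f : ℂ → ℂ) (n : ℕ) (x : ℕ → ℂ) :
    ∏ j ∈ Finset.range (2 * n + 1), f (itl Neg.neg 0 n x j) =
      f 0 * ∏ l ∈ Finset.range n, (f (x l) * f (-x l)) := by
  have h : ∀ k ≤ n, ∏ j ∈ Finset.range (2 * k), f (itl Neg.neg 0 n x j) =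
      ∏ l ∈ Finset.range k, (f (x l) * f (-x l)) := by
    intro k
    induction k with
    | zero => simp
    | succ k ih =>
      intro hk
      rw [show 2 * (k + 1) = 2 * k + 1 + 1 by ring, Finset.prod_range_succ, Finset.prod_range_succ, ih (by omega),
        Finset.prod_range_succ]
      simp only [itl]
      rw [if_pos (by omega), if_pos (by omega), if_pos (by omega), if_neg (by omega),
        show 2 * k / 2 = k by omega, show (2 * k + 1) / 2 = k by omega]
      ring
  rw [Finset.prod_range_succ, h n le_rfl, mul_comm]
  simp [itl]

lemma th1_three_eta (y τ : ℂ) : th1 (y + 3 * ηc) τ = -th1 y τ := by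
  rw [show y + 3 * ηc = y + Real.pi by unfold ηc; ring, th1_add_pi]

lemma Sg_add (n : ℕ) (F G : (ℕ → Fin 2) → ℂ) : Sg n (fun σ => F σ + G σ) = Sg n F + Sg n G := by
  induction n generalizing F G with
  | zero => rfl
  | succ n ih => simp only [Sg, Finset.sum_add_distrib, ih]

/-- The recursion satisfied by the scalar products. -/
lemma Zn_rec {τ : ℂ} (hτ : 0 < τ.im) {Ψ : PsiFam} (h1 : PsiP1 τ Ψ) (h5 : PsiP5 τ Ψ) (n : ℕ) (x : ℕ → ℂ) (y : ℂ)
    (hx0 : x 0 = y + ηc) (hx1 : x 1 = ηc - y) :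
    Zn τ Ψ (n + 2) x = (th2 0 τ / 2) ^ 2 * (th1 (y + ηc) τ * th1 (y - ηc) τ) *
      (th1 (2 * y + ηc) τ * th1 (2 * y - ηc) τ) * th1 y τ ^ 2 *
      (∏ l ∈ Finset.range n, (th1 (y + x (l + 2)) τ * th1 (y - x (l + 2)) τ) ^ 2) *
      Zn τ Ψ n (fun l => x (l + 2)) := by
  set x' : ℕ → ℂ := fun l => x (l + 2) with hx'
  set v : ℕ → ℂ := fun j => itl Neg.neg 0 n x' (j - 2) with hv
  have hu : ndel 1 (itl Neg.neg 0 (n + 2) x) = put2 0 (y + ηc) (y - ηc) v := by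
    funext j
    match j with
    | 0 => simp [ndel, itl, put2, hx0]
    | 1 => simp [ndel, put2, itl_three, hx1]
    | j + 2 =>
      have e1 : (j + 2 + 2) % 2 = j % 2 := by omega
      have e2 : (j + 2 + 2) / 2 = j / 2 + 2 := by omega
      have e3 : (j + 2 + 2 < 2 * (n + 2)) = (j < 2 * n) := by apply propext; omega
      simp [ndel, itl, put2, hv, hx', e1, e2, e3]
  have hα : ∀ (a b : Fin 2) (σ : ℕ → Fin 2), ndel 1 (itl flipS 0 (n + 2) (ncons a (ncons b σ))) =
      put2 0 a (flipS b) fun j => itl flipS 0 n σ (j - 2) := by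
    intro a b σ
    funext j
    match j with
    | 0 => simp [ndel, itl, put2, ncons]
    | 1 => simp [ndel, put2, itl_three, ncons]
    | j + 2 =>
      have e1 : (j + 2 + 2) % 2 = j % 2 := by omega
      have e2 : (j + 2 + 2) / 2 = j / 2 + 1 + 1 := by omega
      have e3 : (j + 2 + 2 < 2 * (n + 2)) = (j < 2 * n) := by apply propext; omega
      simp only [ndel, itl, put2, e1, e2, e3, ncons]
      simp
  have hd : ∀ {X : Type} (a b : X) (w : ℕ → X), ndel 0 (put2 0 a b fun j => w (j - 2)) = w := by
    intro X a b w
    funext j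
    simp [ndel, put2]
  set P0 : ℂ := ∏ j ∈ Finset.range (2 * n + 1), th1 (y - ηc - itl Neg.neg 0 n x' j - 2 * ηc) τ with hP0
  have hred0 : ∀ (p q : Fin 2) (σ : ℕ → Fin 2),
      PsiN Ψ (n + 1) (put2 0 (y - ηc) (y + ηc) v) (put2 0 p q fun j => itl flipS 0 n σ (j - 2)) =
        P0 * singletC p q * PsiN Ψ n (itl Neg.neg 0 n x') (itl flipS 0 n σ) := by
    intro p q σ
    have h := PsiN_reduce h5 (n := n) (i := 0) (by omega) (put2 0 (y - ηc) (y + ηc) v)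
      (by rw [put2_left, put2_right]; ring) (put2 0 p q fun j => itl flipS 0 n σ (j - 2))
    rw [hv, hd, hd, ← hv] at h
    simpa only [put2_left, put2_right] using h
  have hdiff : ∀ σ : ℕ → Fin 2,
      PsiN Ψ (n + 1) (put2 0 (y + ηc) (y - ηc) v) (put2 0 1 0 fun j => itl flipS 0 n σ (j - 2)) -
      PsiN Ψ (n + 1) (put2 0 (y + ηc) (y - ηc) v) (put2 0 0 1 fun j => itl flipS 0 n σ (j - 2)) =
        P0 * PsiN Ψ n (itl Neg.neg 0 n x') (itl flipS 0 n σ) := by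
    intro σ
    have h := PsiN_exchange2 h1 (n := n + 1) (i := 0) (by omega) (y + ηc) (y - ηc) 0 1 v
      fun j => itl flipS 0 n σ (j - 2)
    rw [hred0, show y - ηc - (y + ηc) = -(2 * ηc) by ring] at h
    simp only [loc] at h
    rw [if_neg (by decide), rv] at h
    have ha : av τ (-(2 * ηc)) = 0 := by rw [av, neg_add_cancel, th1_zero]; ring
    have hc : cv τ (-(2 * ηc)) = -bv τ (-(2 * ηc)) := by
      rw [cv, bv, th4_neg, th1_neg]; ring
    have hb : bv τ (-(2 * ηc)) ≠ 0 := by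
      rw [bv, neg_add_cancel, th1_neg, th4_two_eta, th1_two_eta]
      have := th14_eta_ne hτ
      exact mul_ne_zero (mul_ne_zero (by tauto) (th4_zero_ne hτ)) (neg_ne_zero.2 (by tauto))
    refine mul_left_cancel₀ hb ?_
    rw [ha, hc] at h
    simp [singletC] at h
    linear_combination -h
  set P1 : ℂ := ∏ j ∈ Finset.range (2 * (n + 1) + 1), th1 (-(y + ηc) - put2 0 (y + ηc) (y - ηc) v j - 2 * ηc) τ with hP1
  have hred1 : ∀ (a b : Fin 2) (σ : ℕ → Fin 2),
      PsiN Ψ (n + 2) (itl Neg.neg 0 (n + 2) x) (itl flipS 0 (n + 2) (ncons a (ncons b σ))) =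
        P1 * singletC (flipS a) b *
          PsiN Ψ (n + 1) (put2 0 (y + ηc) (y - ηc) v) (put2 0 a (flipS b) fun j => itl flipS 0 n σ (j - 2)) := by
    intro a b σ
    have e1 : itl Neg.neg 0 (n + 2) x 1 = -(y + ηc) := by rw [itl_one, hx0]
    have h := PsiN_reduce h5 (n := n + 1) (i := 1) (by omega) (itl Neg.neg 0 (n + 2) x)
      (by rw [e1, itl_two, hx1]; ring) (itl flipS 0 (n + 2) (ncons a (ncons b σ)))
    rw [hu, hα, e1, ← hP1] at h
    rw [h, itl_one, itl_two]
    rfl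
  have hPP : P1 * P0 = -(th1 (2 * y + ηc) τ * th1 (2 * y - ηc) τ * th1 y τ ^ 2 *
      ∏ l ∈ Finset.range n, (th1 (y + x (l + 2)) τ * th1 (y - x (l + 2)) τ) ^ 2) := by
    have t1 : th1 (-(y + ηc) - (y + ηc) - 2 * ηc) τ = th1 (2 * y + ηc) τ := by
      rw [show -(y + ηc) - (y + ηc) - 2 * ηc = -(2 * y + ηc + 3 * ηc) by ring, th1_neg, th1_three_eta, neg_neg]
    have t2 : th1 (-(y + ηc) - (y - ηc) - 2 * ηc) τ = th1 (2 * y - ηc) τ := by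
      rw [show -(y + ηc) - (y - ηc) - 2 * ηc = -(2 * y - ηc + 3 * ηc) by ring, th1_neg, th1_three_eta, neg_neg]
    have t3 : ∀ w, th1 (-(y + ηc) - w - 2 * ηc) τ = th1 (y + w) τ := fun w => by
      rw [show -(y + ηc) - w - 2 * ηc = -(y + w + 3 * ηc) by ring, th1_neg, th1_three_eta, neg_neg]
    have t4 : ∀ w, th1 (y - ηc - w - 2 * ηc) τ = -th1 (y - w) τ := fun w => by
      rw [show y - w = y - ηc - w - 2 * ηc + 3 * ηc by ring, th1_three_eta, neg_neg]
    have hv2 : ∀ j, put2 0 (y + ηc) (y - ηc) v (j + 1 + 1) = itl Neg.neg 0 n x' j := fun j => by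
      simp [put2, hv]
    have p1 : P1 = (th1 y τ * ∏ l ∈ Finset.range n, (th1 (y + x' l) τ * th1 (y - x' l) τ)) *
        th1 (2 * y - ηc) τ * th1 (2 * y + ηc) τ := by
      rw [hP1, show 2 * (n + 1) + 1 = 2 * n + 1 + 1 + 1 by ring, Finset.prod_range_succ',
        Finset.prod_range_succ', put2_left, put2_right, t1, t2]
      simp only [hv2, t3]
      rw [prod_itl_neg (fun w => th1 (y + w) τ), add_zero]
      simp only [← sub_eq_add_neg]
    have p0 : P0 = -(th1 y τ * ∏ l ∈ Finset.range n, (th1 (y + x' l) τ * th1 (y - x' l) τ)) := by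
      rw [hP0]
      simp only [t4]
      rw [prod_itl_neg (fun w => -th1 (y - w) τ), sub_zero, neg_mul]
      congr 2
      refine Finset.prod_congr rfl fun l _ => ?_
      rw [sub_neg_eq_add]
      ring
    rw [p1, p0, Finset.prod_pow]
    ring
  have hK0 : chi τ 0 (y + ηc) * chi τ 0 (ηc - y) = -((th2 0 τ / 2) ^ 2 * (th1 (y + ηc) τ * th1 (y - ηc) τ)) := by
    have k1 := th1_mul_th2_zero (y + ηc) hτ
    have k2 := th1_mul_th2_zero (y - ηc) hτ
    simp only [chi, if_true]
    rw [show y + ηc - 2 * ηc = y - ηc by ring, show ηc - y - 2 * ηc = -(y + ηc) by ring,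
      show ηc - y = -(y - ηc) by ring, th1_neg, th4_neg]
    linear_combination (th1 (y - ηc) τ * th2 0 τ / 4) * k1 + 
      (th1 (y + ηc) (2 * τ) * th4 (y + ηc) (2 * τ) / 2) * k2
  have hK1 : chi τ 1 (y + ηc) * chi τ 1 (ηc - y) = -((th2 0 τ / 2) ^ 2 * (th1 (y + ηc) τ * th1 (y - ηc) τ)) := by
    rw [← hK0]
    simp only [chi, if_true, if_neg (one_ne_zero : (1 : Fin 2) ≠ 0)]
    rw [show y + ηc - 2 * ηc = y - ηc by ring, show ηc - y - 2 * ηc = -(y + ηc) by ring,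
      show ηc - y = -(y - ηc) by ring, th1_neg, th4_neg]
    simp only [th1_neg, th4_neg]
    ring
  have hterm : ∀ (σ : ℕ → Fin 2), ∑ a, ∑ b, (∏ l ∈ Finset.range (n + 2), chi τ (ncons a (ncons b σ) l) (x l)) *
      PsiN Ψ (n + 2) (itl Neg.neg 0 (n + 2) x) (itl flipS 0 (n + 2) (ncons a (ncons b σ))) =
      -((th2 0 τ / 2) ^ 2 * (th1 (y + ηc) τ * th1 (y - ηc) τ)) * (P1 * P0) *
      ((∏ l ∈ Finset.range n, chi τ (σ l) (x' l)) * PsiN Ψ n (itl Neg.neg 0 n x') (itl flipS 0 n σ)) := by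
    intro σ
    have hp : ∀ a b : Fin 2, ∏ l ∈ Finset.range (n + 2), chi τ (ncons a (ncons b σ) l) (x l) =
        (∏ l ∈ Finset.range n, chi τ (σ l) (x' l)) * chi τ b (ηc - y) * chi τ a (y + ηc) := fun a b => by
      rw [Finset.prod_range_succ', Finset.prod_range_succ', hx0, zero_add, hx1]
      rfl
    simp only [hp, hred1, Fin.sum_univ_two]
    simp [singletC, flipS]
    set Q := ∏ l ∈ Finset.range n, chi τ (σ l) (x' l)
    linear_combination (P1 * Q * (-((th2 0 τ / 2) ^ 2 * (th1 (y + ηc) τ * th1 (y - ηc) τ)))) * hdiff σ -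
      (P1 * Q * PsiN Ψ (n + 1) (put2 0 (y + ηc) (y - ηc) v) (put2 0 0 1 fun j => itl flipS 0 n σ (j - 2))) * hK0 +
      (P1 * Q * PsiN Ψ (n + 1) (put2 0 (y + ηc) (y - ηc) v) (put2 0 1 0 fun j => itl flipS 0 n σ (j - 2))) * hK1
  have hsum : ∀ F : (ℕ → Fin 2) → ℂ, Sg (n + 2) F = Sg n fun σ => ∑ a, ∑ b, F (ncons a (ncons b σ)) := by
    intro F
    rw [Sg_succ']
    simp only [Sg_succ' n, Fin.sum_univ_two, Sg_add]
  unfold Zn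
  rw [hsum, Sg_congr n hterm, Sg_mul, hPP]
  ring

lemma Zn_one_neg_beta2 {τ : ℂ} (hτ : 0 < τ.im) {Ψ : PsiFam} (h3 : PsiP3 τ Ψ) (h5 : PsiP5 τ Ψ) (h6 : PsiP6 Ψ)
    (x : ℕ → ℂ) (hx : x 0 = -β2c) : Zn τ Ψ 1 x = th2 0 τ * th2 ηc τ ^ 2 := by
  set v : ℕ → ℂ := put2 0 (-β2c) (β2c - Real.pi) fun _ => 0 with hv
  have hp : ∀ s : Fin 2, PsiN Ψ 1 (itl Neg.neg 0 1 x) (itl flipS 0 1 fun _ => s) = th2 0 τ := by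
    intro s
    have e1 := PsiN_period h3 (n := 1) (i := 1) (by omega) v (itl flipS 0 1 fun _ => s)
    have e2 := PsiN_reduce h5 (n := 0) (i := 0) (by omega) v
      (by simp only [hv, put2]; simp only [β2c, ηc]; norm_num; ring) (itl flipS 0 1 fun _ => s)
    have e3 : PsiN Ψ 0 (ndel 0 v) (ndel 0 (itl flipS 0 1 fun _ => s)) = 1 := h6 _ _
    have e4 : th1 (v 0 - ndel 0 v 0 - 2 * ηc) τ = th2 0 τ := by
      rw [show v 0 - ndel 0 v 0 - 2 * ηc = -(Real.pi / 2 + Real.pi) by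
        simp only [hv, put2, ndel, β2c, ηc]; norm_num; ring, th1_neg, th1_add_pi, th1_half_pi, neg_neg]
    rw [e3, Finset.prod_range_one, e4] at e2
    rw [e2] at e1
    have e5 : PsiN Ψ 1 (itl Neg.neg 0 1 x) (itl flipS 0 1 fun _ => s) =
        PsiN Ψ 1 (Function.update v 1 (v 1 + Real.pi)) (itl flipS 0 1 fun _ => s) := by
      refine PsiN_congr Ψ 1 (fun j hj => ?_) fun _ _ => rfl
      interval_cases j
      · simp [itl, hx, hv, put2]
      · simp [itl, hx, hv, put2]
      · simp [itl, hv, put2]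
    rw [e5, e1]
    fin_cases s <;> simp [Finset.prod_range_succ, itl, flipS, sgn, singletC]
  have hs := chi_add (-β2c) hτ
  rw [show -β2c - ηc = -(2 * ηc + Real.pi / 2) by unfold β2c; ring, th1_neg, th1_add_half_pi, th2_two_eta, neg_neg] at hs
  have hf : ∀ s : Fin 2, PsiN Ψ 1 (itl Neg.neg 0 1 x) (itl flipS 0 1 (Function.update (fun _ => 0) 0 s)) = th2 0 τ := by
    intro s
    rw [← hp s]
    refine PsiN_congr Ψ 1 (fun j hj => rfl) fun j hj => ?_
    interval_cases j <;> simp [itl]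
  simp only [Zn, Sg, Finset.prod_range_one, Function.update_self, Fin.sum_univ_two, hx]
  rw [hf 0, hf 1]
  linear_combination th2 0 τ * hs

lemma Gf_mul_neg_mem {τ : ℂ} (hτ : 0 < τ.im) : (fun z => Gf τ z * Gf τ (-z)) ∈ evenTheta τ 2 := by
  have hd := Gf_differentiable hτ
  refine ⟨hd.mul (hd.comp (f := fun z : ℂ => -z) (by fun_prop)), fun z => ?_, fun z => ?_, fun z => ?_⟩
  · dsimp only
    rw [Gf_add_pi, show -(z + (Real.pi : ℂ)) = -z - Real.pi by ring, Gf_sub_pi]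
  · dsimp only
    have e : Complex.exp (-(I * (2 * Real.pi * τ + 4 * z + 4 * ηc))) *
        Complex.exp (-(I * (2 * Real.pi * τ - 4 * (-z) - 4 * ηc))) =
        Complex.exp (-((2 : ℕ) * (2 * I * (Real.pi * τ + 2 * z)))) := by
      rw [← Complex.exp_add]; congr 1; push_cast; ring
    rw [Gf_add_pi_tau, show -(z + (Real.pi : ℂ) * τ) = -z - Real.pi * τ by ring, Gf_sub_pi_tau]
    linear_combination Gf τ z * Gf τ (-z) * e
  · dsimp only
    rw [neg_neg, mul_comm]

lemma Gf_neg_beta2 (τ : ℂ) : Gf τ (-β2c) = th4 0 (2 * τ) := by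
  rw [Gf, show 2 * -β2c + 2 * ηc = 0 - Real.pi by unfold β2c; ring, th4_sub_pi]

/-- The points `a` and `±b` are distinct modulo the period lattice. -/
def ThSep (τ a b : ℂ) : Prop := th1 (a + b) τ ≠ 0 ∧ th1 (a - b) τ ≠ 0

lemma ThSep.symm {τ a b : ℂ} (h : ThSep τ a b) : ThSep τ b a :=
  ⟨by rw [add_comm]; exact h.1, by rw [← neg_sub, th1_neg]; exact neg_ne_zero.2 h.2⟩

lemma sep_neg_eta_beta3 {τ : ℂ} (hτ : 0 < τ.im) : ThSep τ (-ηc) (β3c τ) := by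
  constructor
  · have := th1_real_ne_zero hτ (1 / 2) (1 / 2)
      (fun h => not_int_of_between 0 (by norm_num) (by norm_num) h.1)
    convert this using 2
    unfold ηc β3c ηc; push_cast; ring
  · have := th1_real_ne_zero hτ (-7 / 6) (-1 / 2)
      (fun h => not_int_of_between (-2) (by norm_num) (by norm_num) h.1)
    convert this using 2
    unfold ηc β3c ηc; push_cast; ring

lemma sep_neg_eta_beta4 {τ : ℂ} (hτ : 0 < τ.im) : ThSep τ (-ηc) (β4c τ) := by
  constructor
  · have := th1_real_ne_zero hτ 0 (1 / 2)
      (fun h => not_int_of_between 0 (by norm_num) (by norm_num) h.2)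
    convert this using 2
    unfold ηc β4c ηc; push_cast; ring
  · have := th1_real_ne_zero hτ (-2 / 3) (-1 / 2)
      (fun h => not_int_of_between (-1) (by norm_num) (by norm_num) h.1)
    convert this using 2
    unfold ηc β4c ηc; push_cast; ring

lemma sep_beta3_beta4 {τ : ℂ} (hτ : 0 < τ.im) : ThSep τ (β3c τ) (β4c τ) := by
  constructor
  · have := th1_real_ne_zero hτ (7 / 6) 1
      (fun h => not_int_of_between 1 (by norm_num) (by norm_num) h.1)
    convert this using 2
    unfold β3c β4c ηc; push_cast; ring
  · have := th1_real_ne_zero hτ (1 / 2) 0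
      (fun h => not_int_of_between 0 (by norm_num) (by norm_num) h.1)
    convert this using 2
    unfold β3c β4c ηc; push_cast; ring

lemma sep_neg_eta_beta2 {τ : ℂ} (hτ : 0 < τ.im) : ThSep τ (-ηc) (-β2c) := by
  constructor
  · have := th1_real_ne_zero hτ (-7 / 6) 0
      (fun h => not_int_of_between (-2) (by norm_num) (by norm_num) h.1)
    convert this using 2
    unfold ηc β2c ηc; push_cast; ring
  · have := th1_real_ne_zero hτ (1 / 2) 0
      (fun h => not_int_of_between 0 (by norm_num) (by norm_num) h.1)
    convert this using 2
    unfold ηc β2c ηc; push_cast; ring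

lemma sep_beta3_beta2 {τ : ℂ} (hτ : 0 < τ.im) : ThSep τ (β3c τ) (-β2c) := by
  constructor
  · have := th1_real_ne_zero hτ 0 (1 / 2)
      (fun h => not_int_of_between 0 (by norm_num) (by norm_num) h.2)
    convert this using 2
    unfold β3c β2c ηc; push_cast; ring
  · have := th1_real_ne_zero hτ (5 / 3) (1 / 2)
      (fun h => not_int_of_between 1 (by norm_num) (by norm_num) h.1)
    convert this using 2
    unfold β3c β2c ηc; push_cast; ring

lemma sep_beta4_beta2 {τ : ℂ} (hτ : 0 < τ.im) : ThSep τ (β4c τ) (-β2c) := by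
  constructor
  · have := th1_real_ne_zero hτ (-1 / 2) (1 / 2)
      (fun h => not_int_of_between (-1) (by norm_num) (by norm_num) h.1)
    convert this using 2
    unfold β4c β2c ηc; push_cast; ring
  · have := th1_real_ne_zero hτ (7 / 6) (1 / 2)
      (fun h => not_int_of_between 1 (by norm_num) (by norm_num) h.1)
    convert this using 2
    unfold β4c β2c ηc; push_cast; ring

lemma evenTheta_eq_zero_of_nodes {τ : ℂ} (hτ : 0 < τ.im) {l : ℕ} (hl : 1 ≤ l) {ι : Type*} [Fintype ι]
    (b : ι → ℂ) (hcard : l ≤ Fintype.card ι + 2) (hb : ∀ i j, i ≠ j → ThSep τ (b i) (b j))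
    (hb1 : ∀ i, ThSep τ (-ηc) (b i)) (hb3 : ∀ i, ThSep τ (β3c τ) (b i)) (hb4 : ∀ i, ThSep τ (β4c τ) (b i))
    {f : ℂ → ℂ} (hf : f ∈ evenTheta τ l) (f1 : f (-ηc) = 0) (f3 : f (β3c τ) = 0) (f4 : f (β4c τ) = 0)
    (h0 : ∀ i, f (b i) = 0) : f = 0 := by
  refine evenTheta_eq_zero_of_zeros hτ hl (ι := Fin 3 ⊕ ι) (Sum.elim ![-ηc, β3c τ, β4c τ] b)
    (by rw [Fintype.card_sum, Fintype.card_fin]; omega) ?_ hf ?_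
  · have e13 := sep_neg_eta_beta3 hτ
    have e14 := sep_neg_eta_beta4 hτ
    have e34 := sep_beta3_beta4 hτ
    rintro (i | i) (j | j) hij
    · fin_cases i <;> fin_cases j
      · exact absurd rfl hij
      · exact e13
      · exact e14
      · exact e13.symm
      · exact absurd rfl hij
      · exact e34
      · exact e14.symm
      · exact e34.symm
      · exact absurd rfl hij
    · fin_cases i
      · exact hb1 j
      · exact hb3 j
      · exact hb4 j
    · fin_cases j
      · exact (hb1 i).symm
      · exact (hb3 i).symm
      · exact (hb4 i).symm
    · exact hb i j fun h => hij (by rw [h])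
  · rintro (i | i)
    · fin_cases i
      · exact f1
      · exact f3
      · exact f4
    · exact h0 i

lemma Zn_congr (τ : ℂ) (Ψ : PsiFam) {n : ℕ} {x y : ℕ → ℂ} (h : ∀ l < n, x l = y l) : Zn τ Ψ n x = Zn τ Ψ n y := by
  refine Sg_congr n fun σ => ?_
  rw [Finset.prod_congr rfl fun l hl => by rw [h l (Finset.mem_range.1 hl)]]
  congr 1
  refine PsiN_congr Ψ n (fun j hj => ?_) fun _ _ => rfl
  simp only [itl]
  split_ifs
  · exact h _ (by omega)
  · rw [h _ (by omega)]
  · rfl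

lemma Zn_one {τ : ℂ} (hτ : 0 < τ.im) {Ψ : PsiFam} (hent : PsiEntire Ψ) (h1 : PsiP1 τ Ψ) (h2 : PsiP2 τ Ψ)
    (h3 : PsiP3 τ Ψ) (h5 : PsiP5 τ Ψ) (h6 : PsiP6 Ψ) (x : ℕ → ℂ) (hx : Gf τ (-x 0) ≠ 0) :
    Zn τ Ψ 1 x = -(th2 0 τ / (2 * kap τ * th4 0 (2 * τ))) * (Gf τ (x 0) * Dth τ (x 0)) := by
  set C : ℂ := -(th2 0 τ / (2 * kap τ * th4 0 (2 * τ))) with hC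
  have hE := Zn_mem hτ hent h1 h2 h3 (n := 1) (m := 0) (by omega) x
  have hP := evenTheta_mul (Gf_mul_neg_mem hτ) (Dth_mem hτ)
  rw [show 1 + 2 = 3 from rfl] at hE
  rw [show 2 + 1 = 3 from rfl] at hP
  have hF := (evenTheta τ 3).smul_mem C hP
  have hk := kap_ne hτ
  have h0 := th4_zero_ne hτ
  have key := evenTheta_eq_zero_of_nodes hτ (by omega) (fun _ : Unit => -β2c) (by simp)
    (fun i j h => absurd (Subsingleton.elim i j) h) (fun _ => sep_neg_eta_beta2 hτ)
    (fun _ => sep_beta3_beta2 hτ) (fun _ => sep_beta4_beta2 hτ) ((evenTheta τ 3).sub_mem hE hF)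
    (by
      simp only [Pi.sub_apply, Pi.smul_apply, smul_eq_mul, Dth_neg]
      rw [Zn_neg_eta h5 0 _ (by simp), Dth, sub_self, th1_zero]; ring)
    (by
      simp only [Pi.sub_apply, Pi.smul_apply, smul_eq_mul, Gf_neg_beta3]; ring)
    (by
      simp only [Pi.sub_apply, Pi.smul_apply, smul_eq_mul, Gf_neg_beta4]; ring)
    (by
      intro _
      simp only [Pi.sub_apply, Pi.smul_apply, smul_eq_mul, Dth_neg, neg_neg]
      rw [Zn_one_neg_beta2 hτ h3 h5 h6 _ (by simp), Gf_neg_beta2, hC]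
      have e1 := Dth_beta2 hτ
      have e2 := kap_mul_th2_eta hτ
      have e1' : Dth τ β2c = -th2 0 τ ^ 2 / (2 * kap τ) := by field_simp; linear_combination e1
      have e2' : th2 ηc τ = th2 0 τ / (2 * kap τ) := by field_simp; linear_combination 2 * e2
      rw [e1', e2']
      field_simp
      ring)
  have := congrFun key (x 0)
  simp only [Pi.sub_apply, Pi.smul_apply, smul_eq_mul, Pi.zero_apply, Function.update_eq_self] at this
  refine mul_right_cancel₀ hx ?_
  linear_combination this

lemma Zn_swap_one {τ : ℂ} (hτ : 0 < τ.im) {Ψ : PsiFam} (h1 : PsiP1 τ Ψ) {n : ℕ} (j : ℕ) (hj : j + 1 < n)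
    (x : ℕ → ℂ) (hx : ∀ a b, a ≠ 0 → b ≠ 0 → a ≠ b → rv τ (x a - x b) ≠ 0 ∧ rv τ (-x a - x b) ≠ 0) :
    Zn τ Ψ n (fun l => x (Equiv.swap 1 (j + 1) l)) = Zn τ Ψ n x := by
  have hperm : ∀ (x : ℕ → ℂ) (_ : ∀ a b, a ≠ 0 → b ≠ 0 → a ≠ b → rv τ (x a - x b) ≠ 0 ∧ rv τ (-x a - x b) ≠ 0)
      (c d : ℕ) (_ : c ≠ 0) (_ : d ≠ 0), ∀ a b, a ≠ 0 → b ≠ 0 → a ≠ b →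
      rv τ (x (Equiv.swap c d a) - x (Equiv.swap c d b)) ≠ 0 ∧
      rv τ (-x (Equiv.swap c d a) - x (Equiv.swap c d b)) ≠ 0 := by
    intro x hx c d hc hd a b ha hb hab
    have h0 : Equiv.swap c d 0 = 0 := Equiv.swap_apply_of_ne_of_ne hc.symm hd.symm
    refine hx _ _ (fun h => ha ?_) (fun h => hb ?_) fun h => hab ((Equiv.swap c d).injective h)
    · exact (Equiv.swap c d).injective (h.trans h0.symm)
    · exact (Equiv.swap c d).injective (h.trans h0.symm)
  induction j generalizing x with
  | zero => simp
  | succ j ih =>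
    have hadj : ∀ (x : ℕ → ℂ) (_ : ∀ a b, a ≠ 0 → b ≠ 0 → a ≠ b → rv τ (x a - x b) ≠ 0 ∧ rv τ (-x a - x b) ≠ 0),
        Zn τ Ψ n (fun l => x (Equiv.swap (j + 1) (j + 1 + 1) l)) = Zn τ Ψ n x := fun x hx =>
      Zn_swap hτ h1 hj x (hx _ _ (by omega) (by omega) (by omega)).1 (hx _ _ (by omega) (by omega) (by omega)).2
    rcases Nat.eq_zero_or_pos j with rfl | hj0
    · exact hadj x hx
    · have hs := Equiv.swap_mul_swap_mul_swap (x := 1) (y := j + 1) (z := j + 1 + 1) (by omega) (by omega)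
      rw [Equiv.swap_comm 1 (j + 1 + 1), ← hs]
      simp only [Equiv.Perm.mul_apply]
      have hx1 := hperm x hx (j + 1) (j + 1 + 1) (by omega) (by omega)
      have hx2 := hperm _ hx1 1 (j + 1) (by omega) (by omega)
      have e1 := hadj (fun l => x (Equiv.swap (j + 1) (j + 1 + 1) (Equiv.swap 1 (j + 1) l))) hx2
      have e2 := ih (by omega) (fun l => x (Equiv.swap (j + 1) (j + 1 + 1) l)) hx1
      exact (e1.trans e2).trans (hadj x hx)

lemma Gen.rv_ne {τ : ℂ} (hτ : 0 < τ.im) {x : ℕ → ℂ} (h : Gen τ x) {a b : ℕ} (hab : a ≠ b) :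
    rv τ (x a - x b) ≠ 0 ∧ rv τ (-x a - x b) ≠ 0 := by
  have h4 := (th14_eta_ne hτ).2
  have h2 := th2_eta_ne hτ
  constructor
  · rw [rv_eq _ hτ, th4_two_eta]
    refine mul_ne_zero h4 (mul_ne_zero ?_ h2)
    convert h.th1_ne hτ hab (a := 1) one_ne_zero (-1) (1 / 3) 0 using 2
    unfold ηc; push_cast; ring
  · rw [rv_eq _ hτ, th4_two_eta]
    refine mul_ne_zero h4 (mul_ne_zero ?_ h2)
    convert h.th1_ne hτ hab (a := -1) (by norm_num) (-1) (1 / 3) 0 using 2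
    unfold ηc; push_cast; ring

lemma Gf_ne_of_th1 {τ x : ℂ} (hτ : 0 < τ.im) (h : th1 (2 * x + 2 * ηc) τ ≠ 0) : Gf τ x ≠ 0 := fun h0 => by
  have e := th1_mul_th2_zero (2 * x + 2 * ηc) hτ
  rw [Gf] at h0
  rw [h0, mul_zero, mul_zero] at e
  exact mul_ne_zero h (th2_zero_ne hτ) e

lemma Gen.Gf_ne {τ : ℂ} (hτ : 0 < τ.im) {x : ℕ → ℂ} (h : Gen τ x) (a : ℕ) : Gf τ (x a) ≠ 0 := by
  refine Gf_ne_of_th1 hτ ?_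
  convert h.th1_ne_one hτ a (a := 2) (by norm_num) (2 / 3) 0 using 2
  unfold ηc; push_cast; ring

lemma Gen.Gf_neg_ne {τ : ℂ} (hτ : 0 < τ.im) {x : ℕ → ℂ} (h : Gen τ x) (a : ℕ) : Gf τ (-x a) ≠ 0 := by
  have := (h.update_neg a).Gf_ne hτ a
  rwa [Function.update_self] at this

lemma Gen.Dth_ne {τ : ℂ} (hτ : 0 < τ.im) {x : ℕ → ℂ} (h : Gen τ x) (a : ℕ) : Dth τ (x a) ≠ 0 := by
  refine mul_ne_zero ?_ ?_
  · convert h.th1_ne_one hτ a (a := 1) (by norm_num) (-1 / 3) 0 using 2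
    unfold ηc; push_cast; ring
  · convert h.th1_ne_one hτ a (a := 1) (by norm_num) (1 / 3) 0 using 2
    unfold ηc; push_cast; ring

/-- The explicit expression of the scalar product at the point `x`, with constant `C`. -/
def MainAt (τ : ℂ) (Ψ : PsiFam) (H : (k : ℕ) → (Fin (2 * k) → ℂ) → ℂ) (n : ℕ) (C : ℂ) (x : ℕ → ℂ) : Prop :=
  Zn τ Ψ n x = C * (∏ i ∈ Finset.range n, Gf τ (x i) * Dth τ (x i) ^ n) * Rn H n fun i => wfun τ (x i)

/-- The quotient of the constants for `n + 2` and `n`. -/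
def stepC (τ : ℂ) (n : ℕ) : ℂ :=
  th2 0 τ ^ 2 * kap τ ^ (2 * n + 2) / (2 * th4 0 (2 * τ) ^ 2 * th1 ηc τ ^ (4 * n + 2))

lemma rec_theta_double {τ : ℂ} (hτ : 0 < τ.im) (y : ℂ) :
    (th2 0 τ / 2) ^ 2 * (th1 (2 * y + ηc) τ * th1 (2 * y - ηc) τ) * th4 0 (2 * τ) ^ 2 =
      Dth τ y * (th2 (y + ηc) τ * th2 (y - ηc) τ) * (Gf τ (y + ηc) * Gf τ (ηc - y)) := by
  have e1 := th1_mul_th2_zero (2 * y + ηc) hτ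
  have e2 := th1_mul_th2_zero (2 * y - ηc) hτ
  have g1 : Gf τ (y + ηc) = th4 (2 * y + ηc) (2 * τ) := by
    rw [Gf, show 2 * (y + ηc) + 2 * ηc = 2 * y + ηc + Real.pi by unfold ηc; ring, th4_add_pi]
  have g2 : Gf τ (ηc - y) = th4 (2 * y - ηc) (2 * τ) := by
    rw [Gf, show 2 * (ηc - y) + 2 * ηc = -(2 * y - ηc - Real.pi) by unfold ηc; ring, th4_neg, th4_sub_pi]
  have e3 := th1_mul_th2_self (y + 2 * ηc) hτ
  have e4 := th1_mul_th2_self (-y + 2 * ηc) hτ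
  rw [th1_add_two_eta, th2_add_two_eta, show 2 * (y + 2 * ηc) = 2 * y + ηc + Real.pi by unfold ηc; ring,
    th1_add_pi] at e3
  rw [th1_add_two_eta, th2_add_two_eta, show 2 * (-y + 2 * ηc) = -(2 * y - ηc) + Real.pi by unfold ηc; ring,
    th1_add_pi, th1_neg, show -y - ηc = -(y + ηc) by ring, th1_neg, th2_neg] at e4
  rw [g1, g2, Dth]
  have e5 : (th1 (y - ηc) τ * th1 (y + ηc) τ) * (th2 (y + ηc) τ * th2 (y - ηc) τ) =
      th4 0 (2 * τ) ^ 2 * (th1 (2 * y + ηc) (2 * τ) * th1 (2 * y - ηc) (2 * τ)) := by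
    linear_combination (th1 (y + ηc) τ * th2 (y + ηc) τ) * e3 + (th4 0 (2 * τ) * th1 (2 * y + ηc) (2 * τ)) * e4
  linear_combination (th4 0 (2 * τ) ^ 2 / 4) * (th1 (2 * y - ηc) τ * th2 0 τ) * e1 +
    (th4 0 (2 * τ) ^ 2 / 4) * (2 * (th1 (2 * y + ηc) (2 * τ) * th4 (2 * y + ηc) (2 * τ))) * e2 -
    (th4 (2 * y + ηc) (2 * τ) * th4 (2 * y - ηc) (2 * τ)) * e5

lemma rec_J2_sub {τ : ℂ} (hτ : 0 < τ.im) {y : ℂ} (hy : Dth τ y ≠ 0) :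
    th2 (y + ηc) τ * th2 (y - ηc) τ * th1 ηc τ ^ 2 * (2 * kap τ ^ 2) =
      Dth τ y * th2 0 τ ^ 2 * (J2c - wfun τ y) := by
  have e := Dth_beta2 hτ
  have hb : Dth τ β2c ≠ 0 := fun h => by
    rw [h, zero_mul] at e
    exact pow_ne_zero 2 (th2_zero_ne hτ) (neg_eq_zero.1 e.symm)
  have h := wfun_sub hτ hy hb
  rw [wfun_beta2 hτ, show y + β2c = y + ηc + Real.pi / 2 by unfold β2c; ring, th1_add_half_pi,
    show y - β2c = y - ηc + Real.pi / 2 - Real.pi by unfold β2c; ring, th1_sub_pi, th1_add_half_pi] at h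
  linear_combination (-2 * kap τ) * h - Dth τ y * (J2c - wfun τ y) * e

lemma mainAt_algebra {b0 AB Θ T P C g Δ R q w S J GG κ t0 T1 : ℂ} (n : ℕ) (hκ : κ ≠ 0) (ht : t0 ≠ 0) (hT1 : T1 ≠ 0)
    (hT : T ≠ 0) (hAB : AB ≠ 0) (hK : (b0 / 2) ^ 2 * Θ * t0 ^ 2 * (T1 ^ 2 * (2 * κ ^ 2)) = AB ^ 2 * b0 ^ 2 * J * GG)
    (hW : w * T ^ 2 = κ ^ 2 * AB) (hP : P * (T1 ^ 2 * κ) ^ n = AB ^ n * Δ * S) (hq : κ ^ 3 * q = 1) :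
    (b0 / 2) ^ 2 * AB * Θ * T ^ 2 * P ^ 2 * (C * (g * Δ ^ n) * R) =
      C * (b0 ^ 2 * κ ^ (2 * n + 2) / (2 * t0 ^ 2 * T1 ^ (4 * n + 2))) * (GG * (T ^ 2 * AB) ^ (n + 2) * (g * Δ ^ (n + 2))) *
        (q ^ (2 * n + 2) * w ^ (n + 1) * J * S ^ 2 * R) := by
  have hw : (T ^ 2 * AB) ^ (n + 2) * w ^ (n + 1) = T ^ 2 * AB * (κ ^ 2 * AB * AB) ^ (n + 1) := by
    rw [← hW, pow_succ]
    simp only [mul_pow]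
    ring
  have hq' : κ ^ (2 * n + 2) * (κ ^ 2 * AB * AB) ^ (n + 1) * q ^ (2 * n + 2) =
      (κ ^ (2 * n + 2))⁻¹ * (AB * AB) ^ (n + 1) := by
    have e : (κ ^ 3 * q) ^ (2 * n + 2) = 1 := by rw [hq, one_pow]
    rw [eq_comm, inv_mul_eq_iff_eq_mul₀ (pow_ne_zero _ hκ)]
    linear_combination -(AB * AB) ^ (n + 1) * e
  have hPr : P = AB ^ n * Δ * S / (T1 ^ 2 * κ) ^ n := by
    rw [eq_div_iff (pow_ne_zero _ (mul_ne_zero (pow_ne_zero _ hT1) hκ))]; exact hP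
  have hΘ : (b0 / 2) ^ 2 * Θ = AB ^ 2 * b0 ^ 2 * J * GG / (t0 ^ 2 * (T1 ^ 2 * (2 * κ ^ 2))) := by
    field_simp
    linear_combination 2 * hK
  calc _ = ((b0 / 2) ^ 2 * Θ) * (AB * T ^ 2 * P ^ 2 * (C * (g * Δ ^ n) * R)) := by ring
    _ = C * (b0 ^ 2 / (2 * t0 ^ 2 * T1 ^ (4 * n + 2))) * GG * (T ^ 2 * AB) * (g * Δ ^ (n + 2)) *
        ((κ ^ (2 * n + 2))⁻¹ * (AB * AB) ^ (n + 1)) * J * S ^ 2 * R := by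
      rw [hΘ, hPr]
      field_simp
      ring
    _ = C * (b0 ^ 2 / (2 * t0 ^ 2 * T1 ^ (4 * n + 2))) * GG * ((T ^ 2 * AB) ^ (n + 2) * w ^ (n + 1)) *
        (g * Δ ^ (n + 2)) * (κ ^ (2 * n + 2) * q ^ (2 * n + 2)) * J * S ^ 2 * R := by
      rw [← hq', hw]
      ring
    _ = _ := by ring

lemma mainAt_rec {τ : ℂ} (hτ : 0 < τ.im) {Ψ : PsiFam} (h1 : PsiP1 τ Ψ) (h5 : PsiP5 τ Ψ)
    {H : (k : ℕ) → (Fin (2 * k) → ℂ) → ℂ} (hH : IsHFamily (zet τ) H) {n : ℕ} {C : ℂ} {x : ℕ → ℂ} {y : ℂ}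
    (hx0 : x 0 = y + ηc) (hx1 : x 1 = ηc - y) (hT : th1 y τ ≠ 0) (hA : th1 (y + ηc) τ ≠ 0)
    (hB : th1 (y - ηc) τ ≠ 0) (hD : ∀ l, Dth τ (x (l + 2)) ≠ 0) (h : MainAt τ Ψ H n C fun l => x (l + 2)) :
    MainAt τ Ψ H (n + 2) (C * stepC τ n) x := by
  have hDy : Dth τ y ≠ 0 := mul_ne_zero hB hA
  have hw1 : wfun τ (x 1) = wfun τ (y - ηc) := by rw [hx1, ← wfun_neg, neg_sub]
  have hD1 : Dth τ (x 1) = -(th1 y τ * th1 (y + ηc) τ) := by rw [hx1, ← Dth_neg, neg_sub, Dth_sub_eta]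
  have hD0 : Dth τ (x 0) = -(th1 y τ * th1 (y - ηc) τ) := by rw [hx0, Dth_add_eta]
  have hD0' : Dth τ (y + ηc) ≠ 0 := by rw [Dth_add_eta]; exact neg_ne_zero.2 (mul_ne_zero hT hB)
  have hD1' : Dth τ (y - ηc) ≠ 0 := by rw [Dth_sub_eta]; exact neg_ne_zero.2 (mul_ne_zero hT hA)
  have htr : Triple (zet τ) (wfun τ (x 0)) (wfun τ (x 1)) (wfun τ y) := by
    rw [hw1, hx0]
    exact ⟨by linear_combination w_triple_prod hτ hT hA hB, by linear_combination w_triple_sum hτ hT hA hB⟩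
  unfold MainAt at h ⊢
  rw [Zn_rec hτ h1 h5 n x y hx0 hx1, h, Rn_add_two hH htr, Finset.prod_range_succ', Finset.prod_range_succ',
    Finset.prod_mul_distrib, Finset.prod_mul_distrib, Finset.prod_pow, Finset.prod_pow, Finset.prod_pow, stepC]
  simp only [zero_add]
  have hW : wfun τ (x 0) * wfun τ (x 1) * th1 y τ ^ 2 = kap τ ^ 2 * Dth τ y := by
    have e0 := wfun_mul_Dth hD0'
    have e1 := wfun_mul_Dth hD1'
    rw [hw1, hx0]
    rw [Dth_add_eta] at e0
    rw [Dth_sub_eta] at e1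
    refine mul_right_cancel₀ (mul_ne_zero hA hB) ?_
    rw [Dth]
    linear_combination (wfun τ (y - ηc) * -(th1 y τ * th1 (y + ηc) τ)) * e0 +
      (kap τ * th1 (y + ηc) τ ^ 2) * e1
  have hP : (∏ l ∈ Finset.range n, th1 (y + x (l + 2)) τ * th1 (y - x (l + 2)) τ) * (th1 ηc τ ^ 2 * kap τ) ^ n =
      Dth τ y ^ n * (∏ l ∈ Finset.range n, Dth τ (x (l + 2))) *
        ∏ l ∈ Finset.range n, (wfun τ (x (l + 2)) - wfun τ y) := by
    have e : ∀ c : ℂ, c ^ n = ∏ l ∈ Finset.range n, c := by simp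
    rw [e, e, ← Finset.prod_mul_distrib, ← Finset.prod_mul_distrib, ← Finset.prod_mul_distrib]
    refine Finset.prod_congr rfl fun l _ => ?_
    rw [← wfun_sub hτ hDy (hD l)]
    ring
  have hK : (th2 0 τ / 2) ^ 2 * (th1 (2 * y + ηc) τ * th1 (2 * y - ηc) τ) * th4 0 (2 * τ) ^ 2 *
      (th1 ηc τ ^ 2 * (2 * kap τ ^ 2)) =
      Dth τ y ^ 2 * th2 0 τ ^ 2 * (J2c - wfun τ y) * (Gf τ (x 0) * Gf τ (x 1)) := by
    rw [rec_theta_double hτ y, hx0, hx1]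
    linear_combination (Dth τ y * (Gf τ (y + ηc) * Gf τ (ηc - y))) * rec_J2_sub hτ hDy
  have key := mainAt_algebra (C := C) (g := ∏ l ∈ Finset.range n, Gf τ (x (l + 2)))
    (R := Rn H n fun i => wfun τ (x (i + 2))) n (kap_ne hτ) (th4_zero_ne hτ) (th1_eta_ne hτ) hT hDy hK hW hP
    (kap_pow_zet hτ)
  have hDD : Dth τ (x 0) ^ (n + 2) * Dth τ (x 1) ^ (n + 2) = (th1 y τ ^ 2 * Dth τ y) ^ (n + 2) := by
    rw [← mul_pow, hD0, hD1, Dth]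
    congr 1
    ring
  rw [← hDD] at key
  rw [Dth] at key
  linear_combination key

lemma mainAt_node_one {τ : ℂ} (hτ : 0 < τ.im) {Ψ : PsiFam} (h1 : PsiP1 τ Ψ) (h5 : PsiP5 τ Ψ)
    {H : (k : ℕ) → (Fin (2 * k) → ℂ) → ℂ} (hH : IsHFamily (zet τ) H) {n : ℕ} {C : ℂ}
    (ih : ∀ x, Gen τ x → MainAt τ Ψ H n C x) {x : ℕ → ℂ} (hg : Gen τ x) :
    MainAt τ Ψ H (n + 2) (C * stepC τ n) (Function.update x 0 (2 * ηc - x 1)) := by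
  have htail : ∀ l, Function.update x 0 (2 * ηc - x 1) (l + 2) = x (l + 2) := fun l =>
    Function.update_of_ne (by omega) _ _
  refine mainAt_rec hτ h1 h5 hH (y := ηc - x 1) ?_ ?_ ?_ ?_ ?_ ?_ ?_
  · rw [Function.update_self]; ring
  · rw [Function.update_of_ne one_ne_zero]; ring
  · convert hg.th1_ne_one hτ 1 (a := -1) (by norm_num) (1 / 3) 0 using 2
    unfold ηc; push_cast; ring
  · convert hg.th1_ne_one hτ 1 (a := -1) (by norm_num) (2 / 3) 0 using 2
    unfold ηc; push_cast; ring
  · convert hg.th1_ne_one hτ 1 (a := -1) (by norm_num) 0 0 using 2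
    unfold ηc; push_cast; ring
  · intro l
    rw [htail]
    exact hg.Dth_ne hτ _
  · simp only [htail]
    exact ih _ (hg.comp (f := fun l => l + 2) (add_left_injective 2))

lemma mainAt_node {τ : ℂ} (hτ : 0 < τ.im) {Ψ : PsiFam} (h1 : PsiP1 τ Ψ) (h5 : PsiP5 τ Ψ)
    {H : (k : ℕ) → (Fin (2 * k) → ℂ) → ℂ} (hH : IsHFamily (zet τ) H) {n : ℕ} {C : ℂ}
    (ih : ∀ x, Gen τ x → MainAt τ Ψ H n C x) {x : ℕ → ℂ} (hg : Gen τ x) {j : ℕ} (hj : j + 1 < n + 2)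
    (hR : ∀ w : ℕ → ℂ, Rn H (n + 2) (fun l => w (Equiv.swap 1 (j + 1) l)) = Rn H (n + 2) w) :
    MainAt τ Ψ H (n + 2) (C * stepC τ n) (Function.update x 0 (2 * ηc - x (j + 1))) := by
  set X := Function.update x 0 (2 * ηc - x (j + 1)) with hX
  have hs0 : Equiv.swap 1 (j + 1) 0 = 0 := Equiv.swap_apply_of_ne_of_ne (by omega) (by omega)
  have e : (fun l => X (Equiv.swap 1 (j + 1) l)) =
      Function.update (fun l => x (Equiv.swap 1 (j + 1) l)) 0
        (2 * ηc - (fun l => x (Equiv.swap 1 (j + 1) l)) 1) := by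
    ext l
    by_cases hl : l = 0
    · subst hl
      simp [hX, hs0]
    · have : Equiv.swap 1 (j + 1) l ≠ 0 := fun h => hl ((Equiv.swap 1 (j + 1)).injective (h.trans hs0.symm))
      simp [hX, this, hl]
  have h := mainAt_node_one hτ h1 h5 hH ih (hg.comp (Equiv.swap 1 (j + 1)).injective)
  rw [← e] at h
  have hZ := Zn_swap_one hτ h1 j hj X fun a b ha hb hab => by
    rw [hX, Function.update_of_ne ha, Function.update_of_ne hb]
    exact hg.rv_ne hτ hab
  unfold MainAt at h ⊢
  rw [hZ, hR fun i => wfun τ (X i)] at h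
  rw [h]
  congr 2
  refine Finset.prod_equiv (Equiv.swap 1 (j + 1)) (fun i => ?_) fun i _ => rfl
  simp only [Finset.mem_range]
  by_cases h1 : i = 1
  · subst h1; simp; omega
  · by_cases h2 : i = j + 1
    · subst h2; simp; omega
    · rw [Equiv.swap_apply_of_ne_of_ne h1 h2]

lemma MainAt.neg {τ : ℂ} (hτ : 0 < τ.im) {Ψ : PsiFam} (hent : PsiEntire Ψ) (h1 : PsiP1 τ Ψ) (h3 : PsiP3 τ Ψ)
    {H : (k : ℕ) → (Fin (2 * k) → ℂ) → ℂ} {n m : ℕ} (hm : m < n) {C : ℂ} {x : ℕ → ℂ}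
    (hG : Gf τ (x m) ≠ 0) (h : MainAt τ Ψ H n C x) :
    MainAt τ Ψ H n C (Function.update x m (-x m)) := by
  unfold MainAt at h ⊢
  have e := Zn_neg_mul hτ hent h1 h3 hm x
  have hw : (fun i => wfun τ (Function.update x m (-x m) i)) = fun i => wfun τ (x i) := by
    ext i
    by_cases hi : i = m
    · subst hi; rw [Function.update_self, wfun_neg]
    · rw [Function.update_of_ne hi]
  have hp : (∏ i ∈ Finset.range n, Gf τ (Function.update x m (-x m) i) *
      Dth τ (Function.update x m (-x m) i) ^ n) * Gf τ (x m) =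
      (∏ i ∈ Finset.range n, Gf τ (x i) * Dth τ (x i) ^ n) * Gf τ (-x m) := by
    rw [← Finset.mul_prod_erase _ _ (Finset.mem_range.2 hm), ← Finset.mul_prod_erase _ (fun i => Gf τ (x i) * _)
      (Finset.mem_range.2 hm), Function.update_self, Dth_neg, Finset.prod_congr rfl fun i hi => by
        rw [Function.update_of_ne (Finset.ne_of_mem_erase hi)]]
    ring
  refine mul_right_cancel₀ hG ?_
  rw [e, h, hw]
  linear_combination (-C * Rn H n fun i => wfun τ (x i)) * hp

lemma mainAt_node_neg {τ : ℂ} (hτ : 0 < τ.im) {Ψ : PsiFam} (hent : PsiEntire Ψ) (h1 : PsiP1 τ Ψ) (h3 : PsiP3 τ Ψ)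
    (h5 : PsiP5 τ Ψ) {H : (k : ℕ) → (Fin (2 * k) → ℂ) → ℂ} (hH : IsHFamily (zet τ) H) {n : ℕ} {C : ℂ}
    (ih : ∀ x, Gen τ x → MainAt τ Ψ H n C x) {x : ℕ → ℂ} (hg : Gen τ x) {j : ℕ} (hj : j + 1 < n + 2)
    (hR : ∀ w : ℕ → ℂ, Rn H (n + 2) (fun l => w (Equiv.swap 1 (j + 1) l)) = Rn H (n + 2) w) :
    MainAt τ Ψ H (n + 2) (C * stepC τ n) (Function.update x 0 (2 * ηc + x (j + 1))) := by
  have hg' := hg.update_neg (j + 1)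
  have h := mainAt_node hτ h1 h5 hH ih hg' hj hR
  have h' := h.neg hτ hent h1 h3 hj (by
    rw [Function.update_of_ne (by omega)]
    exact hg'.Gf_ne hτ _)
  convert h' using 1
  ext l
  by_cases hl : l = 0
  · subst hl
    simp [Function.update_of_ne]
  · by_cases hl' : l = j + 1
    · subst hl'; simp
    · simp [hl, hl']

lemma PolyDeg.exists_evenTheta {τ : ℂ} (hτ : 0 < τ.im) {d : ℕ} {f : ℂ → ℂ} (hf : PolyDeg d f) :
    ∃ P ∈ evenTheta τ d, ∀ z, Dth τ z ≠ 0 → P z = Dth τ z ^ d * f (wfun τ z) := by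
  obtain ⟨Q, hQ, hfQ⟩ := hf
  refine ⟨∑ k ∈ Finset.range (d + 1), (Q.coeff k * kap τ ^ k) •
    (fun z => (th1 z τ ^ 2) ^ k * Dth τ z ^ (d - k)), ?_, fun z hz => ?_⟩
  · refine Submodule.sum_mem _ fun k hk => Submodule.smul_mem _ _ ?_
    have := evenTheta_mul (evenTheta_pow (th1_sq_mem hτ) k) (evenTheta_pow (Dth_mem hτ) (d - k))
    rwa [mul_one, mul_one, Nat.add_sub_cancel' (by simpa [Nat.lt_succ_iff] using hk)] at this
  · rw [hfQ, Polynomial.eval_eq_sum_range' (Nat.lt_succ_of_le hQ), Finset.sum_apply, Finset.mul_sum]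
    refine Finset.sum_congr rfl fun k hk => ?_
    simp only [Pi.smul_apply, smul_eq_mul]
    have hk' : k ≤ d := by simpa [Nat.lt_succ_iff] using hk
    have e : (wfun τ z * Dth τ z) ^ k = (kap τ * th1 z τ ^ 2) ^ k := by rw [wfun_mul_Dth hz]
    have e2 : Dth τ z ^ d = Dth τ z ^ k * Dth τ z ^ (d - k) := by rw [← pow_add, Nat.add_sub_cancel' hk']
    rw [mul_pow, mul_pow] at e
    rw [e2]
    linear_combination (-Q.coeff k * Dth τ z ^ (d - k)) * e

/-- The position of the variable paired with the `k`-th node. -/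
def nodeIdx (n : ℕ) (k : Fin ((n + 3) / 2)) : ℕ := min (2 * k) n

lemma nodeIdx_lt (n : ℕ) (k : Fin ((n + 3) / 2)) : nodeIdx n k + 1 < n + 2 := by
  unfold nodeIdx; omega

lemma nodeIdx_injective (n : ℕ) : Function.Injective (nodeIdx n) := by
  intro k l h
  have := k.2
  have := l.2
  unfold nodeIdx at h
  ext
  omega

lemma Rn_swap_nodeIdx {ζ : ℂ} {H : (k : ℕ) → (Fin (2 * k) → ℂ) → ℂ} (hH : IsHFamily ζ H) (n : ℕ)
    (k : Fin ((n + 3) / 2)) (w : ℕ → ℂ) :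
    Rn H (n + 2) (fun l => w (Equiv.swap 1 (nodeIdx n k + 1) l)) = Rn H (n + 2) w := by
  by_cases h : 2 * (k : ℕ) ≤ n
  · rw [nodeIdx, min_eq_left h]
    exact Rn_swap_odd hH (by omega) w
  · obtain ⟨m, hm⟩ : ∃ m, n = 2 * m + 1 := ⟨n / 2, by have := k.2; omega⟩
    rw [nodeIdx, min_eq_right (by omega)]
    subst hm
    exact Rn_swap_last hH (k := m + 1) (by omega) w

/-- The sign attached to a Boolean. -/
def bsgn (s : Bool) : ℚ := if s then 1 else -1

lemma bsgn_ne (s : Bool) : bsgn s ≠ 0 := by cases s <;> simp [bsgn]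

lemma Gen.sep_nodes {τ : ℂ} (hτ : 0 < τ.im) {x : ℕ → ℂ} (h : Gen τ x) {i j : ℕ} {s t : Bool}
    (hij : i ≠ j ∨ s ≠ t) : ThSep τ (2 * ηc + bsgn s * x i) (2 * ηc + bsgn t * x j) := by
  by_cases hij' : i = j
  · subst hij'
    have hst : bsgn t = -bsgn s := by
      have : s ≠ t := by simpa using hij
      revert this
      cases s <;> cases t <;> simp [bsgn]
    rw [hst]
    constructor
    · have := th1_real_ne_zero hτ (4 / 3) 0 (fun h => not_int_of_between 1 (by norm_num) (by norm_num) h.1)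
      convert this using 2
      unfold ηc; push_cast; ring
    · convert h.th1_ne_one hτ i (a := 2 * bsgn s) (mul_ne_zero two_ne_zero (bsgn_ne s)) 0 0 using 2
      push_cast; ring
  · constructor
    · convert h.th1_ne hτ hij' (a := bsgn s) (bsgn_ne s) (bsgn t) (4 / 3) 0 using 2
      unfold ηc; push_cast; ring
    · convert h.th1_ne hτ hij' (a := bsgn s) (bsgn_ne s) (-bsgn t) 0 0 using 2
      push_cast; ring

lemma Gen.sep_node {τ : ℂ} (hτ : 0 < τ.im) {x : ℕ → ℂ} (h : Gen τ x) (i : ℕ) (s : Bool) (r t : ℚ) :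
    ThSep τ (r * Real.pi + t * (Real.pi * τ)) (2 * ηc + bsgn s * x i) := by
  constructor
  · convert h.th1_ne_one hτ i (a := bsgn s) (bsgn_ne s) (r + 2 / 3) t using 2
    unfold ηc; push_cast; ring
  · convert h.th1_ne_one hτ i (a := -bsgn s) (neg_ne_zero.2 (bsgn_ne s)) (r - 2 / 3) t using 2
    unfold ηc; push_cast; ring

lemma Gen.Dth_node_ne {τ : ℂ} (hτ : 0 < τ.im) {x : ℕ → ℂ} (h : Gen τ x) (i : ℕ) (s : Bool) :
    Dth τ (2 * ηc + bsgn s * x i) ≠ 0 := by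
  refine mul_ne_zero ?_ ?_
  · convert h.th1_ne_one hτ i (a := bsgn s) (bsgn_ne s) (1 / 3) 0 using 2
    unfold ηc; push_cast; ring
  · convert h.th1_ne_one hτ i (a := bsgn s) (bsgn_ne s) 1 0 using 2
    unfold ηc; push_cast; ring

lemma mainAt_succ {τ : ℂ} (hτ : 0 < τ.im) {Ψ : PsiFam} (hent : PsiEntire Ψ) (h1 : PsiP1 τ Ψ) (h2 : PsiP2 τ Ψ)
    (h3 : PsiP3 τ Ψ) (h5 : PsiP5 τ Ψ) {H : (k : ℕ) → (Fin (2 * k) → ℂ) → ℂ} (hH : IsHFamily (zet τ) H) {n : ℕ}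
    {C : ℂ} (ih : ∀ x, Gen τ x → MainAt τ Ψ H n C x) {x : ℕ → ℂ} (hg : Gen τ x) :
    MainAt τ Ψ H (n + 2) (C * stepC τ n) x := by
  set C' := C * stepC τ n with hC
  obtain ⟨P, hP, hPz⟩ := (polyDeg_Rn hH n fun i => wfun τ (x i)).exists_evenTheta hτ
  set K : ℂ := ∏ i ∈ Finset.range (n + 1), Gf τ (x (i + 1)) * Dth τ (x (i + 1)) ^ (n + 2) with hK
  have hE := Zn_mem hτ hent h1 h2 h3 (n := n + 2) (m := 0) (by omega) x
  have hF := evenTheta_mul (evenTheta_mul (Gf_mul_neg_mem hτ) (Dth_mem hτ)) hP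
  rw [show n + 2 + 2 = n + 4 by ring] at hE
  rw [show 2 + 1 + (n + 1) = n + 4 by ring] at hF
  have hF := (evenTheta τ (n + 4)).smul_mem (C' * K) hF
  have hiff : ∀ z, Dth τ z ≠ 0 → MainAt τ Ψ H (n + 2) C' (Function.update x 0 z) →
      Zn τ Ψ (n + 2) (Function.update x 0 z) = C' * K * (Gf τ z * Dth τ z * P z) := by
    intro z hz h
    rw [h, hPz z hz, Finset.prod_range_succ', hK]
    simp only [Function.update_self, Function.update_of_ne (Nat.succ_ne_zero _)]
    have : (fun i => wfun τ (Function.update x 0 z i)) = Function.update (fun i => wfun τ (x i)) 0 (wfun τ z) := by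
      ext i
      by_cases hi : i = 0
      · subst hi; simp
      · simp [hi]
    rw [this]
    ring
  have hnode : ∀ i : Fin ((n + 3) / 2) × Bool,
      MainAt τ Ψ H (n + 2) C' (Function.update x 0 (2 * ηc + bsgn i.2 * x (nodeIdx n i.1 + 1))) := by
    rintro ⟨k, s⟩
    cases s
    · have := mainAt_node hτ h1 h5 hH ih hg (nodeIdx_lt n k) (Rn_swap_nodeIdx hH n k)
      convert this using 2
      simp [bsgn]; ring
    · have := mainAt_node_neg hτ hent h1 h3 h5 hH ih hg (nodeIdx_lt n k) (Rn_swap_nodeIdx hH n k)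
      convert this using 2
      simp [bsgn]
  have key := evenTheta_eq_zero_of_nodes hτ (by omega)
    (fun i : Fin ((n + 3) / 2) × Bool => 2 * ηc + bsgn i.2 * x (nodeIdx n i.1 + 1))
    (by simp only [Fintype.card_prod, Fintype.card_fin, Fintype.card_bool]; omega)
    (fun i j h => hg.sep_nodes hτ (by
      by_contra! hc
      exact h (Prod.ext (nodeIdx_injective n (by omega)) hc.2)))
    (fun i => by
      convert hg.sep_node hτ (nodeIdx n i.1 + 1) i.2 (-1 / 3) 0 using 1
      unfold ηc; push_cast; ring)
    (fun i => by
      convert hg.sep_node hτ (nodeIdx n i.1 + 1) i.2 (5 / 6) (1 / 2) using 1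
      unfold β3c ηc; push_cast; ring)
    (fun i => by
      convert hg.sep_node hτ (nodeIdx n i.1 + 1) i.2 (1 / 3) (1 / 2) using 1
      unfold β4c ηc; push_cast; ring)
    ((evenTheta τ (n + 4)).sub_mem hE hF)
    (by
      simp only [Pi.sub_apply, Pi.smul_apply, smul_eq_mul, Dth_neg]
      rw [Zn_neg_eta h5 (n + 1) _ (by simp), Dth, sub_self, th1_zero]; ring)
    (by
      simp only [Pi.sub_apply, Pi.smul_apply, smul_eq_mul, Gf_neg_beta3]; ring)
    (by
      simp only [Pi.sub_apply, Pi.smul_apply, smul_eq_mul, Gf_neg_beta4]; ring)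
    (by
      intro i
      simp only [Pi.sub_apply, Pi.smul_apply, smul_eq_mul]
      rw [hiff _ (hg.Dth_node_ne hτ _ _) (hnode i)]
      ring)
  have hx := congrFun key (x 0)
  simp only [Pi.sub_apply, Pi.smul_apply, smul_eq_mul, Pi.zero_apply, Function.update_eq_self] at hx
  rw [hPz _ (hg.Dth_ne hτ 0)] at hx
  have hw : Function.update (fun i => wfun τ (x i)) 0 (wfun τ (x 0)) = fun i => wfun τ (x i) :=
    Function.update_eq_self _ _
  rw [hw] at hx
  unfold MainAt
  refine mul_right_cancel₀ (hg.Gf_neg_ne hτ 0) ?_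
  rw [Finset.prod_range_succ', ← hK]
  linear_combination hx

/-- The constants in the explicit expression of the scalar product. -/
def mainC (τ : ℂ) : ℕ → ℂ
  | 0 => 1
  | 1 => -(th2 0 τ / (2 * kap τ * th4 0 (2 * τ)))
  | n + 2 => mainC τ n * stepC τ n

lemma mainAt_gen {τ : ℂ} (hτ : 0 < τ.im) {Ψ : PsiFam} (hent : PsiEntire Ψ) (h1 : PsiP1 τ Ψ) (h2 : PsiP2 τ Ψ)
    (h3 : PsiP3 τ Ψ) (h5 : PsiP5 τ Ψ) (h6 : PsiP6 Ψ) {H : (k : ℕ) → (Fin (2 * k) → ℂ) → ℂ}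
    (hH : IsHFamily (zet τ) H) : ∀ (n : ℕ) (x : ℕ → ℂ), Gen τ x → MainAt τ Ψ H n (mainC τ n) x
  | 0, x, _ => by simp [MainAt, Zn_zero h6, Rn_zero hH, mainC]
  | 1, x, hg => by
    rw [MainAt, Zn_one hτ hent h1 h2 h3 h5 h6 x (hg.Gf_neg_ne hτ 0), Rn_one hH, mainC]
    simp
  | n + 2, x, hg => mainAt_succ hτ hent h1 h2 h3 h5 hH (mainAt_gen hτ hent h1 h2 h3 h5 h6 hH n) hg

lemma Dth_zero (τ : ℂ) : Dth τ 0 = -th1 ηc τ ^ 2 := by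
  rw [Dth, zero_sub, zero_add, th1_neg]; ring

lemma wfun_zero (τ : ℂ) : wfun τ 0 = 0 := by
  simp [wfun, th1_zero]

lemma continuousAt_wfun_zero {τ : ℂ} (hτ : 0 < τ.im) : ContinuousAt (wfun τ) 0 := by
  have h := (th1_differentiable hτ).continuous
  have h0 : Dth τ 0 ≠ 0 := by
    rw [Dth_zero]; exact neg_ne_zero.2 (pow_ne_zero 2 (th1_eta_ne hτ))
  unfold wfun
  refine ContinuousAt.div (by fun_prop) ?_ h0
  exact ((h.comp (by fun_prop : Continuous fun x : ℂ => x - ηc)).mul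
    (h.comp (by fun_prop : Continuous fun x : ℂ => x + ηc))).continuousAt

lemma mainAt_update_zero {τ : ℂ} (hτ : 0 < τ.im) {Ψ : PsiFam} (hent : PsiEntire Ψ) (h3 : PsiP3 τ Ψ)
    {H : (k : ℕ) → (Fin (2 * k) → ℂ) → ℂ} (hH : IsHFamily (zet τ) H) {n m : ℕ} (hm : m < n) {C : ℂ} {x : ℕ → ℂ}
    (t : ℕ → ℂ) (ht : Filter.Tendsto t Filter.atTop (𝓝 0))
    (h : ∀ k, MainAt τ Ψ H n C (Function.update x m (t k))) : MainAt τ Ψ H n C (Function.update x m 0) := by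
  have hw : ContinuousAt (fun z => Rn H n fun i => wfun τ (Function.update x m z i)) 0 := by
    refine (continuous_Rn hH n).continuousAt.comp (f := fun z i => wfun τ (Function.update x m z i)) ?_
    refine continuousAt_pi.2 fun i => ?_
    by_cases hi : i = m
    · subst hi
      simpa using continuousAt_wfun_zero hτ
    · simpa [hi] using continuousAt_const
  have hp : Continuous fun z => ∏ i ∈ Finset.range n, Gf τ (Function.update x m z i) *
      Dth τ (Function.update x m z i) ^ n := by
    refine continuous_finsetProd _ fun i _ => ?_
    have hu : Continuous fun z => Function.update x m z i := by
      by_cases hi : i = m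
      · subst hi; simpa using continuous_id'
      · simpa [hi] using continuous_const
    exact ((Gf_differentiable hτ).continuous.comp hu).mul (((Dth_mem hτ).1.continuous.comp hu).pow n)
  refine tendsto_nhds_unique
    (((Zn_differentiable hτ hent h3 hm x).continuous.tendsto 0).comp ht) ?_
  refine (((continuousAt_const.mul hp.continuousAt).mul hw).tendsto.comp ht).congr fun k => ?_
  exact (h k).symm

lemma mainAt_zero {τ : ℂ} (hτ : 0 < τ.im) {Ψ : PsiFam} (hent : PsiEntire Ψ) (h3 : PsiP3 τ Ψ)
    {H : (k : ℕ) → (Fin (2 * k) → ℂ) → ℂ} (hH : IsHFamily (zet τ) H) {n : ℕ} {C : ℂ}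
    (h : ∀ x, Gen τ x → MainAt τ Ψ H n C x) : MainAt τ Ψ H n C fun _ => 0 := by
  have hc : ∀ y : ℂ, Filter.Tendsto (fun k : ℕ => ((1 / (k + 1) : ℚ) : ℂ) * y) Filter.atTop (𝓝 0) := fun y => by
    have := (tendsto_one_div_add_atTop_nhds_zero_nat (𝕜 := ℂ)).mul_const y
    rw [zero_mul] at this
    refine this.congr fun k => ?_
    push_cast
    ring
  have key : ∀ m ≤ n, ∀ x, Gen τ x → MainAt τ Ψ H n C fun i => if i < m then 0 else x i := by
    intro m
    induction m with
    | zero => intro _ x hx; simpa using h x hx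
    | succ m ih =>
      intro hm x hx
      have e : (fun i => if i < m + 1 then 0 else x i) =
          Function.update (fun i => if i < m then 0 else x i) m 0 := by
        ext i
        rcases lt_trichotomy i m with hi | hi | hi
        · simp [hi.ne, hi, hi.trans (Nat.lt_succ_self m)]
        · simp [hi]
        · simp [hi.ne', Nat.not_lt.2 hi.le, show ¬ i < m + 1 by omega]
      rw [e]
      refine mainAt_update_zero hτ hent h3 hH (by omega) (fun k => ((1 / (k + 1) : ℚ) : ℂ) * x m) ?_ fun k => ?_
      · exact hc (x m)
      · have := ih (by omega) _ (hx.update_smul m (c := 1 / (k + 1)) (by positivity))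
        convert this using 1
        ext i
        by_cases hi : i = m
        · subst hi; simp
        · simp [hi]
  obtain ⟨x, hx⟩ := exists_gen τ
  have hn := fun k : ℕ => key n le_rfl _ (hx.smul (fun _ => 1 / (k + 1)) fun _ => by positivity)
  unfold MainAt at hn ⊢
  have hZ : ∀ y : ℕ → ℂ, Zn τ Ψ n (fun i => if i < n then 0 else y i) = Zn τ Ψ n fun _ => 0 := fun y =>
    Zn_congr τ Ψ fun l hl => by simp [hl]
  have hp : ∀ y : ℕ → ℂ, (∏ i ∈ Finset.range n, Gf τ (if i < n then 0 else y i) *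
      Dth τ (if i < n then 0 else y i) ^ n) = ∏ i ∈ Finset.range n, Gf τ 0 * Dth τ 0 ^ n := fun y =>
    Finset.prod_congr rfl fun i hi => by simp [Finset.mem_range.1 hi]
  simp only [hZ, hp] at hn
  refine tendsto_nhds_unique (tendsto_const_nhds (x := Zn τ Ψ n fun _ => 0) (f := Filter.atTop (α := ℕ))) ?_
  refine Filter.Tendsto.congr (fun k => (hn k).symm) (Filter.Tendsto.const_mul _ ?_)
  refine ((continuous_Rn hH n).tendsto _).comp (tendsto_pi_nhds.2 fun i => ?_)
  by_cases hi : i < n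
  · simp [hi]
  · simp only [hi, if_false]
    exact (continuousAt_wfun_zero hτ).tendsto.comp (hc (x i))

lemma Zn_at_zero (τ : ℂ) (Ψ : PsiFam) (n : ℕ) :
    Zn τ Ψ n (fun _ => 0) = (-(th1 ηc (2 * τ) * th4 0 (2 * τ))) ^ n * Ψ n (fun _ => 0) altConf := by
  have h1 : ∀ s : Fin 2, s ≠ 0 → chi τ s 0 = 0 := fun s hs => by simp [chi, hs, th1_zero]
  have h0 : chi τ 0 0 = -(th1 ηc (2 * τ) * th4 0 (2 * τ)) := by
    rw [chi, if_pos rfl, zero_sub, th1_neg, th1_two_eta]; ring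
  rw [Zn, Sg_eq_single fun σ m hm hσ => ?_]
  · rw [Finset.prod_const, Finset.card_range, h0, PsiN]
    congr 2
    · ext j; simp [itl]
    · ext j
      simp only [itl, altConf, flipS]
      have := j.2
      split_ifs <;> first | rfl | omega
  · rw [Finset.prod_eq_zero (Finset.mem_range.2 hm) (h1 _ hσ), zero_mul]

lemma th2_zero_mul_th1_eta {τ : ℂ} (hτ : 0 < τ.im) :
    th2 0 τ * th1 ηc τ = 2 * (th1 ηc (2 * τ) * (kap τ * th4 0 (2 * τ))) := by
  have e := th1_mul_th2_zero ηc hτ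
  rw [kap, div_mul_cancel₀ _ (th4_zero_ne hτ)]
  linear_combination e

lemma stepC_mul {τ : ℂ} (hτ : 0 < τ.im) (n : ℕ) :
    stepC τ n * th1 ηc τ ^ (4 * n + 4) = 2 * th1 ηc (2 * τ) ^ 2 * kap τ ^ (2 * n + 4) := by
  have e := th2_zero_mul_th1_eta hτ
  have h0 := th4_zero_ne hτ
  have h1 := th1_eta_ne hτ
  rw [stepC, div_mul_eq_mul_div, div_eq_iff
    (mul_ne_zero (mul_ne_zero two_ne_zero (pow_ne_zero _ h0)) (pow_ne_zero _ h1))]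
  linear_combination (kap τ ^ (2 * n + 2) * th1 ηc τ ^ (4 * n + 2) *
    (th2 0 τ * th1 ηc τ + 2 * (th1 ηc (2 * τ) * (kap τ * th4 0 (2 * τ))))) * e

lemma mainC_even {τ : ℂ} (hτ : 0 < τ.im) (k : ℕ) :
    mainC τ (2 * k) * th1 ηc τ ^ (4 * k ^ 2) = 2 ^ k * th1 ηc (2 * τ) ^ (2 * k) * kap τ ^ (2 * k ^ 2 + 2 * k) := by
  induction k with
  | zero => simp [mainC]
  | succ k ih =>
    have e := stepC_mul hτ (2 * k)
    rw [show 2 * (k + 1) = 2 * k + 2 by ring, mainC]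
    linear_combination (stepC τ (2 * k) * th1 ηc τ ^ (4 * (2 * k) + 4)) * ih +
      (2 ^ k * th1 ηc (2 * τ) ^ (2 * k) * kap τ ^ (2 * k ^ 2 + 2 * k)) * e

lemma mainC_odd {τ : ℂ} (hτ : 0 < τ.im) (k : ℕ) :
    mainC τ (2 * k + 1) * th1 ηc τ ^ (2 * k + 1) ^ 2 =
      -(2 ^ k * th1 ηc (2 * τ) ^ (2 * k + 1) * kap τ ^ (2 * k ^ 2 + 4 * k)) := by
  induction k with
  | zero =>
    have h0 := th4_zero_ne hτ
    have hk := kap_ne hτ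
    have e := th2_zero_mul_th1_eta hτ
    simp only [mul_zero, zero_add, mainC]
    field_simp
    linear_combination -e
  | succ k ih =>
    have e := stepC_mul hτ (2 * k + 1)
    rw [show 2 * (k + 1) + 1 = 2 * k + 1 + 2 by ring, mainC]
    linear_combination (stepC τ (2 * k + 1) * th1 ηc τ ^ (4 * (2 * k + 1) + 4)) * ih -
      (2 ^ k * th1 ηc (2 * τ) ^ (2 * k + 1) * kap τ ^ (2 * k ^ 2 + 4 * k)) * e

lemma psi_alt {τ : ℂ} (hτ : 0 < τ.im) {Ψ : PsiFam} (hent : PsiEntire Ψ) (h1 : PsiP1 τ Ψ) (h2 : PsiP2 τ Ψ)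
    (h3 : PsiP3 τ Ψ) (h5 : PsiP5 τ Ψ) (h6 : PsiP6 Ψ) {H : (k : ℕ) → (Fin (2 * k) → ℂ) → ℂ}
    (hH : IsHFamily (zet τ) H) (n : ℕ) :
    (-th1 ηc (2 * τ)) ^ n * Ψ n (fun _ => 0) altConf =
      mainC τ n * kap τ ^ n * (-th1 ηc τ ^ 2) ^ n ^ 2 * Rn H n fun _ => 0 := by
  have h := mainAt_zero hτ hent h3 hH (mainAt_gen hτ hent h1 h2 h3 h5 h6 hH n)
  have h0 := th4_zero_ne hτ
  have hG : Gf τ 0 = kap τ * th4 0 (2 * τ) := by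
    rw [Gf, mul_zero, zero_add, th4_two_eta, kap, div_mul_cancel₀ _ h0]
  simp only [MainAt, Zn_at_zero, wfun_zero, Finset.prod_const, Finset.card_range, hG, Dth_zero] at h
  refine mul_right_cancel₀ (pow_ne_zero n h0) ?_
  rw [← neg_mul] at h
  simp only [mul_pow, ← pow_mul, ← sq] at h ⊢
  linear_combination h

lemma Ncoef_eq (τ : ℂ) (n : ℕ) :
    Ncoef τ n = (-1) ^ ((n + 1) / 2) * (th1 ηc τ ^ n ^ 2)⁻¹ * (kap τ ^ (n * (n + 1) / 2))⁻¹ := by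
  rw [Ncoef, kap, ← inv_pow (th4 ηc (2 * τ) / _), inv_div]

lemma neg_one_pow_mul_self (k : ℕ) : ((-1 : ℂ) ^ k) * (-1) ^ k = 1 := by rw [← mul_pow]; norm_num

lemma psiH_even_alt {τ : ℂ} (hτ : 0 < τ.im) {Ψ : PsiFam} (hent : PsiEntire Ψ) (h1 : PsiP1 τ Ψ) (h2 : PsiP2 τ Ψ)
    (h3 : PsiP3 τ Ψ) (h5 : PsiP5 τ Ψ) (h6 : PsiP6 Ψ) {H : (k : ℕ) → (Fin (2 * k) → ℂ) → ℂ}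
    (hH : IsHFamily (zet τ) H) (k : ℕ) :
    psiH τ Ψ (2 * k) altConf = 2 ^ k * H k (fun _ => 0) * H k (padded [J2c]) := by
  have h := psi_alt hτ hent h1 h2 h3 h5 h6 hH (2 * k)
  have hC := mainC_even hτ k
  have hT := th1_eta_ne hτ
  have hκ := kap_ne hτ
  have hq : (kap τ ^ 3 * (1 - zet τ ^ 2)) ^ k = 1 := by rw [kap_pow_zet hτ, one_pow]
  have hs := neg_one_pow_mul_self k
  rw [Rn_even_zero hH (one_sub_zet_ne hτ), (even_two_mul k).neg_pow,
    ((even_two_mul k).pow_of_ne_zero two_ne_zero).neg_pow, neg_pow (1 - zet τ ^ 2)] at h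
  rw [psiH, Ncoef_eq, show (2 * k + 1) / 2 = k by omega,
    show 2 * k * (2 * k + 1) / 2 = 2 * k ^ 2 + k by
      rw [show 2 * k * (2 * k + 1) = 2 * (2 * k ^ 2 + k) by ring, Nat.mul_div_cancel_left _ two_pos]]
  generalize Ψ (2 * k) (fun _ => 0) altConf = X at *
  generalize H k (fun _ => 0) = A at *
  generalize H k (padded [J2c]) = B at *
  generalize 1 - zet τ ^ 2 = q at *
  generalize kap τ = κ at *
  generalize th1 ηc τ = T at *
  generalize mainC τ (2 * k) = C at *
  have ht := pow_ne_zero (2 * k) (th14_eta_ne hτ).1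
  generalize th1 ηc (2 * τ) = t at *
  have key : (-1) ^ k * X = 2 ^ k * A * B * (T ^ (2 * k) ^ 2 * κ ^ (2 * k ^ 2 + k)) := by
    refine mul_left_cancel₀ ht ?_
    calc t ^ (2 * k) * ((-1) ^ k * X) = (-1) ^ k * (t ^ (2 * k) * X) := by ring
      _ = ((-1) ^ k * (-1) ^ k) * (C * T ^ (4 * k ^ 2)) * κ ^ (2 * k) * T ^ (4 * k ^ 2) * q ^ k * A * B := by
        rw [h]; ring
      _ = 2 ^ k * t ^ (2 * k) * κ ^ (2 * k ^ 2 + k) * (κ ^ 3 * q) ^ k * T ^ (4 * k ^ 2) * A * B := by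
        rw [hs, hC]; ring
      _ = _ := by rw [hq]; ring
  field_simp
  linear_combination key

lemma psiH_odd_alt {τ : ℂ} (hτ : 0 < τ.im) {Ψ : PsiFam} (hent : PsiEntire Ψ) (h1 : PsiP1 τ Ψ) (h2 : PsiP2 τ Ψ)
    (h3 : PsiP3 τ Ψ) (h5 : PsiP5 τ Ψ) (h6 : PsiP6 Ψ) {H : (k : ℕ) → (Fin (2 * k) → ℂ) → ℂ}
    (hH : IsHFamily (zet τ) H) (k : ℕ) :
    psiH τ Ψ (2 * k + 1) altConf = 2 ^ k * H k (fun _ => 0) * H (k + 1) (padded [J2c]) := by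
  have h := psi_alt hτ hent h1 h2 h3 h5 h6 hH (2 * k + 1)
  have hC := mainC_odd hτ k
  have hT := th1_eta_ne hτ
  have hκ := kap_ne hτ
  have hq : (kap τ ^ 3 * (1 - zet τ ^ 2)) ^ k = 1 := by rw [kap_pow_zet hτ, one_pow]
  have hs := neg_one_pow_mul_self k
  have hodd : Odd (2 * k + 1) := ⟨k, rfl⟩
  rw [Rn_odd_zero hH (one_sub_zet_ne hτ), hodd.neg_pow, hodd.pow.neg_pow, neg_pow (1 - zet τ ^ 2)] at h
  rw [psiH, Ncoef_eq, show (2 * k + 1 + 1) / 2 = k + 1 by omega,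
    show (2 * k + 1) * (2 * k + 1 + 1) / 2 = 2 * k ^ 2 + 3 * k + 1 by
      rw [show (2 * k + 1) * (2 * k + 1 + 1) = 2 * (2 * k ^ 2 + 3 * k + 1) by ring,
        Nat.mul_div_cancel_left _ two_pos]]
  generalize Ψ (2 * k + 1) (fun _ => 0) altConf = X at *
  generalize H k (fun _ => 0) = A at *
  generalize H (k + 1) (padded [J2c]) = B at *
  generalize 1 - zet τ ^ 2 = q at *
  generalize kap τ = κ at *
  generalize th1 ηc τ = T at *
  generalize mainC τ (2 * k + 1) = C at *
  have ht := pow_ne_zero (2 * k + 1) (th14_eta_ne hτ).1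
  generalize th1 ηc (2 * τ) = t at *
  have key : (-1) ^ (k + 1) * X = 2 ^ k * A * B * (T ^ (2 * k + 1) ^ 2 * κ ^ (2 * k ^ 2 + 3 * k + 1)) := by
    refine mul_left_cancel₀ ht ?_
    calc t ^ (2 * k + 1) * ((-1) ^ (k + 1) * X) = (-1) ^ k * (-t ^ (2 * k + 1) * X) := by ring
      _ = -(((-1) ^ k * (-1) ^ k) * (C * T ^ (2 * k + 1) ^ 2)) * κ ^ (2 * k + 1) * T ^ (2 * k + 1) ^ 2 *
          q ^ k * A * B := by
        rw [h]; ring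
      _ = 2 ^ k * t ^ (2 * k + 1) * κ ^ (2 * k ^ 2 + 3 * k + 1) * (κ ^ 3 * q) ^ k * T ^ (2 * k + 1) ^ 2 * A * B := by
        rw [hs, hC]; ring
      _ = _ := by rw [hq]; ring
  field_simp
  linear_combination key

theorem stmt18 (τ : ℂ) (hτ : 0 < τ.im) (hp : preal τ) (Ψ : PsiFam)
    (hent : PsiEntire Ψ) (h1 : PsiP1 τ Ψ) (h2 : PsiP2 τ Ψ) (h3 : PsiP3 τ Ψ)
    (h4 : PsiP4 Ψ) (h5 : PsiP5 τ Ψ) (h6 : PsiP6 Ψ)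
    (H : (k : ℕ) → (Fin (2*k) → ℂ) → ℂ) (hH : IsHFamily (zet τ) H) (k : ℕ) :
    psiH τ Ψ (2*k) altConf = 2^k * H k (fun _ => 0) * H k (padded [J2c]) ∧
    psiH τ Ψ (2*k+1) altConf = 2^k * H k (fun _ => 0) * H (k+1) (padded [J2c]) :=
  ⟨psiH_even_alt hτ hent h1 h2 h3 h5 h6 hH k, psiH_odd_alt hτ hent h1 h2 h3 h5 h6 hH k⟩

end
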